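/- arXiv:1107.4818 — 2 statements merged into one kernel-verified Lean document; each statement's English description precedes it below -/
import Mathlib

section
/- Let S be a tightly connected fundamental inverse semigroup with no isolated nontrivial subgroups and let T be an arbitrary semigroup. Then the monoids PSA(S) and PSA(T) are isomorphic if and only if either S and T are isomorphic semigroups, or T is an inverse semigroup and (S, ≤) and (T, ≤) are chains with respect to their natural partial orders admitting a dual order-isomorphism of (S, ≤) onto (T, ≤). -/
/-- An inverse semigroup: a semigroup in which every element `a` has a unique
element `a⁻¹` with `a * a⁻¹ * a = a` and `a⁻¹ * a * a⁻¹ = a⁻¹`. -/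
class InverseSemigroup (S : Type*) extends Semigroup S, Inv S where
  mul_inv_mul : ∀ a : S, a * a⁻¹ * a = a
  inv_mul_inv : ∀ a : S, a⁻¹ * a * a⁻¹ = a⁻¹
  inv_unique : ∀ a b : S, a * b * a = a → b * a * b = b → b = a⁻¹

section InvSgDefs

variable (S : Type*) [InverseSemigroup S]

/-- The set of idempotents of `S`. -/
def ES : Set S := {e : S | IsIdempotentElem e}

/-- The set of nongroup elements of `S`. -/
def NS : Set S := {x : S | x * x⁻¹ ≠ x⁻¹ * x}

/-- `N_S ∪ E_S`. -/
def NE : Set S := NS S ∪ ES S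

variable {S}

/-- The order on idempotents: `e ≤ f` iff `e * f = e`. -/
def idemLe (e f : S) : Prop := e * f = e

/-- Strict order on idempotents. -/
def idemLt (e f : S) : Prop := idemLe e f ∧ e ≠ f

/-- The natural partial order on an inverse semigroup: `a ≤ b` iff `a = e * b`
for some idempotent `e`. -/
def natLe (a b : S) : Prop := ∃ e : S, IsIdempotentElem e ∧ a = e * b

/-- Green's relation `𝓡`. -/
def rRel (a b : S) : Prop := a * a⁻¹ = b * b⁻¹

/-- Green's relation `𝓛`. -/
def lRel (a b : S) : Prop := a⁻¹ * a = b⁻¹ * b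

/-- Green's relation `𝓗`. -/
def hRel (a b : S) : Prop := rRel a b ∧ lRel a b

/-- Green's relation `𝓓`. -/
def dRel (a b : S) : Prop := ∃ c : S, rRel a c ∧ lRel c b

/-- `U` is an inverse subsemigroup of `S`: closed under multiplication and inversion. -/
def IsInvSub (U : Set S) : Prop :=
  (∀ a ∈ U, ∀ b ∈ U, a * b ∈ U) ∧ ∀ a ∈ U, a⁻¹ ∈ U

/-- The inverse subsemigroup generated by `X`: the smallest subset of `S`
containing `X` and closed under multiplication and inversion. -/
def genInv (X : Set S) : Set S := ⋂₀ {U : Set S | IsInvSub U ∧ X ⊆ U}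

/-- `e` is `x`-covered by `x * x⁻¹`: `e < x * x⁻¹` and no idempotent `f` of `⟨x⟩`
satisfies `e < f < x * x⁻¹`. -/
def XCov (x e : S) : Prop :=
  idemLt e (x * x⁻¹) ∧
    ∀ f ∈ genInv ({x} : Set S), IsIdempotentElem f →
      ¬(idemLt e f ∧ idemLt f (x * x⁻¹))

/-- `e` is tightly `x`-covered by `x * x⁻¹`. -/
def TightXCov (x e : S) : Prop :=
  XCov x e ∧ (e * x ∈ NS S ∨ IsIdempotentElem (e * x))

/-- A short bypass from `e` to `x * x⁻¹`. -/
def ShortBypass (x e : S) : Prop :=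
  ∃ n : ℕ, 1 ≤ n ∧ ∃ es : ℕ → S,
    es 0 = e ∧ es n = x * x⁻¹ ∧ (∀ k ≤ n, IsIdempotentElem (es k)) ∧
    ∀ k : ℕ, 1 ≤ k → k ≤ n → idemLt (es (k - 1)) (es k) ∧ XCov (es k * x) (es (k - 1))

/-- A tight bypass from `e` to `x * x⁻¹`. -/
def TightBypass (x e : S) : Prop :=
  ∃ n : ℕ, 1 ≤ n ∧ ∃ es : ℕ → S,
    es 0 = e ∧ es n = x * x⁻¹ ∧ (∀ k ≤ n, IsIdempotentElem (es k)) ∧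
    ∀ k : ℕ, 1 ≤ k → k ≤ n → idemLt (es (k - 1)) (es k) ∧ TightXCov (es k * x) (es (k - 1))

variable (S)

/-- `S` is shortly connected. -/
def ShortlyConnected : Prop :=
  ∀ x : S, ∀ e : S, IsIdempotentElem e → idemLt e (x * x⁻¹) → ShortBypass x e

/-- `S` is tightly connected. -/
def TightlyConnected : Prop :=
  ∀ x ∈ NE S, ∀ e : S, IsIdempotentElem e → idemLt e (x * x⁻¹) → TightBypass x e

/-- `S` is fundamental. -/
def Fundamental : Prop :=
  ∀ x y : S, (∀ e : S, IsIdempotentElem e → x⁻¹ * e * x = y⁻¹ * e * y) → x = y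

/-- `S` is combinatorial. -/
def Combinatorial : Prop :=
  ∀ a b : S, a * a⁻¹ = b * b⁻¹ → a⁻¹ * a = b⁻¹ * b → a = b

/-- `S` has no isolated nontrivial subgroups: for every idempotent `e` whose
`𝓗`-class is nontrivial there is an idempotent `f ≠ e` with `e 𝓓 f`. -/
def NoIsolatedNontrivial : Prop :=
  ∀ e : S, IsIdempotentElem e → (∃ h : S, h ≠ e ∧ hRel h e) →
    ∃ f : S, IsIdempotentElem f ∧ f ≠ e ∧ dRel e f

/-- `S` is completely semisimple. -/
def CompletelySemisimple : Prop :=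
  ∀ e f : S, IsIdempotentElem e → IsIdempotentElem f → idemLe e f → dRel e f → e = f

end InvSgDefs

section PSADefs

/-- Composition of partial maps given as graphs (relations): first `α`, then `β`. -/
def relComp {A : Type*} (α β : Set (A × A)) : Set (A × A) :=
  {p : A × A | ∃ b : A, (p.1, b) ∈ α ∧ (b, p.2) ∈ β}

variable {A : Type*} [Semigroup A]

/-- `α` is (the graph of) a partial `s`-automorphism of the semigroup `A`, i.e. an
isomorphism between two subsemigroups of `A` (the empty map included): `α` is
functional, injective, and closed under componentwise multiplication. -/
def IsPSAGraph (α : Set (A × A)) : Prop :=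
  (∀ p ∈ α, ∀ q ∈ α, p.1 = q.1 → p.2 = q.2) ∧
  (∀ p ∈ α, ∀ q ∈ α, p.2 = q.2 → p.1 = q.1) ∧
  (∀ p ∈ α, ∀ q ∈ α, (p.1 * q.1, p.2 * q.2) ∈ α)

theorem IsPSAGraph.comp {α β : Set (A × A)} (hα : IsPSAGraph α) (hβ : IsPSAGraph β) :
    IsPSAGraph (relComp α β) := by
  obtain ⟨f1, i1, m1⟩ := hα
  obtain ⟨f2, i2, m2⟩ := hβ
  refine ⟨?_, ?_, ?_⟩
  · rintro ⟨a, c⟩ ⟨b, hab, hbc⟩ ⟨a', c'⟩ ⟨b', hab', hbc'⟩ h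
    have ha : a = a' := h
    subst ha
    have hb : b = b' := f1 (a, b) hab (a, b') hab' rfl
    subst hb
    exact f2 (b, c) hbc (b, c') hbc' rfl
  · rintro ⟨a, c⟩ ⟨b, hab, hbc⟩ ⟨a', c'⟩ ⟨b', hab', hbc'⟩ h
    have hc : c = c' := h
    subst hc
    have hb : b = b' := i2 (b, c) hbc (b', c) hbc' rfl
    subst hb
    exact i1 (a, b) hab (a', b) hab' rfl
  · rintro ⟨a, c⟩ ⟨b, hab, hbc⟩ ⟨a', c'⟩ ⟨b', hab', hbc'⟩
    exact ⟨b * b', m1 (a, b) hab (a', b') hab', m2 (b, c) hbc (b', c') hbc'⟩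

/-- The partial `s`-automorphism monoid of a semigroup `A`, as a type: its elements
are the graphs of isomorphisms between subsemigroups of `A`. -/
def PSA (A : Type*) [Semigroup A] : Type _ := {α : Set (A × A) // IsPSAGraph α}

/-- The monoid operation of `PSA A`: composition of partial `s`-automorphisms. -/
def psacomp (α β : PSA A) : PSA A := ⟨relComp α.1 β.1, α.2.comp β.2⟩

/-- The natural partial order of a semigroup whose elements are to form an inverse
semigroup: `a ≤ b` iff `a = e * b` for some idempotent `e`. -/
def natLeSg (a b : A) : Prop := ∃ e : A, e * e = e ∧ a = e * b

/-- `A` is an inverse semigroup: every element has a unique generalized inverse. -/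
def IsInverseSgp (A : Type*) [Semigroup A] : Prop :=
  ∀ a : A, ∃! b : A, a * b * a = a ∧ b * a * b = b

end PSADefs


section GenSg
variable {M : Type*} [Semigroup M]

/-- `pw x n` is the power `x ^ (n+1)`. -/
def pw (x : M) : ℕ → M
  | 0 => x
  | n + 1 => pw x n * x

@[simp] theorem pw_zero (x : M) : pw x 0 = x := rfl
theorem pw_succ (x : M) (n : ℕ) : pw x (n + 1) = pw x n * x := rfl

theorem pw_mul (x : M) (m n : ℕ) : pw x m * pw x n = pw x (m + n + 1) := by
  induction n with
  | zero => rfl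
  | succ n ih => rw [pw_succ, ← mul_assoc, ih]; rfl

theorem pw_succ' (x : M) (n : ℕ) : pw x (n + 1) = x * pw x n := by
  have := pw_mul x 0 n
  rw [pw_zero] at this
  rw [this]; congr 1; omega

theorem pw_pw (x : M) (m n : ℕ) : pw (pw x m) n = pw x (m * n + m + n) := by
  induction n with
  | zero => simp
  | succ n ih => rw [pw_succ, ih, pw_mul]; congr 1; ring

theorem pw_idem {x : M} (h : IsIdempotentElem x) (n : ℕ) : pw x n = x := by
  induction n with
  | zero => rfl
  | succ n ih => rw [pw_succ, ih]; exact h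

/-- monogenic subsemigroup -/
def mono (x : M) : Subsemigroup M where
  carrier := {y | ∃ n, y = pw x n}
  mul_mem' := by
    rintro _ _ ⟨m, rfl⟩ ⟨n, rfl⟩
    exact ⟨_, pw_mul x m n⟩

/-- powers with exponent at least two -/
def dsub (x : M) : Subsemigroup M where
  carrier := {y | ∃ n, y = pw x (n + 1)}
  mul_mem' := by
    rintro _ _ ⟨m, rfl⟩ ⟨n, rfl⟩
    exact ⟨m + n + 2, by rw [pw_mul]; congr 1; omega⟩

theorem mem_mono {x y : M} : y ∈ mono x ↔ ∃ n, y = pw x n := Iff.rfl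
theorem mem_dsub {x y : M} : y ∈ dsub x ↔ ∃ n, y = pw x (n + 1) := Iff.rfl
theorem self_mono (x : M) : x ∈ mono x := ⟨0, rfl⟩
theorem pw_mem {A : Subsemigroup M} {x : M} (h : x ∈ A) (n : ℕ) : pw x n ∈ A := by
  induction n with
  | zero => exact h
  | succ n ih => exact A.mul_mem ih h
theorem mono_le {x : M} {A : Subsemigroup M} : mono x ≤ A ↔ x ∈ A := by
  constructor
  · intro h; exact h (self_mono x)
  · rintro h _ ⟨n, rfl⟩; exact pw_mem h n
theorem dsub_le (x : M) : dsub x ≤ mono x := by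
  rintro _ ⟨n, rfl⟩; exact ⟨_, rfl⟩
theorem mem_mono_cases {x y : M} (h : y ∈ mono x) : y = x ∨ y ∈ dsub x := by
  obtain ⟨n, rfl⟩ := h
  cases n with
  | zero => left; rfl
  | succ n => right; exact ⟨n, rfl⟩

theorem mem_mono_idem {e t : M} (he : IsIdempotentElem e) : t ∈ mono e ↔ t = e := by
  constructor
  · rintro ⟨n, rfl⟩; exact pw_idem he n
  · rintro rfl; exact self_mono _

/-- commuting with everything in monogenic -/
theorem mono_comm {x a b : M} (ha : a ∈ mono x) (hb : b ∈ mono x) : a * b = b * a := by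
  obtain ⟨m, rfl⟩ := ha; obtain ⟨n, rfl⟩ := hb
  rw [pw_mul, pw_mul]; congr 1; omega

theorem mono_idem_unique {x a b : M} (ha : a ∈ mono x) (hb : b ∈ mono x)
    (ia : IsIdempotentElem a) (ib : IsIdempotentElem b) : a = b := by
  obtain ⟨m, rfl⟩ := ha; obtain ⟨n, rfl⟩ := hb
  have h1 := pw_idem ia n
  have h2 := pw_idem ib m
  rw [pw_pw] at h1 h2
  rw [← h1, ← h2]; congr 1; ring

/-- `x` is not a power of itself with exponent `≥ 2` -/
def Sharp (x : M) : Prop := x ∉ dsub x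

theorem not_sharp {x : M} (h : ¬ Sharp x) :
    IsIdempotentElem x ∨ ∃ n, x * pw x n * x = x ∧ IsIdempotentElem (x * pw x n) := by
  unfold Sharp at h
  push Not at h
  obtain ⟨n, hn⟩ := h
  cases n with
  | zero => left; exact hn.symm
  | succ n =>
    right
    refine ⟨n, ?_, ?_⟩
    · rw [← pw_succ', ← pw_succ]; exact hn.symm
    · have h1 : x * pw x n * x = x := by rw [← pw_succ', ← pw_succ]; exact hn.symm
      unfold IsIdempotentElem
      rw [← mul_assoc, h1]

/-- if a power repeats then there's an idempotent power -/
theorem idem_of_pw_eq {x : M} {m k : ℕ} (h : pw x m = pw x (m + k + 1)) :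
    ∃ n, IsIdempotentElem (pw x n) := by
  have step : ∀ j, pw x (m + j) = pw x (m + j + (k + 1)) := by
    intro j
    induction j with
    | zero => simpa [add_assoc] using h
    | succ j ih => 
      rw [← add_assoc, pw_succ, ih, ← pw_succ]; congr 1; omega
  have step2 : ∀ i j, pw x (m + j) = pw x (m + j + i * (k + 1)) := by
    intro i
    induction i with
    | zero => intro j; simp
    | succ i ih =>
      intro j
      rw [ih j, add_assoc, step, ]; congr 1; ring
  -- want n with n + n + 1 = n + i (k+1), n ≥ m
  have := step2 (m + 1) ((m + 1) * (k + 1) - 1 - m)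
  have hm : m + ((m + 1) * (k + 1) - 1 - m) = (m + 1) * (k + 1) - 1 := by
    have : (m+1) * (k+1) = m * k + m + k + 1 := by ring
    omega
  rw [hm] at this
  refine ⟨(m + 1) * (k + 1) - 1, ?_⟩
  unfold IsIdempotentElem
  rw [pw_mul, this]
  congr 1

theorem idem_of_not_sharp {x : M} (h : ¬ Sharp x) : ∃ n, IsIdempotentElem (pw x n) := by
  rcases not_sharp h with h | ⟨n, _, h⟩
  · exact ⟨0, h⟩
  · exact ⟨n + 1, by rw [pw_succ']; exact h⟩

theorem le_dsub_or {x : M} {B : Subsemigroup M} (h : B ≤ mono x) : B = mono x ∨ B ≤ dsub x := by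
  by_cases hx : x ∈ B
  · left; exact le_antisymm h (mono_le.2 hx)
  · right
    intro b hb
    rcases mem_mono_cases (h hb) with rfl | h'
    · exact absurd hb hx
    · exact h'

theorem sharp_gen {a p : M} (ha : Sharp a) (h : mono a = mono p) : p = a := by
  have : p ∈ mono a := h ▸ self_mono p
  rcases mem_mono_cases this with h1 | h1
  · exact h1
  · exfalso; apply ha
    have : mono p ≤ dsub a := mono_le.2 h1
    rw [← h] at this
    exact this (self_mono a)

theorem mono_sup_ind {p q : M} {P : M → Prop} (hp : P p) (hq : P q)
    (hm : ∀ a ∈ mono p ⊔ mono q, ∀ b ∈ mono p ⊔ mono q, P a → P b → P (a * b)) {t : M}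
    (ht : t ∈ mono p ⊔ mono q) : P t := by
  let B : Subsemigroup M :=
    { carrier := {t | t ∈ mono p ⊔ mono q ∧ P t}
      mul_mem' := by
        rintro a b ⟨ha, pa⟩ ⟨hb, pb⟩
        exact ⟨mul_mem ha hb, hm a ha b hb pa pb⟩ }
  have : mono p ⊔ mono q ≤ B := sup_le (mono_le.2 ⟨(le_sup_left : mono p ≤ _) (self_mono p), hp⟩)
    (mono_le.2 ⟨(le_sup_right : mono q ≤ _) (self_mono q), hq⟩)
  exact (this ht).2

theorem left_mem_sup (p q : M) : p ∈ mono p ⊔ mono q := (le_sup_left : mono p ≤ _) (self_mono p)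
theorem right_mem_sup (p q : M) : q ∈ mono p ⊔ mono q := (le_sup_right : mono q ≤ _) (self_mono q)

/-- Lemma G. -/
theorem sharp_of_pair (hc : ∀ e f : M, IsIdempotentElem e → IsIdempotentElem f → e * f = f * e)
    {a b : M} (h1 : a * b * a = a) (h2 : b * a * b = b) (h3 : a * b ≠ b * a) : Sharp a := by
  by_contra h
  have iab : IsIdempotentElem (a * b) := by
    unfold IsIdempotentElem; rw [← mul_assoc, h1]
  have iba : IsIdempotentElem (b * a) := by
    unfold IsIdempotentElem; rw [← mul_assoc, h2]
  apply h3
  rcases not_sharp h with h | ⟨n, hn, hi⟩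
  · have e1 := hc _ _ iab h
    have e2 := hc _ _ iba h
    unfold IsIdempotentElem at h
    grind
  · have e1 := hc _ _ iab hi
    have e2 := hc _ _ iba hi
    have e3 : a * pw a n = pw a n * a := by rw [← pw_succ', ← pw_succ]
    generalize pw a n = z at *
    have k1 : a * b = a * z := by
      calc a * b = (a * z * a) * b := by rw [hn]
        _ = a * b * (a * z) := by rw [e1]; simp only [mul_assoc]
        _ = a * z := by rw [← mul_assoc, h1]
    have k2 : b * a = z * a := by
      calc b * a = b * (a * z * a) := by rw [hn]
        _ = (a * z) * (b * a) := by rw [← e2, mul_assoc b a, ← mul_assoc a a, mul_assoc a z, ← e3, mul_assoc]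
        _ = z * (a * b * a) := by rw [e3]; simp only [mul_assoc]
        _ = z * a := by rw [h1]
    rw [k1, k2, e3]

theorem asc {a b : M} (h : a = b) (z : M) : a * z = b * z := by rw [h]
theorem lemC1 {c t v : M} (ic : c * c = c) (h : c * (t * v) * c = c) :
    c * t * (v * c) * (c * t) = c * t := by grind
theorem lemC2 {c t v : M} (ic : c * c = c) (h : c * (t * v) * c = c) :
    v * c * (c * t) * (v * c) = v * c := by grind
theorem lemC3 {c t v : M} (_ : c * c = c) (h : c * (t * v) * c = c) :
    c * t * (v * c) = c := by grind
theorem lemC4 {c t v : M} (ic : c * c = c) (h : c * (t * v) * c = c)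
    (h2 : v * c * (c * t) = c) : c * t * c = c * t := by
  calc c * t * c = c * t * (v * c * (c * t)) := by rw [h2]
    _ = c * t * (v * c) * (c * t) := by simp only [mul_assoc]
    _ = c * t := lemC1 ic h
theorem lemC5 {c t v s : M} (ic : c * c = c) (_ : c * (t * (v * s)) * c = c)
    (h2 : v * s * c * (c * t) = c) : c * (v * (s * c * t)) * c = c := by
  calc c * (v * (s * c * t)) * c = c * (v * s * c * t) * c := by simp only [mul_assoc]
    _ = c * (v * s * (c * c) * t) * c := by rw [ic]
    _ = c * (v * s * c * (c * t)) * c := by simp only [mul_assoc]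
    _ = c := by rw [h2, ic, ic]

/-- Lemma C. -/
theorem lemC {p q c d : M} (ic : IsIdempotentElem c) (hcA : c ∈ mono p ⊔ mono q)
    (hcp : c ∉ mono p) (hcq : c ∉ mono q) (id : IsIdempotentElem d) (hdA : d ∈ mono p ⊔ mono q)
    (hcd : c * d = d * c) (hne : c * d ≠ c) :
    ∃ a ∈ mono p ⊔ mono q, ∃ b ∈ mono p ⊔ mono q,
      a * b * a = a ∧ b * a * b = b ∧ a * b = c ∧ b * a ≠ c := by
  by_contra hcon
  push Not at hcon
  set A := mono p ⊔ mono q with hA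
  let W : M → Prop := fun t => ∃ s ∈ A, c * t * c = c * t ∧ c * t * (s * c) = c ∧ s * c * (c * t) = c
  unfold IsIdempotentElem at ic id
  have cl1 : ∀ t ∈ A, ∀ v ∈ A, c * (t * v) * c = c → W t := by
    intro t ht v hv h
    have := hcon (c * t) (mul_mem hcA ht) (v * c) (mul_mem hv hcA) (lemC1 ic h) (lemC2 ic h) (lemC3 ic h)
    exact ⟨v, hv, lemC4 ic h this, lemC3 ic h, this⟩
  have cl2 : ∀ t ∈ A, ∀ v ∈ A, W (t * v) → W t ∧ W v := by
    rintro t ht v hv ⟨s, hs, h1, h2, h3⟩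
    have h5 : c * (t * (v * s)) * c = c := by clear * - h2; grind
    have hW : W t := cl1 t ht (v * s) (mul_mem hv hs) h5
    have h4 := hcon (c * t) (mul_mem hcA ht) (v * s * c) (mul_mem (mul_mem hv hs) hcA)
      (lemC1 ic h5) (lemC2 ic h5) (lemC3 ic h5)
    exact ⟨hW, cl1 v hv (s * c * t) (mul_mem (mul_mem hs hcA) ht) (lemC5 ic h5 h4)⟩
  have cW : W c := ⟨c, hcA, by rw [ic, ic], by rw [ic, ic], by rw [ic, ic]⟩
  have key : c ∈ A ∧ (W c → ((c ∈ mono p ∨ W q) ∧ (c ∈ mono q ∨ W p))) := by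
    refine ⟨hcA, ?_⟩
    refine mono_sup_ind (p := p) (q := q) (P := fun c => (W c → ((c ∈ mono p ∨ W q) ∧ (c ∈ mono q ∨ W p)))) 
      ?_ ?_ ?_ hcA
    · intro h; exact ⟨Or.inl (self_mono p), Or.inr h⟩
    · intro h; exact ⟨Or.inr h, Or.inl (self_mono q)⟩
    · intro a ha b hb pa pb h
      obtain ⟨wa, wb⟩ := cl2 a ha b hb h
      obtain ⟨a1, a2⟩ := pa wa
      obtain ⟨b1, b2⟩ := pb wb
      constructor
      · rcases a1 with a1 | a1
        · rcases b1 with b1 | b1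
          · left; exact mul_mem a1 b1
          · right; exact b1
        · right; exact a1
      · rcases a2 with a1 | a1
        · rcases b2 with b1 | b1
          · left; exact mul_mem a1 b1
          · right; exact b1
        · right; exact a1
  obtain ⟨k1, k2⟩ := key.2 cW
  have wq := k1.resolve_left hcp
  have wp := k2.resolve_left hcq
  have wd : W d := by
    refine mono_sup_ind (p := p) (q := q) (P := W) wp wq ?_ hdA
    rintro a ha b hb ⟨s, hs, s1, s2, s3⟩ ⟨r, hr, r1, r2, r3⟩
    refine ⟨r * c * s, mul_mem (mul_mem hr hcA) hs, ?_, ?_, ?_⟩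
    · have e1 := asc s1
      have e2 : c * a * (c * b * c) = c * a * (c * b) := by rw [r1]
      simp only [mul_assoc] at e1 e2 ⊢
      rw [e1, e1] at e2
      exact e2
    · have e1 := asc s1
      have e2 : c * a * (c * b * (r * c)) * (s * c) = c := by rw [r2, s1, s2]
      simp only [mul_assoc] at e1 e2 ⊢
      rw [e1] at e2
      exact e2
    · clear * - ic s3 r3; grind
  obtain ⟨s, hs, s1, s2, s3⟩ := wd
  apply hne
  calc c * d = (c * d) * c := by rw [mul_assoc, ← hcd, ← mul_assoc, ic]
    _ = (c * d) * (c * d * (s * c)) := by rw [s2]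
    _ = (c * d * c) * d * (s * c) := by simp only [mul_assoc]
    _ = c * (d * d) * (s * c) := by rw [s1]; simp only [mul_assoc]
    _ = c := by rw [id, s2]

end GenSg


section InvBasics
variable {S : Type*} [InverseSemigroup S]

theorem imi (a : S) : a * a⁻¹ * a = a := InverseSemigroup.mul_inv_mul a
theorem iim (a : S) : a⁻¹ * a * a⁻¹ = a⁻¹ := InverseSemigroup.inv_mul_inv a
theorem imi' (a : S) : a * (a⁻¹ * a) = a := by rw [← mul_assoc, imi]
theorem iim' (a : S) : a⁻¹ * (a * a⁻¹) = a⁻¹ := by rw [← mul_assoc, iim]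
theorem iuniq {a b : S} (h1 : a * b * a = a) (h2 : b * a * b = b) : b = a⁻¹ :=
  InverseSemigroup.inv_unique a b h1 h2

theorem ii (a : S) : a⁻¹⁻¹ = a := (iuniq (iim a) (imi a)).symm
theorem iinj {a b : S} (h : a⁻¹ = b⁻¹) : a = b := by rw [← ii a, h, ii]
theorem idem_inv {e : S} (h : IsIdempotentElem e) : e⁻¹ = e := by
  unfold IsIdempotentElem at h
  exact (iuniq (by rw [h, h]) (by rw [h, h])).symm
theorem idem_r (a : S) : IsIdempotentElem (a * a⁻¹) := by
  unfold IsIdempotentElem; rw [← mul_assoc, imi]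
theorem idem_l (a : S) : IsIdempotentElem (a⁻¹ * a) := by
  unfold IsIdempotentElem; rw [← mul_assoc, iim]

theorem idem_mul_aux {e f : S} (he : IsIdempotentElem e) (hf : IsIdempotentElem f) :
    IsIdempotentElem (e * f) := by
  unfold IsIdempotentElem at he hf
  have h1 := imi (e * f)
  have h2 := iim (e * f)
  generalize hx : (e * f)⁻¹ = x at h1 h2
  have k : f * x * e = (e * f)⁻¹ := by
    apply iuniq
    · calc e * f * (f * x * e) * (e * f) = e * (f * f) * x * (e * e) * f := by simp only [mul_assoc]
        _ = e * f * x * (e * f) := by rw [he, hf]; simp only [mul_assoc]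
        _ = e * f := h1
    · calc f * x * e * (e * f) * (f * x * e) = f * x * (e * e) * (f * f) * x * e := by
            simp only [mul_assoc]
        _ = f * (x * (e * f) * x) * e := by rw [he, hf]; simp only [mul_assoc]
        _ = f * x * e := by rw [h2]
  rw [hx] at k
  have ix : IsIdempotentElem x := by
    unfold IsIdempotentElem
    calc x * x = (f * x * e) * (f * x * e) := by rw [k]
      _ = f * (x * (e * f) * x) * e := by simp only [mul_assoc]
      _ = x := by rw [h2, k]
  have : e * f = x := by
    rw [← idem_inv ix, ← hx, ii]
  rw [this]; exact ix

theorem idem_comm {e f : S} (he : IsIdempotentElem e) (hf : IsIdempotentElem f) :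
    e * f = f * e := by
  have h1 := idem_mul_aux he hf
  have h2 := idem_mul_aux hf he
  have : f * e = (e * f)⁻¹ := by
    unfold IsIdempotentElem at *
    apply iuniq
    · calc e * f * (f * e) * (e * f) = e * (f * f) * (e * e) * f := by simp only [mul_assoc]
        _ = e * f * (e * f) := by rw [he, hf]; simp only [mul_assoc]
        _ = e * f := h1
    · calc f * e * (e * f) * (f * e) = f * (e * e) * (f * f) * e := by simp only [mul_assoc]
        _ = f * e * (f * e) := by rw [he, hf]; simp only [mul_assoc]
        _ = f * e := h2
  rw [this, idem_inv h1]

theorem idem_mul {e f : S} (he : IsIdempotentElem e) (hf : IsIdempotentElem f) :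
    IsIdempotentElem (e * f) := idem_mul_aux he hf

theorem mir (a b : S) : (a * b)⁻¹ = b⁻¹ * a⁻¹ := by
  symm
  have h := idem_comm (idem_l a) (idem_r b)
  apply iuniq
  · calc a * b * (b⁻¹ * a⁻¹) * (a * b) = a * ((b * b⁻¹) * (a⁻¹ * a)) * b := by simp only [mul_assoc]
      _ = (a * a⁻¹ * a) * (b * b⁻¹ * b) := by rw [← h]; simp only [mul_assoc]
      _ = a * b := by rw [imi, imi]
  · calc b⁻¹ * a⁻¹ * (a * b) * (b⁻¹ * a⁻¹) = b⁻¹ * ((a⁻¹ * a) * (b * b⁻¹)) * a⁻¹ := by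
          simp only [mul_assoc]
      _ = (b⁻¹ * b * b⁻¹) * (a⁻¹ * a * a⁻¹) := by rw [h]; simp only [mul_assoc]
      _ = b⁻¹ * a⁻¹ := by rw [iim, iim]

/-- `τ`-conjugation gives idempotents -/
theorem idem_conj {e : S} (he : IsIdempotentElem e) (x : S) : IsIdempotentElem (x⁻¹ * e * x) := by
  have h := idem_comm he (idem_r x)
  unfold IsIdempotentElem at *
  calc x⁻¹ * e * x * (x⁻¹ * e * x) = x⁻¹ * (e * (x * x⁻¹)) * e * x := by simp only [mul_assoc]
    _ = (x⁻¹ * x * x⁻¹) * (e * e) * x := by rw [h]; simp only [mul_assoc]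
    _ = _ := by rw [iim, he]
theorem idem_conj' {e : S} (he : IsIdempotentElem e) (x : S) : IsIdempotentElem (x * e * x⁻¹) := by
  have := idem_conj he x⁻¹
  rwa [ii] at this

theorem push_r {e : S} (he : IsIdempotentElem e) (x : S) : e * x = x * (x⁻¹ * e * x) := by
  have h := idem_comm he (idem_r x)
  calc e * x = e * (x * x⁻¹ * x) := by rw [imi]
    _ = e * (x * x⁻¹) * x := by simp only [mul_assoc]
    _ = _ := by rw [h]; simp only [mul_assoc]
theorem push_l {e : S} (he : IsIdempotentElem e) (x : S) : x * e = (x * e * x⁻¹) * x := by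
  have h := idem_comm he (idem_l x)
  calc x * e = x * (x⁻¹ * x) * e := by rw [imi']
    _ = x * ((x⁻¹ * x) * e) := by simp only [mul_assoc]
    _ = _ := by rw [← h]; simp only [mul_assoc]

/-- conjugation is multiplicative on idempotents -/
theorem cj_mul {e f : S} (_ : IsIdempotentElem e) (hf : IsIdempotentElem f) (x : S) :
    x⁻¹ * (e * f) * x = (x⁻¹ * e * x) * (x⁻¹ * f * x) := by
  have h := push_r hf x
  calc x⁻¹ * (e * f) * x = x⁻¹ * e * (f * x) := by simp only [mul_assoc]
    _ = _ := by rw [h]; simp only [mul_assoc]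

theorem conj_back {e x : S} (he : IsIdempotentElem e) (h : e * (x * x⁻¹) = e) :
    x * (x⁻¹ * e * x) * x⁻¹ = e := by
  calc x * (x⁻¹ * e * x) * x⁻¹ = (x * x⁻¹) * e * (x * x⁻¹) := by simp only [mul_assoc]
    _ = e := by rw [← idem_comm he (idem_r x), h, h]
theorem conj_back' {e x : S} (he : IsIdempotentElem e) (h : e * (x⁻¹ * x) = e) :
    x⁻¹ * (x * e * x⁻¹) * x = e := by
  have := conj_back (x := x⁻¹) he (by rwa [ii])
  rwa [ii] at this

theorem mul_rng {e : S} (he : IsIdempotentElem e) (x : S) :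
    (e * x) * (e * x)⁻¹ = e * (x * x⁻¹) := by
  rw [mir, idem_inv he]
  calc e * x * (x⁻¹ * e) = e * ((x * x⁻¹) * e) := by simp only [mul_assoc]
    _ = _ := by rw [← idem_comm he (idem_r x), ← mul_assoc, he]
theorem mul_dom {e : S} (he : IsIdempotentElem e) (x : S) :
    (e * x)⁻¹ * (e * x) = x⁻¹ * e * x := by
  rw [mir, idem_inv he]
  calc x⁻¹ * e * (e * x) = x⁻¹ * (e * e) * x := by simp only [mul_assoc]
    _ = _ := by rw [he]

/-- natural order toolkit -/
theorem natLe_iff {a b : S} : natLe a b ↔ a = a * a⁻¹ * b := by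
  constructor
  · rintro ⟨e, he, rfl⟩
    rw [mul_rng he]
    calc e * b = e * (b * b⁻¹ * b) := by rw [imi]
      _ = (e * e) * (b * b⁻¹ * b) := by rw [he]
      _ = _ := by rw [he]; simp only [mul_assoc]
  · intro h; exact ⟨_, idem_r a, h⟩
theorem natLe_refl (a : S) : natLe a a := ⟨_, idem_r a, (imi a).symm⟩
theorem natLe_left {e : S} (he : IsIdempotentElem e) (a : S) : natLe (e * a) a := ⟨e, he, rfl⟩
theorem natLe_right {e : S} (he : IsIdempotentElem e) (a : S) : natLe (a * e) a :=
  ⟨_, idem_conj' he a, push_l he a⟩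
theorem natLe_trans {a b c : S} (h1 : natLe a b) (h2 : natLe b c) : natLe a c := by
  obtain ⟨e, he, rfl⟩ := h1
  obtain ⟨f, hf, rfl⟩ := h2
  exact ⟨e * f, idem_mul he hf, by rw [mul_assoc]⟩
theorem natLe_mul {a b c d : S} (h1 : natLe a b) (h2 : natLe c d) : natLe (a * c) (b * d) := by
  obtain ⟨e, he, rfl⟩ := h1
  obtain ⟨f, hf, rfl⟩ := h2
  refine ⟨e * (b * f * b⁻¹), idem_mul he (idem_conj' hf b), ?_⟩
  calc e * b * (f * d) = e * (b * f) * d := by simp only [mul_assoc]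
    _ = e * ((b * f * b⁻¹) * b) * d := by rw [← push_l hf b]
    _ = _ := by simp only [mul_assoc]
theorem natLe_inv {a b : S} (h : natLe a b) : natLe a⁻¹ b⁻¹ := by
  obtain ⟨e, he, rfl⟩ := h
  rw [mir, idem_inv he]; exact natLe_right he _
theorem natLe_antisymm {a b : S} (h1 : natLe a b) (h2 : natLe b a) : a = b := by
  have e1 := natLe_iff.1 h1
  have e2 := natLe_iff.1 h2
  calc a = a * a⁻¹ * b := e1
    _ = (a * a⁻¹) * (b * b⁻¹ * a) := by rw [← e2]
    _ = (b * b⁻¹) * (a * a⁻¹ * a) := by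
        rw [← mul_assoc, idem_comm (idem_r a) (idem_r b)]; simp only [mul_assoc]
    _ = b := by rw [imi, ← e2]
theorem natLe_idem {a e : S} (he : IsIdempotentElem e) (h : natLe a e) : IsIdempotentElem a := by
  obtain ⟨f, hf, rfl⟩ := h
  exact idem_mul hf he
theorem natLe_idem_iff {e f : S} (he : IsIdempotentElem e) : natLe e f ↔ e * f = e := by
  rw [natLe_iff, idem_inv he, he]; exact eq_comm
theorem natLe_of_idemLe {e f : S} (he : IsIdempotentElem e) (h : e * f = e) : natLe e f :=
  ⟨e, he, h.symm⟩
theorem natLe_rng {a b : S} (h : natLe a b) : natLe (a * a⁻¹) (b * b⁻¹) :=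
  natLe_mul h (natLe_inv h)
theorem natLe_dom {a b : S} (h : natLe a b) : natLe (a⁻¹ * a) (b⁻¹ * b) :=
  natLe_mul (natLe_inv h) h
theorem natLe_eq_of_rng {a b : S} (h : natLe a b) (h2 : a * a⁻¹ = b * b⁻¹) : a = b := by
  rw [natLe_iff, h2, imi] at h; exact h
theorem natLe_pw {a b : S} (h : natLe a b) (n : ℕ) : natLe (pw a n) (pw b n) := by
  induction n with
  | zero => exact h
  | succ n ih => exact natLe_mul ih h
theorem pw_inv (a : S) (n : ℕ) : (pw a n)⁻¹ = pw a⁻¹ n := by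
  induction n with
  | zero => rfl
  | succ n ih => rw [pw_succ, mir, ih, pw_succ']

theorem sharp_NS {x : S} (h : x ∈ NS S) : Sharp x :=
  sharp_of_pair (fun _ _ h1 h2 => idem_comm h1 h2) (imi x) (iim x) h
theorem inv_NS {x : S} (h : x ∈ NS S) : x⁻¹ ∈ NS S := by
  intro h2; rw [ii] at h2; exact h h2.symm
theorem NS_not_idem {x : S} (h : x ∈ NS S) : ¬ IsIdempotentElem x := by
  intro h2; apply h; rw [idem_inv h2]

end InvBasics


section BiLemma
variable {M : Type*} [Semigroup M]

theorem pw_shift {p : M} {n k : ℕ} (h : pw p n = pw p (n + k)) (i : ℕ) :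
    pw p n = pw p (n + i * k) := by
  have step : ∀ j, pw p (n + j) = pw p (n + j + k) := by
    intro j
    induction j with
    | zero => simpa using h
    | succ j ih => rw [← add_assoc, pw_succ, ih, ← pw_succ]; congr 1; omega
  induction i with
  | zero => simp
  | succ i ih => rw [ih, step]; congr 1; ring

theorem mul_pw_of_left {c p : M} (h : c * p = p) (n : ℕ) : c * pw p n = pw p n := by
  induction n with
  | zero => exact h
  | succ n ih => rw [pw_succ, ← mul_assoc, ih]
theorem mul_pw_of_right {c p : M} (h : p * c = p) (n : ℕ) : pw p n * c = pw p n := by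
  induction n with
  | zero => exact h
  | succ n ih => rw [pw_succ, mul_assoc, h]

theorem biT {p q c : M} (P : M → Prop) (Pm : ∀ a b, P a → P b → P (a * b)) (Pp : P p) (Pq : P q)
    (Pc : P c) (ic : c * c = c) (hu : ∀ u, P u → u * u = u → u * c = u ∧ c * u = u)
    (hcp : ∀ n, pw p n ≠ c)
    (Bi : ∀ a b, P a → P b → a * b * a = a → b * a * b = b → a * b = c → b * a ≠ c →
      ((∃ n, a = pw p n) ∧ ∃ m, b = pw q m) ∨ ((∃ n, a = pw q n) ∧ ∃ m, b = pw p m))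
    {n m : ℕ} (hab : pw p n * pw q m = c) (hba : pw q m * pw p n ≠ c)
    (h1 : pw p n * pw q m * pw p n = pw p n) (h2 : pw q m * pw p n * pw q m = pw q m) :
    c * p = p ∧ ∃ k, p * pw q k = c := by
  have Ppw : ∀ z, P z → ∀ i, P (pw z i) := by
    intro z hz i
    induction i with
    | zero => exact hz
    | succ i ih => exact Pm _ _ ih hz
  have Pa := Ppw p Pp n
  have Pb := Ppw q Pq m
  have iba : pw q m * pw p n * (pw q m * pw p n) = pw q m * pw p n := by
    rw [← mul_assoc, h2]
  obtain ⟨u1, u2⟩ := hu _ (Pm _ _ Pb Pa) iba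
  have hca : c * pw p n = pw p n := by rw [← hab, h1]
  have hac : pw p n * c = pw p n := by
    calc pw p n * c = pw p n * pw q m * pw p n * c := by rw [h1]
      _ = pw p n * (pw q m * pw p n * c) := by simp only [mul_assoc]
      _ = pw p n := by rw [u1, ← mul_assoc, h1]
  have hbc : pw q m * c = pw q m := by rw [← hab, ← mul_assoc, h2]
  -- the inverse d of c * p
  have hd : ∃ d, P d ∧ d * c = d ∧ c * p * d = c := by
    cases n with
    | zero => exact ⟨pw q m, Pb, hbc, by rw [mul_assoc]; change c * (pw p 0 * pw q m) = c; rw [hab, ic]⟩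
    | succ n =>
      refine ⟨pw p n * pw q m, Pm _ _ (Ppw p Pp n) Pb, by rw [mul_assoc, hbc], ?_⟩
      rw [pw_succ'] at hab
      calc c * p * (pw p n * pw q m) = c * (p * pw p n * pw q m) := by simp only [mul_assoc]
        _ = c := by rw [hab, ic]
  obtain ⟨d, Pd, hdc, hcpd⟩ := hd
  by_cases hcase : d * (c * p) = c
  · exfalso
    have hcpc : c * p * c = c * p := by
      calc c * p * c = c * p * (d * (c * p)) := by rw [hcase]
        _ = (c * p * d) * (c * p) := by simp only [mul_assoc]
        _ = c * c * p := by rw [hcpd, mul_assoc]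
        _ = c * p := by rw [ic]
    have ind : ∀ i, (∃ u, u * (c * pw p i) = c) ∧ c * pw p i * c = c * pw p i := by
      intro i
      induction i with
      | zero => exact ⟨⟨d, hcase⟩, hcpc⟩
      | succ i ih =>
        obtain ⟨⟨u, hu1⟩, hi⟩ := ih
        have e : c * pw p (i + 1) = c * pw p i * (c * p) := by
          rw [pw_succ, ← mul_assoc, ← mul_assoc, hi]
        refine ⟨⟨d * u, ?_⟩, ?_⟩
        · rw [e]
          calc d * u * (c * pw p i * (c * p)) = d * (u * (c * pw p i)) * (c * p) := by
                simp only [mul_assoc]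
            _ = c := by rw [hu1, hdc, hcase]
        · rw [e, mul_assoc _ (c * p), hcpc]
    obtain ⟨⟨u, hu1⟩, -⟩ := ind n
    rw [hca] at hu1
    apply hba
    calc pw q m * pw p n = c * (pw q m * pw p n) := u2.symm
      _ = u * (pw p n * pw q m * pw p n) := by rw [← hu1]; simp only [mul_assoc]
      _ = c := by rw [h1, hu1]
  · have g1 : c * p * d * (c * p) = c * p := by rw [hcpd, ← mul_assoc, ic]
    have g2 : d * (c * p) * d = d := by rw [mul_assoc, hcpd, hdc]
    rcases Bi (c * p) d (Pm _ _ Pc Pp) Pd g1 g2 hcpd hcase with ⟨⟨k, hk⟩, ⟨j, hj⟩⟩ | ⟨⟨k, hk⟩, ⟨j, hj⟩⟩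
    · have hk0 : k = 0 := by
        by_contra hk0
        obtain ⟨k', rfl⟩ := Nat.exists_eq_succ_of_ne_zero hk0
        have e1 : pw p n = pw p (n + (k' + 1)) := by
          calc pw p n = c * pw p n := hca.symm
            _ = pw p (n + (k' + 1)) := by
              cases n with
              | zero => rw [pw_zero, hk]; congr 1; omega
              | succ n => rw [pw_succ', ← mul_assoc, hk, pw_mul]; congr 1; omega
        have e2 := pw_shift e1 (n + 1)
        have e3 : pw p n = pw (pw p n) k' * pw p n := by
          rw [pw_pw, pw_mul]
          exact e2.trans (by congr 1; ring)
        apply hcp (n * k' + n + k')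
        rw [← pw_pw]
        calc pw (pw p n) k' = pw (pw p n) k' * c := (mul_pw_of_right hac k').symm
          _ = (pw (pw p n) k' * pw p n) * pw q m := by rw [← hab, mul_assoc]
          _ = c := by rw [← e3, hab]
      subst hk0
      rw [pw_zero] at hk
      refine ⟨hk, j, ?_⟩
      rw [← hj, ← hcpd, hk]
    · exfalso
      have e1 : c * pw p (j + 1) = c := by
        rw [pw_succ', ← mul_assoc, ← hj, hcpd]
      have e2 : ∀ i, c * pw (pw p (j + 1)) i = c := by
        intro i
        induction i with
        | zero => exact e1
        | succ i ih => rw [pw_succ, ← mul_assoc, ih, e1]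
      have e3 := e2 n
      have e4 : pw (pw p (j + 1)) n = pw (pw p n) (j + 1) := by
        rw [pw_pw, pw_pw]; congr 1; ring
      rw [e4, mul_pw_of_left hca, pw_pw] at e3
      exact hcp _ e3

theorem pw_op (p : M) (n : ℕ) : pw (MulOpposite.op p) n = MulOpposite.op (pw p n) := by
  induction n with
  | zero => rfl
  | succ n ih => rw [pw_succ, ih, pw_succ']; rfl

open MulOpposite in
theorem biT2 {p q c : M} (P : M → Prop) (Pm : ∀ a b, P a → P b → P (a * b)) (Pp : P p) (Pq : P q)
    (Pc : P c) (ic : c * c = c) (hu : ∀ u, P u → u * u = u → u * c = u ∧ c * u = u)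
    (hcp : ∀ n, pw p n ≠ c) (hcq : ∀ n, pw q n ≠ c)
    (hdis : ∀ n m, pw p n ≠ pw q m)
    (Bi : ∀ a b, P a → P b → a * b * a = a → b * a * b = b → a * b = c → b * a ≠ c →
      ((∃ n, a = pw p n) ∧ ∃ m, b = pw q m) ∨ ((∃ n, a = pw q n) ∧ ∃ m, b = pw p m))
    {n m : ℕ} (hab : pw p n * pw q m = c) (hba : pw q m * pw p n ≠ c)
    (h1 : pw p n * pw q m * pw p n = pw p n) (h2 : pw q m * pw p n * pw q m = pw q m) :
    c * p = p ∧ p * c = p ∧ c * q = q ∧ q * c = q ∧ p * q = c ∧ q * p ≠ c := by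
  obtain ⟨cp, k, hk⟩ := biT P Pm Pp Pq Pc ic hu hcp Bi hab hba h1 h2
  have hop := biT (M := Mᵐᵒᵖ) (p := op q) (q := op p) (c := op c) (fun z => P z.unop)
    (fun a b ha hb => Pm _ _ hb ha) Pq Pp Pc (by rw [← op_mul, ic])
    (fun u hu1 hu2 => by
      have := hu u.unop hu1 (by rw [← unop_mul, hu2])
      exact ⟨unop_injective (by simpa using this.2), unop_injective (by simpa using this.1)⟩)
    (fun n h => hcq n (op_injective (by rw [← pw_op, h])))
    (fun a b ha hb h1 h2 h3 h4 => by
      have := Bi b.unop a.unop hb ha (by rw [← unop_mul, ← unop_mul, ← mul_assoc, h2])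
        (by rw [← unop_mul, ← unop_mul, ← mul_assoc, h1]) (by rw [← unop_mul, h3]; rfl)
        (fun h => h4 (unop_injective (by simpa using h)))
      rcases this with ⟨⟨n, hn⟩, ⟨m, hm⟩⟩ | ⟨⟨n, hn⟩, ⟨m, hm⟩⟩
      · left
        exact ⟨⟨m, by rw [pw_op, ← hm]; rfl⟩, ⟨n, by rw [pw_op, ← hn]; rfl⟩⟩
      · right
        exact ⟨⟨m, by rw [pw_op, ← hm]; rfl⟩, ⟨n, by rw [pw_op, ← hn]; rfl⟩⟩)
    (n := m) (m := n) (by rw [pw_op, pw_op, ← op_mul, hab])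
    (by rw [pw_op, pw_op, ← op_mul]; exact fun h => hba (op_injective h))
    (by rw [pw_op, pw_op, ← op_mul, ← op_mul, ← mul_assoc, h2])
    (by rw [pw_op, pw_op, ← op_mul, ← op_mul, ← mul_assoc, h1])
  obtain ⟨qc, l, hl⟩ := hop
  rw [← op_mul] at qc
  have qc := op_injective qc
  rw [pw_op, ← op_mul] at hl
  have hl := op_injective hl
  have Ppw : ∀ z, P z → ∀ i, P (pw z i) := by
    intro z hz i
    induction i with
    | zero => exact hz
    | succ i ih => exact Pm _ _ ih hz
  have pc : p * c = p := by
    have i1 : pw q k * p * (pw q k * p) = pw q k * p := by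
      calc pw q k * p * (pw q k * p) = pw q k * (p * pw q k) * p := by simp only [mul_assoc]
        _ = pw q k * p := by rw [hk, mul_assoc, cp]
    have := (hu _ (Pm _ _ (Ppw q Pq k) Pp) i1).1
    calc p * c = c * p * c := by rw [cp]
      _ = p * (pw q k * p * c) := by rw [← hk]; simp only [mul_assoc]
      _ = (p * pw q k) * p := by rw [this, mul_assoc]
      _ = p := by rw [hk, cp]
  have cq : c * q = q := by
    have i1 : q * pw p l * (q * pw p l) = q * pw p l := by
      calc q * pw p l * (q * pw p l) = q * (pw p l * q) * pw p l := by simp only [mul_assoc]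
        _ = q * pw p l := by rw [hl, qc]
    have := (hu _ (Pm _ _ Pq (Ppw p Pp l)) i1).2
    calc c * q = c * (q * c) := by rw [qc]
      _ = (c * (q * pw p l)) * q := by rw [← hl]; simp only [mul_assoc]
      _ = q * (pw p l * q) := by rw [this, mul_assoc]
      _ = q := by rw [hl, qc]
  have pq : p * q = c := by
    cases k with
    | zero => exact hk
    | succ k =>
      cases l with
      | zero => exact hl
      | succ l =>
        exfalso
        apply hdis l k
        rw [pw_succ'] at hk
        rw [pw_succ] at hl
        calc pw p l = pw p l * c := (mul_pw_of_right pc l).symm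
          _ = (pw p l * p * q) * pw q k := by rw [← hk]; simp only [mul_assoc]
          _ = pw q k := by rw [hl, mul_pw_of_left cq]
  refine ⟨cp, pc, cq, qc, pq, ?_⟩
  intro hqp
  apply hba
  have : ∀ i, pw q i * pw p i = c := by
    intro i
    induction i with
    | zero => exact hqp
    | succ i ih =>
      rw [pw_succ', pw_succ]
      calc q * pw q i * (pw p i * p) = q * (pw q i * pw p i) * p := by simp only [mul_assoc]
        _ = c := by rw [ih, qc, hqp]
  have this2 : ∀ i, pw p i * pw q i = c := by
    intro i
    induction i with
    | zero => exact pq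
    | succ i ih =>
      rw [pw_succ', pw_succ]
      calc p * pw p i * (pw q i * q) = p * (pw p i * pw q i) * q := by simp only [mul_assoc]
        _ = c := by rw [ih, pc, pq]
  -- b * a = c since b is a two-sided unit
  calc pw q m * pw p n = pw q m * pw p n * (pw q m * pw p m) := by
        rw [this, mul_assoc, mul_pw_of_right pc]
    _ = pw q m * (pw p n * pw q m) * pw p m := by simp only [mul_assoc]
    _ = c := by rw [hab, mul_pw_of_right qc, this]

/-- normal form -/
theorem normForm {p q c : M} (pq : p * q = c) (cp : c * p = p) (pc : p * c = p) (cq : c * q = q)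
    (qc : q * c = q) {s : M} (hs : s ∈ mono p ⊔ mono q) :
    s = c ∨ (∃ n, s = pw p n) ∨ (∃ n, s = pw q n) ∨ ∃ n m, s = pw q n * pw p m := by
  let NF : M → Prop := fun s =>
    s = c ∨ (∃ n, s = pw p n) ∨ (∃ n, s = pw q n) ∨ ∃ n m, s = pw q n * pw p m
  have hp : ∀ s, NF s → NF (p * s) := by
    rintro s (rfl | ⟨n, rfl⟩ | ⟨n, rfl⟩ | ⟨n, m, rfl⟩)
    · rw [pc]; exact Or.inr (Or.inl ⟨0, rfl⟩)
    · exact Or.inr (Or.inl ⟨n + 1, (pw_succ' p n).symm⟩)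
    · cases n with
      | zero => exact Or.inl pq
      | succ n =>
        right; right; left
        exact ⟨n, by rw [pw_succ', ← mul_assoc, pq, mul_pw_of_left cq]⟩
    · cases n with
      | zero =>
        right; left
        exact ⟨m, by rw [pw_zero, ← mul_assoc, pq, mul_pw_of_left cp]⟩
      | succ n =>
        right; right; right
        exact ⟨n, m, by rw [pw_succ', ← mul_assoc, ← mul_assoc, pq, mul_pw_of_left cq]⟩
  have hq : ∀ s, NF s → NF (q * s) := by
    rintro s (rfl | ⟨n, rfl⟩ | ⟨n, rfl⟩ | ⟨n, m, rfl⟩)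
    · rw [qc]; exact Or.inr (Or.inr (Or.inl ⟨0, rfl⟩))
    · exact Or.inr (Or.inr (Or.inr ⟨0, n, rfl⟩))
    · exact Or.inr (Or.inr (Or.inl ⟨n + 1, (pw_succ' q n).symm⟩))
    · exact Or.inr (Or.inr (Or.inr ⟨n + 1, m, by rw [pw_succ', mul_assoc]⟩))
  have key : NF s ∧ ∀ t, NF t → NF (s * t) := by
    refine mono_sup_ind (P := fun s => NF s ∧ ∀ t, NF t → NF (s * t)) ?_ ?_ ?_ hs
    · exact ⟨Or.inr (Or.inl ⟨0, rfl⟩), hp⟩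
    · exact ⟨Or.inr (Or.inr (Or.inl ⟨0, rfl⟩)), hq⟩
    · rintro a _ b _ ⟨a1, a2⟩ ⟨b1, b2⟩
      exact ⟨a2 _ b1, fun t ht => by rw [mul_assoc]; exact a2 _ (b2 _ ht)⟩
  exact key.1

theorem normForm_l {p q c : M} (pq : p * q = c) (cp : c * p = p) (pc : p * c = p) (cq : c * q = q)
    (qc : q * c = q) {s : M} (hs : s ∈ mono p ⊔ mono q) :
    s = c ∨ s ∈ mono p ∨ q * p * s = s := by
  have e : q * p * q = q := by rw [mul_assoc, pq, qc]
  rcases normForm pq cp pc cq qc hs with h | h | ⟨n, rfl⟩ | ⟨n, m, rfl⟩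
  · exact Or.inl h
  · exact Or.inr (Or.inl h)
  · exact Or.inr (Or.inr (mul_pw_of_left e n))
  · exact Or.inr (Or.inr (by rw [← mul_assoc, mul_pw_of_left e n]))

theorem normForm_r {p q c : M} (pq : p * q = c) (cp : c * p = p) (pc : p * c = p) (cq : c * q = q)
    (qc : q * c = q) {s : M} (hs : s ∈ mono p ⊔ mono q) :
    s = c ∨ s ∈ mono q ∨ s * (q * p) = s := by
  have e : p * (q * p) = p := by rw [← mul_assoc, pq, cp]
  rcases normForm pq cp pc cq qc hs with h | ⟨n, rfl⟩ | h | ⟨n, m, rfl⟩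
  · exact Or.inl h
  · exact Or.inr (Or.inr (mul_pw_of_right e n))
  · exact Or.inr (Or.inl h)
  · exact Or.inr (Or.inr (by rw [mul_assoc, mul_pw_of_right e m]))

end BiLemma


/-- A lattice isomorphism between subsemigroup lattices together with the induced map
on idempotents. -/
structure LData (S T : Type*) [Semigroup S] [Semigroup T] where
  L : Subsemigroup S ≃o Subsemigroup T
  th : S → T
  hi : ∀ e, IsIdempotentElem e → IsIdempotentElem (th e)
  hL : ∀ e, IsIdempotentElem e → L (mono e) = mono (th e)
  hs : ∀ t, IsIdempotentElem t → ∃ e, IsIdempotentElem e ∧ th e = t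

section LD
variable {M N : Type*} [Semigroup M] [Semigroup N]

theorem exists_gen (L : Subsemigroup M ≃o Subsemigroup N) {x : M} (hx : Sharp x) :
    ∃ p, L (mono x) = mono p := by
  have h1 : L (dsub x) < L (mono x) := by
    apply L.strictMono
    refine lt_of_le_of_ne (dsub_le x) ?_
    intro h
    exact hx (h ▸ self_mono x)
  obtain ⟨p, hp, hp2⟩ := SetLike.exists_of_lt h1
  refine ⟨p, ?_⟩
  have h2 : L.symm (mono p) ≤ mono x := by
    rw [← L.symm_apply_apply (mono x)]
    exact L.symm.monotone (mono_le.2 hp)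
  rcases le_dsub_or h2 with h | h
  · rw [← h, L.apply_symm_apply]
  · exfalso
    apply hp2
    have := L.monotone h
    rw [L.apply_symm_apply] at this
    exact this (self_mono p)

theorem symm_dsub_le (L : Subsemigroup M ≃o Subsemigroup N) {x : M} {p : N} (hp : Sharp p)
    (h : L (mono x) = mono p) : L.symm (dsub p) ≤ dsub x := by
  have h2 : L.symm (dsub p) ≤ mono x := by
    rw [← L.symm_apply_apply (mono x), h]
    exact L.symm.monotone (dsub_le p)
  rcases le_dsub_or h2 with h3 | h3
  · exfalso
    apply hp
    have := congrArg L h3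
    rw [L.apply_symm_apply, h] at this
    rw [this]; exact self_mono p
  · exact h3

theorem LData.mem (D : LData M N) {e : M} (he : IsIdempotentElem e) {A : Subsemigroup M} :
    D.th e ∈ D.L A ↔ e ∈ A := by
  rw [← mono_le, ← D.hL e he, D.L.le_iff_le, mono_le]

theorem LData.inj (D : LData M N) {e f : M} (he : IsIdempotentElem e) (hf : IsIdempotentElem f)
    (h : D.th e = D.th f) : e = f := by
  have := D.hL e he
  rw [h, ← D.hL f hf] at this
  have := D.L.injective this
  have h2 : e ∈ mono f := this ▸ self_mono e
  exact (mem_mono_idem hf).1 h2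

/-- the map is multiplicative on idempotents -/
def LData.Up (D : LData M N) : Prop :=
  ∀ e f, IsIdempotentElem e → IsIdempotentElem f → D.th (e * f) = D.th e * D.th f

theorem regular_l {a b t : M} (h1 : a * b * a = a) (h2 : b * a * b = b)
    (ht : t ∈ mono a ⊔ mono b) : a * b * t = t ∨ b * a * t = t := by
  refine mono_sup_ind (P := fun t => a * b * t = t ∨ b * a * t = t) (Or.inl h1) (Or.inr h2) ?_ ht
  rintro s _ t _ (h | h) _
  · left; rw [← mul_assoc, h]
  · right; rw [← mul_assoc, h]

end LD

section LF
variable {S T : Type*} [InverseSemigroup S] [Semigroup T]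

theorem LData.comm (D : LData S T) (hU : D.Up) {u v : T} (hu : IsIdempotentElem u)
    (hv : IsIdempotentElem v) : u * v = v * u := by
  obtain ⟨e, he, rfl⟩ := D.hs u hu
  obtain ⟨f, hf, rfl⟩ := D.hs v hv
  rw [← hU _ _ he hf, ← hU _ _ hf he, idem_comm he hf]

theorem rng_mul (s t : S) : (s * t) * (s * t)⁻¹ = s * (t * t⁻¹) * s⁻¹ := by
  rw [mir]; simp only [mul_assoc]
theorem le_of_le_rng_mul {g s t : S} (h : g * ((s * t) * (s * t)⁻¹) = g) : g * (s * s⁻¹) = g := by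
  rw [rng_mul] at h
  calc g * (s * s⁻¹) = g * (s * (t * t⁻¹) * s⁻¹) * (s * s⁻¹) := by rw [h]
    _ = g * (s * (t * t⁻¹) * (s⁻¹ * s * s⁻¹)) := by simp only [mul_assoc]
    _ = g := by rw [iim, h]
theorem le_of_conj {s j : S} (hj : IsIdempotentElem j) (h : s * s⁻¹ * (s * j * s⁻¹) = s * s⁻¹) :
    s⁻¹ * s * j = s⁻¹ * s := by
  calc s⁻¹ * s * j = (s⁻¹ * s) * (s⁻¹ * s) * j := by rw [idem_l s]
    _ = (s⁻¹ * s) * (j * (s⁻¹ * s)) := by rw [mul_assoc, idem_comm hj (idem_l s)]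
    _ = (s⁻¹ * s * s⁻¹) * s * j * s⁻¹ * s := by rw [iim]; simp only [mul_assoc]
    _ = s⁻¹ * (s * s⁻¹ * (s * j * s⁻¹)) * s := by simp only [mul_assoc]
    _ = s⁻¹ * s := by rw [h, ← mul_assoc, iim]

/-- the small elements -/
def JJ (x s : S) : Prop := ¬ (x * x⁻¹ * (s * s⁻¹) = x * x⁻¹) ∧ ¬ (x⁻¹ * x * (s * s⁻¹) = x⁻¹ * x)

theorem JJ_inv {x s : S} (h : JJ x s) : JJ x⁻¹ s := by
  unfold JJ at *; rw [ii]; exact ⟨h.2, h.1⟩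
theorem JJ_right {x s : S} (h : JJ x s) (t : S) : JJ x (s * t) :=
  ⟨fun h1 => h.1 (le_of_le_rng_mul h1), fun h1 => h.2 (le_of_le_rng_mul h1)⟩

/-- incomparability -/
def Inc (x : S) : Prop := ¬ (x * x⁻¹ * (x⁻¹ * x) = x * x⁻¹) ∧ ¬ (x⁻¹ * x * (x * x⁻¹) = x⁻¹ * x)
theorem Inc_inv {x : S} (h : Inc x) : Inc x⁻¹ := by
  unfold Inc at *; rw [ii]; exact ⟨h.2, h.1⟩

theorem JJ_x {x t : S} (hx : Inc x) (h : ¬ (x⁻¹ * x * (t * t⁻¹) = x⁻¹ * x)) : JJ x (x * t) := by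
  constructor
  · rw [rng_mul]; intro h1; exact h (le_of_conj (idem_r t) h1)
  · intro h1; exact hx.2 (le_of_le_rng_mul h1)
theorem JJ_f {x t : S} (hx : Inc x) (h : ¬ (x⁻¹ * x * (t * t⁻¹) = x⁻¹ * x)) :
    JJ x (x⁻¹ * x * t) := by
  constructor
  · intro h1
    have := le_of_le_rng_mul h1
    rw [idem_inv (idem_l x), idem_l x] at this
    exact hx.1 this
  · intro h1; rw [mul_rng (idem_l x), ← mul_assoc, idem_l x] at h1; exact h h1
theorem JJ_y {x t : S} (hx : Inc x) (h : ¬ (x * x⁻¹ * (t * t⁻¹) = x * x⁻¹)) : JJ x (x⁻¹ * t) := by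
  have := JJ_x (Inc_inv hx) (t := t) (by rwa [ii])
  have := JJ_inv this
  rwa [ii] at this

theorem inc_elems {x : S} (hx : Inc x) {s : S} (hs : s ∈ mono x ⊔ mono x⁻¹) :
    s = x ∨ s = x⁻¹ ∨ s = x * x⁻¹ ∨ s = x⁻¹ * x ∨ JJ x s := by
  let Q : S → Prop := fun s => s = x ∨ s = x⁻¹ ∨ s = x * x⁻¹ ∨ s = x⁻¹ * x ∨ JJ x s
  have hfe : ¬ (x⁻¹ * x * ((x * x⁻¹) * (x * x⁻¹)⁻¹) = x⁻¹ * x) := by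
    rw [idem_inv (idem_r x), idem_r x]; exact hx.2
  have hef : ¬ (x * x⁻¹ * ((x⁻¹ * x) * (x⁻¹ * x)⁻¹) = x * x⁻¹) := by
    rw [idem_inv (idem_l x), idem_l x]; exact hx.1
  have hp : ∀ s, Q s → Q (x * s) := by
    rintro s (rfl | rfl | rfl | rfl | h)
    · right; right; right; right; exact JJ_x hx hx.2
    · right; right; left; rfl
    · right; right; right; right; exact JJ_x hx hfe
    · left; exact imi' x
    · right; right; right; right; exact JJ_x hx h.2
  have hq : ∀ s, Q s → Q (x⁻¹ * s) := by
    rintro s (rfl | rfl | rfl | rfl | h)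
    · right; right; right; left; rfl
    · right; right; right; right; exact JJ_y hx (by rw [ii]; exact hx.1)
    · right; left; exact iim' x
    · right; right; right; right; exact JJ_y hx hef
    · right; right; right; right; exact JJ_y hx h.1
  have key : Q s ∧ ∀ t, Q t → Q (s * t) := by
    refine mono_sup_ind (P := fun s => Q s ∧ ∀ t, Q t → Q (s * t)) ?_ ?_ ?_ hs
    · exact ⟨Or.inl rfl, hp⟩
    · exact ⟨Or.inr (Or.inl rfl), hq⟩
    · rintro a _ b _ ⟨a1, a2⟩ ⟨b1, b2⟩
      exact ⟨a2 _ b1, fun t ht => by rw [mul_assoc]; exact a2 _ (b2 _ ht)⟩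
  exact key.1

/-- the subsemigroup `{x, x⁻¹x} ∪ JJ`. -/
def incX (x : S) (hx : Inc x) : Subsemigroup S where
  carrier := {s | s = x ∨ s = x⁻¹ * x ∨ JJ x s}
  mul_mem' := by
    rintro a b (rfl | rfl | ha) (rfl | rfl | hb)
    · right; right; exact JJ_x hx hx.2
    · left; exact imi' _
    · right; right; exact JJ_x hx hb.2
    · right; right; exact JJ_f hx hx.2
    · right; left; exact idem_l _
    · right; right; exact JJ_f hx hb.2
    all_goals exact Or.inr (Or.inr (JJ_right ha _))

/-- the subsemigroup `{x⁻¹, x⁻¹x} ∪ JJ`. -/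
def incY (x : S) (hx : Inc x) : Subsemigroup S where
  carrier := {s | s = x⁻¹ ∨ s = x⁻¹ * x ∨ JJ x s}
  mul_mem' := by
    have hef : ¬ (x * x⁻¹ * ((x⁻¹ * x) * (x⁻¹ * x)⁻¹) = x * x⁻¹) := by
      rw [idem_inv (idem_l x), idem_l x]; exact hx.1
    rintro a b (rfl | rfl | ha) (rfl | rfl | hb)
    · right; right; exact JJ_y hx (by rw [ii]; exact hx.1)
    · right; right; exact JJ_y hx hef
    · right; right; exact JJ_y hx hb.1
    · left; exact iim _
    · right; left; exact idem_l _
    · right; right; exact JJ_f hx hb.2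
    all_goals exact Or.inr (Or.inr (JJ_right ha _))

theorem inc_pair {x : S} (hx : Inc x) {z w : S} (hz : z ∈ mono x ⊔ mono x⁻¹)
    (hw : w ∈ mono x ⊔ mono x⁻¹) (iz : ¬ IsIdempotentElem z) (iw : ¬ IsIdempotentElem w)
    (he : x * x⁻¹ ∈ mono z ⊔ mono w) : (z = x ∧ w = x⁻¹) ∨ (z = x⁻¹ ∧ w = x) := by
  have hnx : x ≠ x⁻¹ := by
    intro h; apply hx.1
    have : x * x⁻¹ = x⁻¹ * x := by rw [← h]
    rw [← this, idem_r]
  have hJe : ¬ JJ x (x * x⁻¹) := by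
    intro h; apply h.1; rw [idem_inv (idem_r x), idem_r x, idem_r x]
  have hex : x * x⁻¹ ∉ incX x hx := by
    rintro (h | h | h)
    · apply hx.1
      have h3 : x⁻¹ = x := by
        have := idem_inv (idem_r x)
        rw [h] at this; exact this
      exact absurd h3.symm hnx
    · apply hx.1; rw [← h, idem_r]
    · exact hJe h
  have hey : x * x⁻¹ ∉ incY x hx := by
    rintro (h | h | h)
    · have := idem_inv (idem_r x)
      rw [h, ii] at this; exact hnx this
    · apply hx.1; rw [← h, idem_r]
    · exact hJe h
  have cases3 : ∀ z ∈ mono x ⊔ mono x⁻¹, ¬ IsIdempotentElem z → z = x ∨ z = x⁻¹ ∨ JJ x z := by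
    intro z hz iz
    rcases inc_elems hx hz with h | h | h | h | h
    · exact Or.inl h
    · exact Or.inr (Or.inl h)
    · exact absurd (h ▸ idem_r x) iz
    · exact absurd (h ▸ idem_l x) iz
    · exact Or.inr (Or.inr h)
  have nX : ¬ (z ∈ incX x hx ∧ w ∈ incX x hx) := by
    rintro ⟨h1, h2⟩
    exact hex (sup_le (mono_le.2 h1) (mono_le.2 h2) he)
  have nY : ¬ (z ∈ incY x hx ∧ w ∈ incY x hx) := by
    rintro ⟨h1, h2⟩
    exact hey (sup_le (mono_le.2 h1) (mono_le.2 h2) he)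
  rcases cases3 z hz iz with h1 | h1 | h1 <;> rcases cases3 w hw iw with h2 | h2 | h2
  · exact absurd ⟨Or.inl h1, Or.inl h2⟩ nX
  · exact Or.inl ⟨h1, h2⟩
  · exact absurd ⟨Or.inl h1, Or.inr (Or.inr h2)⟩ nX
  · exact Or.inr ⟨h1, h2⟩
  · exact absurd ⟨Or.inl h1, Or.inl h2⟩ nY
  · exact absurd ⟨Or.inl h1, Or.inr (Or.inr h2)⟩ nY
  · exact absurd ⟨Or.inr (Or.inr h1), Or.inl h2⟩ nX
  · exact absurd ⟨Or.inr (Or.inr h1), Or.inl h2⟩ nY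
  · exact absurd ⟨Or.inr (Or.inr h1), Or.inr (Or.inr h2)⟩ nX

/-- pulling back a nongroup pair -/
theorem pull_pair (D : LData S T) (hU : D.Up) {A : Subsemigroup S} {e : S} (he : IsIdempotentElem e)
    {a b : T} (ha : a ∈ D.L A) (hb : b ∈ D.L A) (h1 : a * b * a = a) (h2 : b * a * b = b)
    (h3 : a * b = D.th e) (h4 : b * a ≠ D.th e) :
    Sharp a ∧ Sharp b ∧ ∃ z ∈ A, ∃ w ∈ A, D.L (mono z) = mono a ∧ D.L (mono w) = mono b ∧
      ¬ IsIdempotentElem z ∧ ¬ IsIdempotentElem w ∧ e ∈ mono z ⊔ mono w := by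
  have hne : a * b ≠ b * a := by rw [h3]; exact h4.symm
  have sa : Sharp a := sharp_of_pair (fun _ _ hu hv => D.comm hU hu hv) h1 h2 hne
  have sb : Sharp b := sharp_of_pair (fun _ _ hu hv => D.comm hU hu hv) h2 h1 hne.symm
  have main : ∀ a, Sharp a → a ∈ D.L A → ∃ z ∈ A, D.L (mono z) = mono a ∧ ¬ IsIdempotentElem z := by
    intro a sa ha
    obtain ⟨z, hz⟩ := exists_gen D.L.symm sa
    have hz' : D.L (mono z) = mono a := by rw [← hz, D.L.apply_symm_apply]
    refine ⟨z, ?_, hz', ?_⟩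
    · rw [← mono_le, ← D.L.le_iff_le, hz', mono_le]; exact ha
    · intro iz
      rw [D.hL z iz] at hz'
      have : a = D.th z := (mem_mono_idem (D.hi z iz)).1 (hz' ▸ self_mono a)
      apply sa
      have i := D.hi z iz
      rw [← this] at i
      exact ⟨0, i.symm⟩
  obtain ⟨z, hz, hz1, hz2⟩ := main a sa ha
  obtain ⟨w, hw, hw1, hw2⟩ := main b sb hb
  refine ⟨sa, sb, z, hz, w, hw, hz1, hw1, hz2, hw2, ?_⟩
  rw [← D.mem he, map_sup, hz1, hw1, ← h3]
  exact mul_mem (left_mem_sup a b) (right_mem_sup a b)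

theorem not_mem_mono_rng {x : S} (hx : x ∈ NS S) : x * x⁻¹ ∉ mono x := by
  rintro ⟨n, hn⟩
  apply sharp_NS hx
  exact ⟨n, by rw [pw_succ, ← hn, imi]⟩
theorem not_mem_mono_rng' {x : S} (hx : x ∈ NS S) : x * x⁻¹ ∉ mono x⁻¹ := by
  rintro ⟨n, hn⟩
  apply sharp_NS (inv_NS hx)
  exact ⟨n, by rw [pw_succ', ← hn, ← mul_assoc, iim]⟩

def FConc (D : LData S T) (x : S) (p q : T) : Prop :=
  p * q * p = p ∧ q * p * q = q ∧
    ((p * q = D.th (x * x⁻¹) ∧ q * p = D.th (x⁻¹ * x)) ∨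
      (q * p = D.th (x * x⁻¹) ∧ p * q = D.th (x⁻¹ * x)))

theorem FConc_inv {D : LData S T} {x : S} {p q : T} (h : FConc D x⁻¹ q p) : FConc D x p q := by
  obtain ⟨h1, h2, h3⟩ := h
  rw [ii] at h3
  rcases h3 with ⟨a, b⟩ | ⟨a, b⟩
  · exact ⟨h2, h1, Or.inl ⟨b, a⟩⟩
  · exact ⟨h2, h1, Or.inr ⟨b, a⟩⟩

theorem lemF_inc (D : LData S T) (hU : D.Up) {x : S} (hx : x ∈ NS S) (hI : Inc x) {p q : T}
    (hp : D.L (mono x) = mono p) (hq : D.L (mono x⁻¹) = mono q) : FConc D x p q := by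
  have hA : D.L (mono x ⊔ mono x⁻¹) = mono p ⊔ mono q := by rw [map_sup, hp, hq]
  have ie := idem_r x
  have jf := idem_l x
  have heA : x * x⁻¹ ∈ mono x ⊔ mono x⁻¹ := mul_mem (left_mem_sup _ _) (right_mem_sup _ _)
  have hfA : x⁻¹ * x ∈ mono x ⊔ mono x⁻¹ := mul_mem (right_mem_sup _ _) (left_mem_sup _ _)
  obtain ⟨a, ha, b, hb, h1, h2, h3, h4⟩ := lemC (p := p) (q := q) (D.hi _ ie)
    (by rw [← hA, D.mem ie]; exact heA)
    (by rw [← hp, D.mem ie]; exact not_mem_mono_rng hx)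
    (by rw [← hq, D.mem ie]; exact not_mem_mono_rng' hx)
    (D.hi _ jf) (by rw [← hA, D.mem jf]; exact hfA) (D.comm hU (D.hi _ ie) (D.hi _ jf))
    (by rw [← hU _ _ ie jf]; intro h; exact hI.1 (D.inj (idem_mul ie jf) ie h))
  rw [← hA] at ha hb
  obtain ⟨sa, sb, z, hz, w, hw, hza, hwb, iz, iw, hezw⟩ := pull_pair D hU ie ha hb h1 h2 h3 h4
  have hsup : D.L (mono x ⊔ mono x⁻¹) = mono a ⊔ mono b := by
    rcases inc_pair hI hz hw iz iw hezw with ⟨rfl, rfl⟩ | ⟨rfl, rfl⟩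
    · rw [map_sup, hza, hwb]
    · rw [map_sup, hza, hwb, sup_comm]
  have hba : b * a = D.th (x⁻¹ * x) := by
    have iba : IsIdempotentElem (b * a) := by
      unfold IsIdempotentElem; rw [← mul_assoc, h2]
    obtain ⟨i, hi, hi2⟩ := D.hs _ iba
    have hiA : i ∈ mono x ⊔ mono x⁻¹ := by
      rw [← D.mem hi, hi2]; exact mul_mem hb ha
    have hth : D.th (x⁻¹ * x) ∈ mono a ⊔ mono b := by rw [← hsup, D.mem jf]; exact hfA
    rcases regular_l h1 h2 hth with h | h
    · rw [h3, ← hU _ _ ie jf] at h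
      have := D.inj (idem_mul ie jf) jf h
      rw [idem_comm ie jf] at this
      exact absurd this hI.2
    · rw [← hi2, ← hU _ _ hi jf] at h
      have hfi := D.inj (idem_mul hi jf) jf h
      rcases regular_l (imi x) (iim x) hiA with h5 | h5
      · exfalso; apply hI.2
        calc x⁻¹ * x * (x * x⁻¹) = (x * x⁻¹) * (i * (x⁻¹ * x)) := by rw [hfi, idem_comm jf ie]
          _ = x⁻¹ * x := by rw [← mul_assoc, h5, hfi]
      · rw [← hi2]; congr 1
        rw [← h5, idem_comm jf hi, hfi]
  rcases inc_pair hI hz hw iz iw hezw with ⟨rfl, rfl⟩ | ⟨rfl, rfl⟩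
  · have e1 := sharp_gen sa (hza.symm.trans hp)
    have e2 := sharp_gen sb (hwb.symm.trans hq)
    subst e1 e2
    exact ⟨h1, h2, Or.inl ⟨h3, hba⟩⟩
  · have e1 := sharp_gen sa (hza.symm.trans hq)
    have e2 := sharp_gen sb (hwb.symm.trans hp)
    subst e1 e2
    exact ⟨h2, h1, Or.inr ⟨h3, hba⟩⟩

end LF


section LF2
variable {S T : Type*} [InverseSemigroup S] [Semigroup T]

/-- The basic relations when `x⁻¹x ≤ xx⁻¹`. -/
theorem bic_rel {x : S} (hle : x⁻¹ * x * (x * x⁻¹) = x⁻¹ * x) :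
    (x * x⁻¹) * x = x ∧ x * (x * x⁻¹) = x ∧ (x * x⁻¹) * x⁻¹ = x⁻¹ ∧ x⁻¹ * (x * x⁻¹) = x⁻¹ := by
  refine ⟨imi x, ?_, ?_, iim' x⟩
  · calc x * (x * x⁻¹) = x * (x⁻¹ * x * (x * x⁻¹)) := by rw [← mul_assoc x (x⁻¹ * x), imi']
      _ = x := by rw [hle, imi']
  · calc x * x⁻¹ * x⁻¹ = (x * x⁻¹) * (x⁻¹ * x) * x⁻¹ := by
          rw [mul_assoc _ (x⁻¹ * x), iim]
      _ = x⁻¹ * x * (x * x⁻¹) * x⁻¹ := by rw [idem_comm (idem_r x) (idem_l x)]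
      _ = x⁻¹ := by rw [hle, iim]

theorem sup_left_id {M : Type*} [Semigroup M] {p q c : M} (h1 : c * p = p) (h2 : c * q = q) {s : M}
    (hs : s ∈ mono p ⊔ mono q) : c * s = s := by
  refine mono_sup_ind (P := fun s => c * s = s) h1 h2 ?_ hs
  intro a _ b _ ha _
  rw [← mul_assoc, ha]
theorem sup_right_id {M : Type*} [Semigroup M] {p q c : M} (h1 : p * c = p) (h2 : q * c = q) {s : M}
    (hs : s ∈ mono p ⊔ mono q) : s * c = s := by
  refine mono_sup_ind (P := fun s => s * c = s) h1 h2 ?_ hs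
  intro a _ b _ _ hb
  rw [mul_assoc, hb]

theorem bic_disj {x : S} (hx : x ∈ NS S) (hle : x⁻¹ * x * (x * x⁻¹) = x⁻¹ * x) (n m : ℕ) :
    pw x n ≠ pw x⁻¹ m := by
  intro h
  obtain ⟨r1, r2, r3, r4⟩ := bic_rel hle
  have hpp : ∀ n, pw x n * pw x⁻¹ n = x * x⁻¹ := by
    intro n
    induction n with
    | zero => rfl
    | succ n ih =>
      rw [pw_succ', pw_succ]
      calc x * pw x n * (pw x⁻¹ n * x⁻¹) = x * (pw x n * pw x⁻¹ n) * x⁻¹ := by simp only [mul_assoc]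
        _ = _ := by rw [ih, r2]
  apply hx
  have e1 : x⁻¹ * x * pw x n = pw x n := by rw [h, mul_pw_of_left (iim x)]
  have := hpp n
  rw [← e1, mul_assoc, hpp, hle] at this
  exact this.symm

theorem bic_idem {x : S} (hx : x ∈ NS S) (hle : x⁻¹ * x * (x * x⁻¹) = x⁻¹ * x) {n : ℕ} :
    ¬ IsIdempotentElem (pw x n) := by
  intro h
  have := idem_inv h
  rw [pw_inv] at this
  exact bic_disj hx hle n n this.symm

theorem bic_pair {x : S} (hx : x ∈ NS S) (hle : x⁻¹ * x * (x * x⁻¹) = x⁻¹ * x)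
    {z w : S} (hz : z ∈ mono x ⊔ mono x⁻¹)
    (hw : w ∈ mono x ⊔ mono x⁻¹) (iz : ¬ IsIdempotentElem z) (iw : ¬ IsIdempotentElem w)
    (he : x * x⁻¹ ∈ mono z ⊔ mono w) :
    (z ∈ mono x ∧ w ∈ mono x⁻¹) ∨ (z ∈ mono x⁻¹ ∧ w ∈ mono x) := by
  obtain ⟨r1, r2, r3, r4⟩ := bic_rel hle
  have hne : x⁻¹ * x * (x * x⁻¹) ≠ x * x⁻¹ := by rw [hle]; exact fun h => hx h.symm
  have hne' : x * x⁻¹ * (x⁻¹ * x) ≠ x * x⁻¹ := by rw [idem_comm (idem_r x) (idem_l x)]; exact hne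
  have fl : ∀ s ∈ mono x ⊔ mono x⁻¹, ¬ IsIdempotentElem s → s ∈ mono x ∨ x⁻¹ * x * s = s := by
    intro s hs is
    rcases normForm_l rfl r1 r2 r3 r4 hs with h | h | h
    · exact absurd (h ▸ idem_r x) is
    · exact Or.inl h
    · exact Or.inr h
  have fr : ∀ s ∈ mono x ⊔ mono x⁻¹, ¬ IsIdempotentElem s → s ∈ mono x⁻¹ ∨ s * (x⁻¹ * x) = s := by
    intro s hs is
    rcases normForm_r rfl r1 r2 r3 r4 hs with h | h | h
    · exact absurd (h ▸ idem_r x) is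
    · exact Or.inl h
    · exact Or.inr h
  have ly : ∀ s ∈ mono x⁻¹, x⁻¹ * x * s = s := by
    rintro _ ⟨n, rfl⟩; exact mul_pw_of_left (iim x) n
  have rx : ∀ s ∈ mono x, s * (x⁻¹ * x) = s := by
    rintro _ ⟨n, rfl⟩; exact mul_pw_of_right (imi' x) n
  by_cases h1 : x⁻¹ * x * z = z
  · have h2 : x⁻¹ * x * w ≠ w := fun h => hne (sup_left_id h1 h he)
    have hwx := (fl w hw iw).resolve_right h2
    have h3 : z * (x⁻¹ * x) ≠ z := fun h => hne' (sup_right_id h (rx w hwx) he)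
    exact Or.inr ⟨(fr z hz iz).resolve_right h3, hwx⟩
  · have hzx := (fl z hz iz).resolve_right h1
    have h3 : w * (x⁻¹ * x) ≠ w := fun h => hne' (sup_right_id (rx z hzx) h he)
    exact Or.inl ⟨hzx, (fr w hw iw).resolve_right h3⟩

theorem lemF_lt (D : LData S T) (hU : D.Up) {x : S} (hx : x ∈ NS S)
    (hle : x⁻¹ * x * (x * x⁻¹) = x⁻¹ * x) {p q : T}
    (hp : D.L (mono x) = mono p) (hq : D.L (mono x⁻¹) = mono q) : FConc D x p q := by
  have hA : D.L (mono x ⊔ mono x⁻¹) = mono p ⊔ mono q := by rw [map_sup, hp, hq]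
  obtain ⟨r1, r2, r3, r4⟩ := bic_rel hle
  have ie := idem_r x
  have jf := idem_l x
  have heA : x * x⁻¹ ∈ mono x ⊔ mono x⁻¹ := mul_mem (left_mem_sup _ _) (right_mem_sup _ _)
  have hfA : x⁻¹ * x ∈ mono x ⊔ mono x⁻¹ := mul_mem (right_mem_sup _ _) (left_mem_sup _ _)
  have hcA : D.th (x * x⁻¹) ∈ mono p ⊔ mono q := by rw [← hA, D.mem ie]; exact heA
  have hcp : D.th (x * x⁻¹) ∉ mono p := by rw [← hp, D.mem ie]; exact not_mem_mono_rng hx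
  have hcq : D.th (x * x⁻¹) ∉ mono q := by rw [← hq, D.mem ie]; exact not_mem_mono_rng' hx
  obtain ⟨a, ha, b, hb, h1, h2, h3, h4⟩ := lemC (p := p) (q := q) (D.hi _ ie) hcA hcp hcq
    (D.hi _ jf) (by rw [← hA, D.mem jf]; exact hfA) (D.comm hU (D.hi _ ie) (D.hi _ jf))
    (by rw [← hU _ _ ie jf]; intro h; 
        have := D.inj (idem_mul ie jf) ie h
        rw [idem_comm ie jf, hle] at this
        exact hx this.symm)
  have Bi : ∀ a b, a ∈ mono p ⊔ mono q → b ∈ mono p ⊔ mono q → a * b * a = a → b * a * b = b →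
      a * b = D.th (x * x⁻¹) → b * a ≠ D.th (x * x⁻¹) →
      ((∃ n, a = pw p n) ∧ ∃ m, b = pw q m) ∨ ((∃ n, a = pw q n) ∧ ∃ m, b = pw p m) := by
    intro a b ha hb h1 h2 h3 h4
    rw [← hA] at ha hb
    obtain ⟨sa, sb, z, hz, w, hw, hza, hwb, iz, iw, hezw⟩ := pull_pair D hU ie ha hb h1 h2 h3 h4
    have tr : ∀ {z x : S} {a p : T}, D.L (mono z) = mono a → D.L (mono x) = mono p →
        z ∈ mono x → a ∈ mono p := by
      intro z x a p h1 h2 h3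
      rw [← mono_le, ← h1, ← h2, D.L.le_iff_le, mono_le]; exact h3
    rcases bic_pair hx hle hz hw iz iw hezw with ⟨h5, h6⟩ | ⟨h5, h6⟩
    · exact Or.inl ⟨tr hza hp h5, tr hwb hq h6⟩
    · exact Or.inr ⟨tr hza hq h5, tr hwb hp h6⟩
  have hu : ∀ u, u ∈ mono p ⊔ mono q → u * u = u →
      u * D.th (x * x⁻¹) = u ∧ D.th (x * x⁻¹) * u = u := by
    intro u hu iu
    obtain ⟨i, hi, rfl⟩ := D.hs u iu
    rw [← hA, D.mem hi] at hu
    rw [← hU _ _ hi ie, ← hU _ _ ie hi, sup_left_id r1 r3 hu, sup_right_id r2 r4 hu]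
    exact ⟨rfl, rfl⟩
  have hdis : ∀ n m, pw p n ≠ pw q m := by
    intro n m h
    have hbot : mono x ⊓ mono x⁻¹ = ⊥ := by
      rw [eq_bot_iff]
      rintro s ⟨⟨n, hn⟩, ⟨m, hm⟩⟩
      exact absurd (hn.symm.trans hm) (bic_disj hx hle n m)
    have h5 : pw p n ∈ mono p ⊓ mono q := ⟨⟨n, rfl⟩, ⟨m, h⟩⟩
    rw [← hp, ← hq, ← map_inf, hbot, map_bot] at h5
    exact h5
  -- finishing lemma
  have fin : ∀ p q : T, mono x ⊔ mono x⁻¹ = D.L.symm (mono p ⊔ mono q) →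
      (D.L (mono x) = mono p ∨ D.L (mono x⁻¹) = mono p) → 
      D.th (x * x⁻¹) * p = p → p * D.th (x * x⁻¹) = p → D.th (x * x⁻¹) * q = q →
      q * D.th (x * x⁻¹) = q → p * q = D.th (x * x⁻¹) → q * p ≠ D.th (x * x⁻¹) →
      p * q * p = p ∧ q * p * q = q ∧ p * q = D.th (x * x⁻¹) ∧ q * p = D.th (x⁻¹ * x) := by
    intro p q hA hp cp pc cq qc pq qp
    have hA' : D.L (mono x ⊔ mono x⁻¹) = mono p ⊔ mono q := by rw [hA, D.L.apply_symm_apply]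
    have h1 : p * q * p = p := by rw [pq, cp]
    have h2 : q * p * q = q := by rw [mul_assoc, pq, qc]
    refine ⟨h1, h2, pq, ?_⟩
    have iqp : IsIdempotentElem (q * p) := by
      unfold IsIdempotentElem; rw [← mul_assoc, h2]
    obtain ⟨i, hi, hi2⟩ := D.hs _ iqp
    have hiA : i ∈ mono x ⊔ mono x⁻¹ := by
      rw [← D.mem hi, hi2, hA']; exact mul_mem (right_mem_sup _ _) (left_mem_sup _ _)
    have hfi : x⁻¹ * x * i = i := by
      rcases normForm_l rfl r1 r2 r3 r4 hiA with h | ⟨n, h⟩ | h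
      · rw [h] at hi2; exact absurd hi2.symm qp
      · exact absurd (h ▸ hi) (bic_idem hx hle)
      · exact h
    have hth : D.th (x⁻¹ * x) ∈ mono p ⊔ mono q := by rw [← hA', D.mem jf]; exact hfA
    rcases normForm_l pq cp pc cq qc hth with h | h | h
    · exact absurd (D.inj jf ie h).symm hx
    · exfalso
      rcases hp with hp | hp
      · rw [← hp, D.mem jf] at h
        obtain ⟨n, h⟩ := h
        exact bic_idem hx hle (h ▸ jf)
      · rw [← hp, D.mem jf] at h
        have := not_mem_mono_rng (inv_NS hx)
        rw [ii] at this
        exact this h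
    · rw [← hi2, ← hU _ _ hi jf] at h
      have := D.inj (idem_mul hi jf) jf h
      rw [← hi2, ← hfi, idem_comm jf hi, this]
  have hAs : mono x ⊔ mono x⁻¹ = D.L.symm (mono p ⊔ mono q) := by rw [← hA, D.L.symm_apply_apply]
  rcases Bi a b ha hb h1 h2 h3 h4 with ⟨⟨n, rfl⟩, ⟨m, rfl⟩⟩ | ⟨⟨n, rfl⟩, ⟨m, rfl⟩⟩
  · obtain ⟨cp, pc, cq, qc, pq, qp⟩ := biT2 (fun t => t ∈ mono p ⊔ mono q)
      (fun a b => mul_mem) (left_mem_sup _ _) (right_mem_sup _ _) hcA (D.hi _ ie) hu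
      (fun n h => hcp ⟨n, h.symm⟩) (fun n h => hcq ⟨n, h.symm⟩) hdis Bi h3 h4 h1 h2
    obtain ⟨k1, k2, k3, k4⟩ := fin p q hAs (Or.inl hp) cp pc cq qc pq qp
    exact ⟨k1, k2, Or.inl ⟨k3, k4⟩⟩
  · obtain ⟨cp, pc, cq, qc, pq, qp⟩ := biT2 (p := q) (q := p) (fun t => t ∈ mono p ⊔ mono q)
      (fun a b => mul_mem) (right_mem_sup _ _) (left_mem_sup _ _) hcA (D.hi _ ie) hu
      (fun n h => hcq ⟨n, h.symm⟩) (fun n h => hcp ⟨n, h.symm⟩) (fun n m h => hdis m n h.symm)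
      (fun a b h1 h2 h3 h4 h5 h6 => (Bi a b h1 h2 h3 h4 h5 h6).symm) h3 h4 h1 h2
    obtain ⟨k1, k2, k3, k4⟩ := fin q p (by rw [sup_comm (mono q)]; exact hAs) (Or.inr hq)
      cp pc cq qc pq qp
    exact ⟨k2, k1, Or.inr ⟨k3, k4⟩⟩

theorem lemF (D : LData S T) (hU : D.Up) {x : S} (hx : x ∈ NS S) {p q : T}
    (hp : D.L (mono x) = mono p) (hq : D.L (mono x⁻¹) = mono q) : FConc D x p q := by
  by_cases h1 : x⁻¹ * x * (x * x⁻¹) = x⁻¹ * x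
  · exact lemF_lt D hU hx h1 hp hq
  by_cases h2 : x * x⁻¹ * (x⁻¹ * x) = x * x⁻¹
  · apply FConc_inv
    exact lemF_lt D hU (inv_NS hx) (by rw [ii]; exact h2) hq (by rw [ii]; exact hp)
  · exact lemF_inc D hU hx ⟨h2, h1⟩ hp hq

end LF2


section TInv
variable {S T : Type*} [InverseSemigroup S] [Semigroup T]

theorem group_split (hNI : NoIsolatedNontrivial S) {s : S} (h1 : s ∉ NS S)
    (h2 : ¬ IsIdempotentElem s) : ∃ x ∈ NS S, s * x ∈ NS S ∧ s = s * x * x⁻¹ := by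
  have hs : s * s⁻¹ = s⁻¹ * s := by
    by_contra h; exact h1 h
  obtain ⟨f, hf, hfe, c, hc1, hc2⟩ := hNI (s * s⁻¹) (idem_r s) ⟨s, fun h => h2 (h ▸ idem_r s), by
    constructor
    · unfold rRel; rw [idem_inv (idem_r s), idem_r s]
    · unfold lRel; rw [idem_inv (idem_r s), idem_r s, hs]⟩
  unfold rRel at hc1
  unfold lRel at hc2
  rw [idem_inv (idem_r s), idem_r s] at hc1
  rw [idem_inv hf, hf] at hc2
  have r1 : (s * c) * (s * c)⁻¹ = s * s⁻¹ := by
    calc (s * c) * (s * c)⁻¹ = s * (c * c⁻¹) * s⁻¹ := rng_mul s c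
      _ = s * (s⁻¹ * s) * s⁻¹ := by rw [← hc1, hs]
      _ = s * s⁻¹ := by rw [imi']
  have r2 : (s * c)⁻¹ * (s * c) = f := by
    rw [mir]
    calc c⁻¹ * s⁻¹ * (s * c) = c⁻¹ * (s⁻¹ * s) * c := by simp only [mul_assoc]
      _ = f := by rw [← hs, hc1, ← hc2, iim']
  refine ⟨c, ?_, ?_, ?_⟩
  · intro h; rw [← hc1, hc2] at h; exact hfe h.symm
  · intro h; rw [r1, r2] at h; exact hfe h.symm
  · rw [mul_assoc, ← hc1, hs, imi']

theorem gen_NE (hNI : NoIsolatedNontrivial S) {A : Subsemigroup S} (h1 : ∀ x ∈ NS S, x ∈ A)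
    (h2 : ∀ e, IsIdempotentElem e → e ∈ A) (s : S) : s ∈ A := by
  by_cases hs : s ∈ NS S
  · exact h1 s hs
  by_cases hi : IsIdempotentElem s
  · exact h2 s hi
  obtain ⟨x, hx, hsx, he⟩ := group_split hNI hs hi
  rw [he]
  exact mul_mem (h1 _ hsx) (h1 _ (inv_NS hx))

theorem isInverse_T (hNI : NoIsolatedNontrivial S) (D : LData S T) (hU : D.Up) :
    IsInverseSgp T := by
  have hc : ∀ u v : T, u * u = u → v * v = v → u * v = v * u := fun u v hu hv => D.comm hU hu hv
  let V : Subsemigroup T :=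
    { carrier := {t | ∃ u, t * u * t = t ∧ u * t * u = u}
      mul_mem' := by
        rintro a b ⟨u, h1, h2⟩ ⟨v, h3, h4⟩
        have i1 : u * a * (u * a) = u * a := by rw [← mul_assoc, h2]
        have i2 : b * v * (b * v) = b * v := by rw [← mul_assoc, h3]
        have := hc _ _ i1 i2
        refine ⟨v * u, ?_, ?_⟩
        · calc a * b * (v * u) * (a * b) = a * ((b * v) * (u * a)) * b := by simp only [mul_assoc]
            _ = (a * u * a) * (b * v * b) := by rw [← this]; simp only [mul_assoc]
            _ = a * b := by rw [h1, h3]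
        · calc v * u * (a * b) * (v * u) = v * ((u * a) * (b * v)) * u := by simp only [mul_assoc]
            _ = (v * b * v) * (u * a * u) := by rw [this]; simp only [mul_assoc]
            _ = v * u := by rw [h4, h2] }
  have hV : ∀ t : T, t ∈ V := by
    have h1 : ∀ s : S, s ∈ D.L.symm V := by
      apply gen_NE hNI
      · intro x hx
        obtain ⟨p, hp⟩ := exists_gen D.L (sharp_NS hx)
        obtain ⟨q, hq⟩ := exists_gen D.L (sharp_NS (inv_NS hx))
        obtain ⟨a1, a2, -⟩ := lemF D hU hx hp hq
        rw [← mono_le, ← D.L.symm_apply_apply (mono x)]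
        apply D.L.symm.monotone
        rw [hp, mono_le]
        exact ⟨q, a1, a2⟩
      · intro e he
        rw [← D.mem he, D.L.apply_symm_apply]
        have := D.hi e he
        unfold IsIdempotentElem at this
        exact ⟨D.th e, by rw [this, this], by rw [this, this]⟩
    have h2 : D.L.symm V = ⊤ := by rw [eq_top_iff]; intro s _; exact h1 s
    have h3 : V = ⊤ := by rw [← D.L.apply_symm_apply V, h2, map_top]
    intro t; rw [h3]; trivial
  intro a
  obtain ⟨b, h1, h2⟩ := hV a
  refine ⟨b, ⟨h1, h2⟩, ?_⟩
  rintro b' ⟨h3, h4⟩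
  have i1 : b * a * (b * a) = b * a := by rw [← mul_assoc, h2]
  have i2 : b' * a * (b' * a) = b' * a := by rw [← mul_assoc, h4]
  have i3 : a * b * (a * b) = a * b := by rw [← mul_assoc, h1]
  have i4 : a * b' * (a * b') = a * b' := by rw [← mul_assoc, h3]
  calc b' = b' * (a * b * a) * b' := by rw [h1, h4]
    _ = b' * ((a * b) * (a * b')) := by simp only [mul_assoc]
    _ = b' * ((a * b') * (a * b)) := by rw [hc _ _ i3 i4]
    _ = (b' * a * b') * a * b := by simp only [mul_assoc]
    _ = b' * a * b := by rw [h4]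
    _ = b' * a * (b * a * b) := by rw [h2]
    _ = (b' * a) * (b * a) * b := by simp only [mul_assoc]
    _ = (b * a) * (b' * a) * b := by rw [hc _ _ i1 i2]
    _ = b * (a * b' * a) * b := by simp only [mul_assoc]
    _ = b := by rw [h3, h2]

/-- turn the predicate into an instance -/
noncomputable abbrev invOf {T : Type*} [i : Semigroup T] (h : IsInverseSgp T) : InverseSemigroup T :=
  { i with
    inv := fun a => (h a).choose
    mul_inv_mul := fun a => (h a).choose_spec.1.1
    inv_mul_inv := fun a => (h a).choose_spec.1.2
    inv_unique := fun a b h1 h2 => (h a).choose_spec.2 b ⟨h1, h2⟩ }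

end TInv

section Part2
variable {S T : Type*} [InverseSemigroup S] [InverseSemigroup T]

/-- positive correspondence -/
def Pos (D : LData S T) (x : S) (p : T) : Prop :=
  D.L (mono x) = mono p ∧ D.L (mono x⁻¹) = mono p⁻¹ ∧ p * p⁻¹ = D.th (x * x⁻¹) ∧
    p⁻¹ * p = D.th (x⁻¹ * x)

theorem Pos.inv {D : LData S T} {x : S} {p : T} (h : Pos D x p) : Pos D x⁻¹ p⁻¹ := by
  obtain ⟨h1, h2, h3, h4⟩ := h
  exact ⟨h2, by rw [ii, ii]; exact h1, by rw [ii, ii]; exact h4, by rw [ii, ii]; exact h3⟩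

theorem Pos.NS {D : LData S T} {x : S} {p : T} (h : Pos D x p) (hx : x ∈ NS S) : p ∈ NS T := by
  obtain ⟨h1, h2, h3, h4⟩ := h
  intro h
  rw [h3, h4] at h
  exact hx (D.inj (idem_r x) (idem_l x) h)

theorem lemF' (D : LData S T) (hU : D.Up) {x : S} (hx : x ∈ NS S) :
    ∃ p, D.L (mono x) = mono p ∧ D.L (mono x⁻¹) = mono p⁻¹ ∧
    ((p * p⁻¹ = D.th (x * x⁻¹) ∧ p⁻¹ * p = D.th (x⁻¹ * x)) ∨
      (p⁻¹ * p = D.th (x * x⁻¹) ∧ p * p⁻¹ = D.th (x⁻¹ * x))) := by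
  obtain ⟨p, hp⟩ := exists_gen D.L (sharp_NS hx)
  obtain ⟨q, hq⟩ := exists_gen D.L (sharp_NS (inv_NS hx))
  obtain ⟨a1, a2, a3⟩ := lemF D hU hx hp hq
  have : q = p⁻¹ := iuniq a1 a2
  subst this
  exact ⟨p, hp, hq, a3⟩

theorem idem_or_le {M : Type*} [InverseSemigroup M] {h x : M} (hh : IsIdempotentElem h) (k : ℕ)
    {B : Subsemigroup M} (hB : ∀ b ∈ B, ∃ n, b = pw x (n + k)) {s : M} (hs : s ∈ mono h ⊔ B) :
    IsIdempotentElem s ∨ ∃ n, natLe s (pw x (n + k)) := by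
  let C : Subsemigroup M :=
    { carrier := {s | IsIdempotentElem s ∨ ∃ n, natLe s (pw x (n + k))}
      mul_mem' := by
        rintro a b (ha | ⟨n, ha⟩) (hb | ⟨m, hb⟩)
        · exact Or.inl (idem_mul ha hb)
        · exact Or.inr ⟨m, natLe_trans (natLe_left ha b) hb⟩
        · exact Or.inr ⟨n, natLe_trans (natLe_right hb a) ha⟩
        · refine Or.inr ⟨n + m + k + 1, ?_⟩
          have := natLe_mul ha hb
          rw [pw_mul] at this
          convert this using 2
          omega }
  have : mono h ⊔ B ≤ C := by
    refine sup_le (mono_le.2 (Or.inl hh)) ?_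
    intro b hb
    obtain ⟨n, rfl⟩ := hB b hb
    exact Or.inr ⟨n, natLe_refl _⟩
  exact this hs

end Part2


section G1
variable {S : Type*} [InverseSemigroup S]

theorem le_tr {a b c : S} (h1 : a * b = a) (h2 : b * c = b) : a * c = a := by
  calc a * c = a * b * c := by rw [h1]
    _ = a := by rw [mul_assoc, h2, h1]
theorem le_as {a b : S} (ha : IsIdempotentElem a) (hb : IsIdempotentElem b) (h1 : a * b = a)
    (h2 : b * a = b) : a = b := by rw [← h1, idem_comm ha hb, h2]
theorem cj_mono {a b : S} (ha : IsIdempotentElem a) (hb : IsIdempotentElem b) (x : S)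
    (h : a * b = a) : x⁻¹ * a * x * (x⁻¹ * b * x) = x⁻¹ * a * x := by
  rw [← cj_mul ha hb, h]
theorem cj_mono' {a b : S} (ha : IsIdempotentElem a) (hb : IsIdempotentElem b) (x : S)
    (h : a * b = a) : x * a * x⁻¹ * (x * b * x⁻¹) = x * a * x⁻¹ := by
  have := cj_mono ha hb x⁻¹ h
  rwa [ii] at this
theorem le_pw2 {h x : S} {n : ℕ} (hh : IsIdempotentElem h) (hl : natLe h (pw x (n + 1))) :
    h * (x * (x * x⁻¹) * x⁻¹) = h := by
  have h1 := natLe_rng hl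
  rw [idem_inv hh, hh, natLe_idem_iff hh] at h1
  rw [← rng_mul]
  cases n with
  | zero => exact h1
  | succ n =>
    rw [pw_succ', pw_succ'] at h1
    apply le_of_le_rng_mul (t := pw x n)
    simpa only [mul_assoc] using h1
theorem le_pw3 {h x : S} {n : ℕ} (hh : IsIdempotentElem h) (hl : natLe h (pw x (n + 2))) :
    h * (x * (x * (x * x⁻¹) * x⁻¹) * x⁻¹) = h := by
  have h1 := natLe_rng hl
  rw [idem_inv hh, hh, natLe_idem_iff hh] at h1
  rw [← rng_mul x x, ← rng_mul]
  cases n with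
  | zero => rw [pw_succ', pw_succ', pw_zero] at h1; exact h1
  | succ n =>
    rw [pw_succ', pw_succ', pw_succ'] at h1
    apply le_of_le_rng_mul (t := pw x n)
    simpa only [mul_assoc] using h1

theorem ef_comm (x : S) : x * x⁻¹ * (x⁻¹ * x) = x⁻¹ * x * (x * x⁻¹) :=
  idem_comm (idem_r x) (idem_l x)
theorem cj_E2 (x : S) : x⁻¹ * (x * (x * x⁻¹) * x⁻¹) * x = x⁻¹ * x * (x * x⁻¹) := by
  calc x⁻¹ * (x * (x * x⁻¹) * x⁻¹) * x = (x⁻¹ * x) * ((x * x⁻¹) * (x⁻¹ * x)) := by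
        simp only [mul_assoc]
    _ = _ := by rw [ef_comm, ← mul_assoc, idem_l]
theorem E2_le (x : S) : x * (x * x⁻¹) * x⁻¹ * (x * x⁻¹) = x * (x * x⁻¹) * x⁻¹ := by
  calc x * (x * x⁻¹) * x⁻¹ * (x * x⁻¹) = x * (x * x⁻¹) * (x⁻¹ * x * x⁻¹) := by simp only [mul_assoc]
    _ = _ := by rw [iim]
theorem f_le_e {x : S} (h : x * (x * x⁻¹) * x⁻¹ = x * x⁻¹) : x⁻¹ * x * (x * x⁻¹) = x⁻¹ * x :=
  le_of_conj (idem_r x) (by rw [h]; exact idem_r x)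
theorem e_le_f {x : S} (h : x⁻¹ * (x⁻¹ * x) * x = x⁻¹ * x) : x * x⁻¹ * (x⁻¹ * x) = x * x⁻¹ := by
  have := f_le_e (x := x⁻¹)
  rw [ii] at this
  exact this h

/-- the covering hypotheses used -/
structure Cv (x h : S) : Prop where
  ih : IsIdempotentElem h
  he : h * (x * x⁻¹) = h
  hk : x⁻¹ * h * x ≠ h
  hne : x * x⁻¹ ≠ x⁻¹ * x
  c1 : h * (x * (x * x⁻¹) * x⁻¹) = h → x * (x * x⁻¹) * x⁻¹ = h ∨ x * (x * x⁻¹) * x⁻¹ = x * x⁻¹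
  c2 : h * (x * x⁻¹ * (x⁻¹ * x)) = h → x * x⁻¹ * (x⁻¹ * x) = h ∨ x * x⁻¹ * (x⁻¹ * x) = x * x⁻¹
  c3 : h * (x⁻¹ * x) = h → x⁻¹ * x * (x * x⁻¹) = x⁻¹ * x → x⁻¹ * x = h ∨ x⁻¹ * x = x * x⁻¹

theorem step2_pow {x h : S} (H : Cv x h) {n : ℕ} (hl : natLe (h * x) (pw x (n + 1))) : False := by
  obtain ⟨ih, he, hk, hne, c1, c2, c3⟩ := H
  have hw : h = h * pw x n * (x * x⁻¹) := by
    have h1 := natLe_iff.1 hl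
    rw [mul_rng ih, he, pw_succ] at h1
    calc h = h * x * x⁻¹ := by rw [mul_assoc, he]
      _ = h * (pw x n * x) * x⁻¹ := by rw [← h1]
      _ = _ := by simp only [mul_assoc]
  have hw2 : natLe h (pw x n) := by
    have : natLe (h * pw x n * (x * x⁻¹)) (pw x n) :=
      natLe_trans (natLe_right (idem_r x) _) (natLe_left ih _)
    rwa [← hw] at this
  cases n with
  | zero =>
    have h1 := natLe_iff.1 hw2
    rw [idem_inv ih, ih, pw_zero] at h1
    apply hk
    rw [mul_assoc, ← h1, ← idem_inv ih, ← mir, ← h1]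
  | succ n =>
    have hw3 : natLe h (pw x (n + n + 1 + 2)) := by
      have := natLe_mul hw2 hw2
      rw [ih, pw_mul] at this
      convert this using 2
      omega
    have hinv : natLe h (pw x⁻¹ (n + 1)) := by
      have := natLe_inv hw2
      rwa [idem_inv ih, pw_inv] at this
    have a1 := le_pw2 ih hw2
    have a2 := le_pw2 ih hinv
    have a3 := le_pw3 ih hw3
    rw [ii] at a2
    have a4 : h * (x⁻¹ * x) = h := le_tr a2 (by have := E2_le x⁻¹; rwa [ii] at this)
    rcases c1 a1 with b | b
    · rcases c2 (by rw [← mul_assoc, he, a4]) with c | c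
      · apply hk
        rw [← c]
        nth_rw 1 [c]
        rw [← b, cj_E2, ← ef_comm]
      · have i2 : IsIdempotentElem (x * (x * x⁻¹) * x⁻¹) := idem_conj' (idem_r x) x
        have m := cj_mono ih (idem_conj' i2 x) x a3
        rw [← b, conj_back' i2 (by rw [b, a4]), cj_E2, ← ef_comm, c] at m
        have e1 := le_as (idem_r x) i2 m (E2_le x)
        have := f_le_e e1.symm
        rw [← ef_comm, c] at this
        exact hne this
    · have d := f_le_e b
      rcases c3 a4 d with c | c
      · rw [← c] at a2
        have := le_as (idem_l x) (idem_conj (idem_l x) x) a2 (by have := E2_le x⁻¹; rwa [ii] at this)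
        have := e_le_f this.symm
        rw [ef_comm, d] at this
        exact hne this.symm
      · exact hne c.symm

theorem step2_neg {x h : S} (H : Cv x h) (hf : h * (x⁻¹ * x) = h)
    (hke : x⁻¹ * h * x * (x * x⁻¹) = x⁻¹ * h * x) (P1 : x⁻¹ * h * x = x * x⁻¹ ↔ h = x⁻¹ * x) :
    False := by
  obtain ⟨ih, he, hk, hne, c1, c2, c3⟩ := H
  have ik := idem_conj ih x
  have i2 : IsIdempotentElem (x * (x * x⁻¹) * x⁻¹) := idem_conj' (idem_r x) x
  have hE : h * (x * (x * x⁻¹) * x⁻¹) = h := by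
    have := cj_mono' ik (idem_r x) x hke
    rwa [conj_back ih he] at this
  have kf : x⁻¹ * h * x * (x⁻¹ * x) = x⁻¹ * h * x := by
    rw [mul_assoc, imi']
  rcases c2 (by rw [← mul_assoc, he, hf]) with c | c
  · rcases c1 hE with b | b
    · apply hk
      nth_rw 1 [← b]
      rw [cj_E2, ← ef_comm, c]
    · have d := f_le_e b
      have e1 : h = x⁻¹ * x := by rw [← c, ef_comm, d]
      have e2 := P1.2 e1
      have : x⁻¹ * h * x * h = x⁻¹ * h * x := by
        rw [← c, ← mul_assoc, c, hke, kf]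
      rw [e2, e1, ef_comm, d] at this
      exact hne this.symm
  · rcases c1 hE with b | b
    · have e1 : x⁻¹ * h * x = x * x⁻¹ := by
        nth_rw 1 [← b]
        rw [cj_E2, ← ef_comm, c]
      have e2 := P1.1 e1
      rw [e2, ← ef_comm, c] at he
      exact hne he
    · have d := f_le_e b
      rw [← ef_comm, c] at d
      exact hne d

theorem Cv_of_XCov {x h : S} (ih : IsIdempotentElem h) (hc : XCov x h) (hn : h * x ∈ NS S) (hxn : x ∈ NS S) :
    Cv x h := by
  obtain ⟨⟨he, hne⟩, hc⟩ := hc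
  unfold idemLe at he
  have key : ∀ g : S, g ∈ genInv ({x} : Set S) → IsIdempotentElem g → g * (x * x⁻¹) = g →
      h * g = h → g = h ∨ g = x * x⁻¹ := by
    intro g hg ig h1 h2
    by_contra h3
    push Not at h3
    exact hc g hg ig ⟨⟨h2, fun h => h3.1 h.symm⟩, h1, h3.2⟩
  have gx : ∀ U : Set S, U ∈ {U : Set S | IsInvSub U ∧ ({x} : Set S) ⊆ U} → x ∈ U ∧ x⁻¹ ∈ U :=
    fun U hU => ⟨hU.2 rfl, hU.1.2 _ (hU.2 rfl)⟩
  have hk : x⁻¹ * h * x ≠ h := by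
    intro hk
    apply hn
    rw [mul_rng ih, mul_dom ih, he, hk]
  refine ⟨ih, he, hk, hxn, ?_, ?_, ?_⟩
  · apply key
    · intro U hU
      obtain ⟨h1, h2⟩ := gx U hU
      have m := hU.1.1
      exact m _ (m _ h1 _ (m _ h1 _ h2)) _ h2
    · exact idem_conj' (idem_r x) x
    · exact E2_le x
  · apply key
    · intro U hU
      obtain ⟨h1, h2⟩ := gx U hU
      have m := hU.1.1
      exact m _ (m _ h1 _ h2) _ (m _ h2 _ h1)
    · exact idem_mul (idem_r x) (idem_l x)
    · rw [ef_comm, mul_assoc, idem_r x]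
  · intro h1 h2
    refine key _ ?_ (idem_l x) h2 h1
    intro U hU
    obtain ⟨h1, h2⟩ := gx U hU
    exact hU.1.1 _ h2 _ h1

end G1


section G2
variable {S T : Type*} [InverseSemigroup S] [InverseSemigroup T]

theorem step2 (D : LData S T) (hU : D.Up) {x h : S} {p : T} (hP : Pos D x p) (H : Cv x h)
    (hn : h * x ∈ NS S) : Pos D (h * x) (D.th h * p) := by
  obtain ⟨r, h1, h2, h3⟩ := lemF' D hU hn
  obtain ⟨q1, q2, q3, q4⟩ := hP
  have ih := H.ih
  have ith := D.hi h ih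
  have er : h * x * (h * x)⁻¹ = h := by rw [mul_rng ih, H.he]
  have ed : (h * x)⁻¹ * (h * x) = x⁻¹ * h * x := mul_dom ih x
  have ik := idem_conj ih x
  rw [er, ed] at h3
  have hrr : r * r⁻¹ ≠ r⁻¹ * r := by
    intro h0
    have : D.th h = D.th (x⁻¹ * h * x) := by
      rcases h3 with ⟨a, b⟩ | ⟨a, b⟩
      · rw [← a, ← b, h0]
      · rw [← a, ← b, h0]
    exact H.hk (D.inj ih ik this).symm
  have hmem : h * x ∈ mono h ⊔ mono x :=
    mul_mem (Subsemigroup.mem_sup_left (self_mono h)) (Subsemigroup.mem_sup_right (self_mono x))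
  have hr : r ∈ mono (D.th h) ⊔ mono p := by
    rw [← mono_le, ← h1, ← D.hL h ih, ← q1, ← map_sup, D.L.le_iff_le, mono_le]
    exact hmem
  rcases idem_or_le ith 0 (B := mono p) (fun b hb => by
      obtain ⟨n, hn⟩ := mem_mono.1 hb; exact ⟨n, by simpa using hn⟩) hr with i | ⟨n, hl⟩
  · exact absurd (by rw [idem_inv i]) hrr
  rw [add_zero] at hl
  have hform : (r * r⁻¹ = D.th h ∧ r⁻¹ * r = D.th (x⁻¹ * h * x) ∧ r = D.th h * pw p n) ∨
      (r⁻¹ * r = D.th h ∧ r * r⁻¹ = D.th (x⁻¹ * h * x) ∧ r = pw p n * D.th h) := by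
    rcases h3 with ⟨a, b⟩ | ⟨a, b⟩
    · left; refine ⟨a, b, ?_⟩
      rw [← a]; exact natLe_iff.1 hl
    · right; refine ⟨a, b, ?_⟩
      rw [← a]
      have := natLe_iff.1 (natLe_inv hl)
      rw [ii] at this
      apply iinj
      rw [mir, idem_inv (idem_l r)]
      exact this
  cases n with
  | succ n =>
    exfalso
    have hr2 : r ∈ mono (D.th h) ⊔ dsub p := by
      have m1 : D.th h ∈ mono (D.th h) ⊔ dsub p := Subsemigroup.mem_sup_left (self_mono _)
      have m2 : pw p (n + 1) ∈ mono (D.th h) ⊔ dsub p :=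
        Subsemigroup.mem_sup_right (mem_dsub.2 ⟨n, rfl⟩)
      rcases hform with ⟨_, _, a⟩ | ⟨_, _, a⟩
      · rw [a]; exact mul_mem m1 m2
      · rw [a]; exact mul_mem m2 m1
    have hp : Sharp p := sharp_NS (Pos.NS ⟨q1, q2, q3, q4⟩ H.hne)
    have hx2 : h * x ∈ mono h ⊔ dsub x := by
      rw [← mono_le]
      have l1 : mono (h * x) ≤ D.L.symm (mono (D.th h) ⊔ dsub p) := by
        rw [← D.L.symm_apply_apply (mono (h * x)), h1]
        exact D.L.symm.monotone (mono_le.2 hr2)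
      rw [map_sup, ← D.hL h ih, D.L.symm_apply_apply] at l1
      exact l1.trans (sup_le_sup_left (symm_dsub_le D.L hp q1) _)
    rcases idem_or_le ih 1 (B := dsub x) (fun b hb => by
      obtain ⟨n, hn⟩ := mem_dsub.1 hb; exact ⟨n, hn⟩) hx2 with i | ⟨n, hl⟩
    · exact NS_not_idem hn i
    · exact step2_pow H hl
  | zero =>
    rw [pw_zero] at hl
    rcases hform with ⟨a, b, c⟩ | ⟨a, b, c⟩
    · rw [pw_zero] at c
      rw [← c]
      exact ⟨h1, h2, by rw [er, a], by rw [ed, b]⟩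
    · exfalso
      have l1 := natLe_rng hl
      have l2 := natLe_dom hl
      rw [a, q4, natLe_idem_iff ith, ← hU _ _ ih (idem_l x)] at l2
      rw [b, q3, natLe_idem_iff (D.hi _ ik), ← hU _ _ ik (idem_r x)] at l1
      refine step2_neg H (D.inj (idem_mul ih (idem_l x)) ih l2)
        (D.inj (idem_mul ik (idem_r x)) ik l1) ⟨?_, ?_⟩
      · intro e1
        have := natLe_eq_of_rng hl (by rw [b, q3, e1])
        rw [this, q4] at a
        exact (D.inj (idem_l x) ih a).symm
      · intro e1
        have := natLe_eq_of_rng (natLe_inv hl) (by rw [ii, ii, a, q4, e1])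
        have := iinj this
        rw [this, q3] at b
        exact (D.inj (idem_r x) ik b).symm

theorem caseE (D : LData S T) (hU : D.Up) {x h : S} {p : T} (hP : Pos D x p)
    (ih : IsIdempotentElem h) (he : h * (x * x⁻¹) = h) (hi : IsIdempotentElem (h * x)) :
    p⁻¹ * D.th h * p = D.th (x⁻¹ * h * x) := by
  obtain ⟨q1, q2, q3, q4⟩ := hP
  have ith := D.hi h ih
  have e1 : h * x = h := by
    have : h * x * (h * x)⁻¹ = h := by rw [mul_rng ih, he]
    rw [idem_inv hi, hi] at this
    exact this
  have e2 : x⁻¹ * h = h := by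
    have : (h * x)⁻¹ = h⁻¹ := by rw [e1]
    rwa [mir, idem_inv ih] at this
  have e3 : x * h = h := by
    calc x * h = x * (x⁻¹ * h) := by rw [e2]
      _ = h * (x * x⁻¹) := by rw [← mul_assoc, idem_comm ih (idem_r x)]
      _ = h := he
  have e4 : h * x⁻¹ = h := by
    calc h * x⁻¹ = h * x * x⁻¹ := by rw [e1]
      _ = h := by rw [mul_assoc, he]
  have hxx : x⁻¹ * h * x = h := by rw [e2, e1]
  rw [hxx]
  have hf : h * (x⁻¹ * x) = h := by rw [← mul_assoc, e4, e1]
  let C : Subsemigroup S :=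
    { carrier := {s | h * s = h}
      mul_mem' := by
        intro a b ha hb
        show h * (a * b) = h
        rw [← mul_assoc, show h * a = h from ha, show h * b = h from hb] }
  have key : ∀ u : T, IsIdempotentElem u → u ∈ mono (D.th h) ⊔ (mono p ⊔ mono p⁻¹) →
      D.th h * u = D.th h := by
    intro u hu hm
    obtain ⟨i, ii', rfl⟩ := D.hs u hu
    rw [← D.hL h ih, ← q1, ← q2, ← map_sup, ← map_sup, D.mem ii'] at hm
    have hC : mono h ⊔ (mono x ⊔ mono x⁻¹) ≤ C :=
      sup_le (mono_le.2 ih) (sup_le (mono_le.2 e1) (mono_le.2 e4))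
    have : h * i = h := hC hm
    rw [← hU _ _ ih ii', this]
  have m1 : D.th h ∈ mono (D.th h) ⊔ (mono p ⊔ mono p⁻¹) := Subsemigroup.mem_sup_left (self_mono _)
  have m2 : p ∈ mono (D.th h) ⊔ (mono p ⊔ mono p⁻¹) :=
    Subsemigroup.mem_sup_right (Subsemigroup.mem_sup_left (self_mono _))
  have m3 : p⁻¹ ∈ mono (D.th h) ⊔ (mono p ⊔ mono p⁻¹) :=
    Subsemigroup.mem_sup_right (Subsemigroup.mem_sup_right (self_mono _))
  have k1 := key _ (idem_conj ith p) (mul_mem (mul_mem m3 m1) m2)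
  have k2 := key _ (idem_conj' ith p) (mul_mem (mul_mem m2 m1) m3)
  have k3 := cj_mono ith (idem_conj' ith p) p k2
  rw [conj_back' ith (by rw [q4, ← hU _ _ ih (idem_l x), hf])] at k3
  exact (le_as ith (idem_conj ith p) k1 k3).symm

theorem conj_main (hTC : TightlyConnected S) (D : LData S T) (hU : D.Up) {x : S} {p : T}
    (hP : Pos D x p) (hx : x ∈ NS S) (h : S) (ih : IsIdempotentElem h) :
    p⁻¹ * D.th h * p = D.th (x⁻¹ * h * x) := by
  have red : p⁻¹ * D.th (h * (x * x⁻¹)) * p = D.th (x⁻¹ * (h * (x * x⁻¹)) * x) →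
      p⁻¹ * D.th h * p = D.th (x⁻¹ * h * x) := by
    intro h1
    rw [hU _ _ ih (idem_r x), ← hP.2.2.1] at h1
    calc p⁻¹ * D.th h * p = p⁻¹ * D.th h * (p * p⁻¹ * p) := by rw [imi]
      _ = p⁻¹ * (D.th h * (p * p⁻¹)) * p := by simp only [mul_assoc]
      _ = _ := h1
      _ = D.th (x⁻¹ * h * (x * x⁻¹ * x)) := by simp only [mul_assoc]
      _ = _ := by rw [imi]
  apply red
  have ih' := idem_mul ih (idem_r x)
  have hle : h * (x * x⁻¹) * (x * x⁻¹) = h * (x * x⁻¹) := by rw [mul_assoc, idem_r x]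
  clear red
  generalize h * (x * x⁻¹) = h at ih' hle
  clear ih
  by_cases hne : h = x * x⁻¹
  · rw [hne, ← hP.2.2.1, iim', hP.2.2.2, iim']
  by_cases hi : IsIdempotentElem (h * x)
  · exact caseE D hU hP ih' hle hi
  obtain ⟨n, hn, es, h0, hnn, hid, hst⟩ := hTC x (Or.inl hx) h ih' ⟨hle, hne⟩
  have up : ∀ k ≤ n, h * es k = h := by
    intro k
    induction k with
    | zero => intro _; rw [h0]; exact ih'
    | succ k ihk =>
      intro hk
      have := (hst (k + 1) (by omega) hk).1.1
      exact le_tr (ihk (by omega)) this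
  have main : ∀ j ≤ n, Pos D (es (n - j) * x) (D.th (es (n - j)) * p) ∧ es (n - j) * x ∈ NS S := by
    intro j
    induction j with
    | zero =>
      intro _
      rw [Nat.sub_zero, hnn, imi, ← hP.2.2.1, imi]
      exact ⟨hP, hx⟩
    | succ j ihj =>
      intro hj
      obtain ⟨hp1, hn1⟩ := ihj (by omega)
      obtain ⟨⟨hl, -⟩, hcov, ht⟩ := hst (n - j) (by omega) (by omega)
      have hsub : n - j - 1 = n - (j + 1) := by omega
      rw [hsub] at hl hcov ht
      unfold idemLe at hl
      have ia := hid (n - (j + 1)) (by omega)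
      have ib := hid (n - j) (by omega)
      have ex : es (n - (j + 1)) * (es (n - j) * x) = es (n - (j + 1)) * x := by
        rw [← mul_assoc, hl]
      have hns : es (n - (j + 1)) * x ∈ NS S := by
        rw [ex] at ht
        rcases ht with ht | ht
        · exact ht
        · exfalso; apply hi
          rw [← up (n - (j + 1)) (by omega), mul_assoc]
          exact idem_mul ih' ht
      have hns' : es (n - (j + 1)) * (es (n - j) * x) ∈ NS S := by rwa [ex]
      have := step2 D hU hp1 (Cv_of_XCov ia hcov hns' hn1) hns'
      rw [ex, ← mul_assoc, ← hU _ _ ia ib, hl] at this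
      exact ⟨this, hns⟩
  have fin := (main n le_rfl).1.2.2.2
  rw [Nat.sub_self, h0, mul_dom (D.hi _ ih'), mul_dom ih'] at fin
  exact fin

/-- conjugation correspondence -/
def RR (D : LData S T) (s : S) (t : T) : Prop :=
  ∀ h, IsIdempotentElem h → t⁻¹ * D.th h * t = D.th (s⁻¹ * h * s) ∧
    t * D.th h * t⁻¹ = D.th (s * h * s⁻¹)

theorem RR_of_Pos (hTC : TightlyConnected S) (D : LData S T) (hU : D.Up) {x : S} {p : T}
    (hP : Pos D x p) (hx : x ∈ NS S) : RR D x p := by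
  intro h ih
  refine ⟨conj_main hTC D hU hP hx h ih, ?_⟩
  have := conj_main hTC D hU hP.inv (inv_NS hx) h ih
  rwa [ii, ii] at this

/-- inverse image order isomorphism -/
def invIso (S : Type*) [InverseSemigroup S] : Subsemigroup S ≃o Subsemigroup S where
  toFun A :=
    { carrier := {a | a⁻¹ ∈ A}
      mul_mem' := by
        intro a b ha hb
        show (a * b)⁻¹ ∈ A
        rw [mir]; exact mul_mem hb ha }
  invFun A :=
    { carrier := {a | a⁻¹ ∈ A}
      mul_mem' := by
        intro a b ha hb
        show (a * b)⁻¹ ∈ A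
        rw [mir]; exact mul_mem hb ha }
  left_inv A := by
    ext a
    show a⁻¹⁻¹ ∈ A ↔ a ∈ A
    rw [ii]
  right_inv A := by
    ext a
    show a⁻¹⁻¹ ∈ A ↔ a ∈ A
    rw [ii]
  map_rel_iff' := by
    intro A B
    constructor
    · intro h a ha
      have : a⁻¹⁻¹ ∈ B := h (show a⁻¹⁻¹ ∈ A by rwa [ii])
      rwa [ii] at this
    · intro h a ha
      exact h ha

theorem mem_invIso {A : Subsemigroup S} {a : S} : a ∈ invIso S A ↔ a⁻¹ ∈ A := Iff.rfl

theorem invIso_mono (x : S) : invIso S (mono x) = mono x⁻¹ := by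
  ext a
  rw [mem_invIso, mem_mono, mem_mono]
  constructor
  · rintro ⟨n, h⟩; exact ⟨n, by rw [← pw_inv, ← h, ii]⟩
  · rintro ⟨n, h⟩; exact ⟨n, by rw [h, ← pw_inv, ii]⟩

/-- twisted data -/
def LData.tw (D : LData S T) : LData S T where
  L := (invIso S).trans D.L
  th := D.th
  hi := D.hi
  hL e he := by
    show D.L (invIso S (mono e)) = _
    rw [invIso_mono, idem_inv he, D.hL e he]
  hs := D.hs

theorem RR_exists (hTC : TightlyConnected S) (D : LData S T) (hU : D.Up) {x : S}
    (hx : x ∈ NS S) : ∃ p, D.L (mono x) = mono p ∧ D.L (mono x⁻¹) = mono p⁻¹ ∧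
      (RR D x p ∨ RR D x p⁻¹) := by
  obtain ⟨p, h1, h2, h3⟩ := lemF' D hU hx
  refine ⟨p, h1, h2, ?_⟩
  rcases h3 with ⟨a, b⟩ | ⟨a, b⟩
  · left; exact RR_of_Pos hTC D hU ⟨h1, h2, a, b⟩ hx
  · right
    have hP : Pos D.tw x p⁻¹ := by
      refine ⟨?_, ?_, ?_, ?_⟩
      · show D.L (invIso S (mono x)) = _
        rw [invIso_mono, h2]
      · show D.L (invIso S (mono x⁻¹)) = _
        rw [invIso_mono, ii, ii, h1]
      · rw [ii]; exact a
      · rw [ii]; exact b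
    exact RR_of_Pos hTC D.tw hU hP hx

end G2


section H1
variable {S : Type*} [InverseSemigroup S]

theorem grp_pw {s : S} (h : s * s⁻¹ = s⁻¹ * s) (n : ℕ) :
    pw s n * (pw s n)⁻¹ = s * s⁻¹ ∧ (pw s n)⁻¹ * pw s n = s * s⁻¹ := by
  induction n with
  | zero => exact ⟨rfl, h.symm⟩
  | succ n ih =>
    obtain ⟨a, b⟩ := ih
    constructor
    · rw [pw_succ', rng_mul, a, h, imi', h]
    · rw [pw_succ, mir]
      calc s⁻¹ * (pw s n)⁻¹ * (pw s n * s) = s⁻¹ * ((pw s n)⁻¹ * pw s n) * s := by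
            simp only [mul_assoc]
        _ = s * s⁻¹ := by rw [b, iim', h]

theorem pureP {s s2 : S} (hg : s * s⁻¹ = s⁻¹ * s) (hs : Sharp s) (hm : s ∈ dsub s ⊔ mono s2) :
    s * s⁻¹ * (s2 * s2⁻¹) = s * s⁻¹ := by
  by_contra hc
  let Y : Subsemigroup S :=
    { carrier := {x | x ∈ dsub s ∨ ¬ (s * s⁻¹ * (x * x⁻¹) = s * s⁻¹)}
      mul_mem' := by
        rintro a b ha hb
        by_cases h1 : s * s⁻¹ * (a * a⁻¹) = s * s⁻¹
        · have ha := ha.resolve_right (not_not.2 h1)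
          rcases hb with hb | hb
          · exact Or.inl (mul_mem ha hb)
          · right
            intro h2
            apply hb
            obtain ⟨n, rfl⟩ := mem_dsub.1 ha
            obtain ⟨a1, a2⟩ := grp_pw hg (n + 1)
            rw [rng_mul, ← a1] at h2
            have := le_of_conj (idem_r b) h2
            rwa [a2] at this
        · right
          intro h2
          exact h1 (le_of_le_rng_mul h2) }
  have : dsub s ⊔ mono s2 ≤ Y := sup_le (fun x hx => Or.inl hx) (mono_le.2 (Or.inr hc))
  rcases this hm with h | h
  · exact hs h
  · exact h (idem_r s)

end H1

section H2
variable {S T : Type*} [InverseSemigroup S] [InverseSemigroup T]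

theorem RR.mul {D : LData S T} {s1 s2 : S} {t1 t2 : T} (h1 : RR D s1 t1) (h2 : RR D s2 t2) :
    RR D (s1 * s2) (t1 * t2) := by
  intro h ih
  constructor
  · calc (t1 * t2)⁻¹ * D.th h * (t1 * t2) = t2⁻¹ * (t1⁻¹ * D.th h * t1) * t2 := by
          rw [mir]; simp only [mul_assoc]
      _ = D.th (s2⁻¹ * (s1⁻¹ * h * s1) * s2) := by
          rw [(h1 h ih).1, (h2 _ (idem_conj ih s1)).1]
      _ = _ := by rw [mir]; simp only [mul_assoc]
  · calc (t1 * t2) * D.th h * (t1 * t2)⁻¹ = t1 * (t2 * D.th h * t2⁻¹) * t1⁻¹ := by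
          rw [mir]; simp only [mul_assoc]
      _ = D.th (s1 * (s2 * h * s2⁻¹) * s1⁻¹) := by
          rw [(h2 h ih).2, (h1 _ (idem_conj' ih s2)).2]
      _ = _ := by rw [mir]; simp only [mul_assoc]

theorem RR.inv {D : LData S T} {s : S} {t : T} (h : RR D s t) : RR D s⁻¹ t⁻¹ := by
  intro i ih
  rw [ii, ii]
  exact ⟨(h i ih).2, (h i ih).1⟩

theorem RR_idem {D : LData S T} (hU : D.Up) {j : S} (hj : IsIdempotentElem j) :
    RR D j (D.th j) := by
  intro h ih
  rw [idem_inv hj, idem_inv (D.hi j hj), ← hU _ _ hj ih, ← hU _ _ (idem_mul hj ih) hj]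
  exact ⟨rfl, rfl⟩

theorem RR.dom {D : LData S T} (hU : D.Up) {s : S} {t : T} (h : RR D s t) :
    t⁻¹ * t = D.th (s⁻¹ * s) := by
  obtain ⟨i, hi, hii⟩ := D.hs _ (idem_r t)
  have a1 := (h i hi).1
  rw [hii, iim'] at a1
  have a2 := (h _ (idem_r s)).1
  rw [iim'] at a2
  apply le_as (idem_l t) (D.hi _ (idem_l s))
  · rw [a1, ← hU _ _ (idem_conj hi s) (idem_l s), mul_assoc, imi']
  · rw [← a2, mul_assoc, imi']

theorem RR.rng {D : LData S T} (hU : D.Up) {s : S} {t : T} (h : RR D s t) :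
    t * t⁻¹ = D.th (s * s⁻¹) := by
  have := h.inv.dom hU
  rwa [ii, ii] at this

/-- the centralizing group -/
def KK (D : LData S T) (j : S) : Subsemigroup T where
  carrier := {m | m * m⁻¹ = D.th j ∧ m⁻¹ * m = D.th j ∧ ∀ u, IsIdempotentElem u → m * u = u * m}
  mul_mem' := by
    rintro a b ⟨a1, a2, a3⟩ ⟨b1, b2, b3⟩
    refine ⟨?_, ?_, ?_⟩
    · rw [rng_mul, b1, ← a2, imi', a1, a2]
    · rw [mir]
      calc b⁻¹ * a⁻¹ * (a * b) = b⁻¹ * (a⁻¹ * a) * b := by simp only [mul_assoc]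
        _ = _ := by rw [a2, ← b1, iim', b2, b1]
    · intro u hu
      rw [mul_assoc, b3 u hu, ← mul_assoc, a3 u hu, mul_assoc]

theorem KK_inv {D : LData S T} {j : S} {m : T} (h : m ∈ KK D j) : m⁻¹ ∈ KK D j := by
  obtain ⟨a, b, c⟩ := h
  refine ⟨by rw [ii]; exact b, by rw [ii]; exact a, ?_⟩
  intro u hu
  have := c u hu
  rw [← idem_inv hu, ← mir, ← mir, this]

theorem KK_idem {D : LData S T} {j : S} {m : T} (h : m ∈ KK D j) (hm : IsIdempotentElem m) :
    m = D.th j := by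
  have := h.1
  rwa [idem_inv hm, hm] at this

theorem th_KK (D : LData S T) {j : S} (hj : IsIdempotentElem j) : D.th j ∈ KK D j := by
  have := D.hi j hj
  refine ⟨by rw [idem_inv this, this], by rw [idem_inv this, this], ?_⟩
  intro u hu
  exact idem_comm this hu

theorem A0_idem {D : LData S T} {j s : S} (hj : IsIdempotentElem j) (h : s ∈ D.L.symm (KK D j))
    (hs : IsIdempotentElem s) : s = j := by
  rw [← D.mem hs, D.L.apply_symm_apply] at h
  exact D.inj hs hj (KK_idem h (D.hi s hs))

theorem A0_mem {D : LData S T} {j s : S} {t : T} (h : D.L (mono s) = mono t) :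
    s ∈ D.L.symm (KK D j) ↔ t ∈ KK D j := by
  rw [← mono_le, ← mono_le, ← h, ← D.L.le_iff_le, D.L.apply_symm_apply]

theorem A0_grp (hTC : TightlyConnected S) {D : LData S T} (hU : D.Up) {j s : S}
    (h : s ∈ D.L.symm (KK D j)) : s * s⁻¹ = s⁻¹ * s := by
  by_contra hn
  obtain ⟨p, h1, h2, h3⟩ := RR_exists hTC D hU (x := s) hn
  have hp := (A0_mem h1).1 h
  have e := hp.1.trans hp.2.1.symm
  rcases h3 with h3 | h3
  · rw [h3.rng hU, h3.dom hU] at e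
    exact hn (D.inj (idem_r s) (idem_l s) e)
  · have e1 := h3.rng hU
    have e2 := h3.dom hU
    rw [ii] at e1 e2
    rw [e1, e2] at e
    exact hn (D.inj (idem_l s) (idem_r s) e).symm

/-- companion element in the case without idempotent powers -/
theorem A0_comp {D : LData S T} {j s : S} (hj : IsIdempotentElem j)
    (h : s ∈ D.L.symm (KK D j)) (hn : ∀ n, ¬ IsIdempotentElem (pw s n)) :
    ∃ t s2, D.L (mono s) = mono t ∧ D.L (mono s2) = mono t⁻¹ ∧ s2 ∈ D.L.symm (KK D j) ∧
      Sharp s ∧ Sharp s2 ∧ Sharp t ∧ Sharp t⁻¹ ∧ t ∈ KK D j ∧ D.th j ∉ mono t⁻¹ := by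
  have ss : Sharp s := by
    by_contra hc
    obtain ⟨n, hh⟩ := idem_of_not_sharp hc
    exact hn n hh
  obtain ⟨t, ht⟩ := exists_gen D.L ss
  have tK := (A0_mem ht).1 h
  have nt : ∀ n, ¬ IsIdempotentElem (pw t n) := by
    intro n hi
    have := KK_idem (pw_mem tK n) hi
    have h2 : D.th j ∈ D.L (mono s) := by rw [ht, ← this]; exact pw_mem (self_mono t) n
    rw [D.mem hj] at h2
    obtain ⟨m, hm⟩ := mem_mono.1 h2
    exact hn m (hm ▸ hj)
  have nt2 : ∀ n, ¬ IsIdempotentElem (pw t⁻¹ n) := by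
    intro n hi
    apply nt n
    rw [← pw_inv] at hi
    have := idem_inv hi
    rw [ii] at this
    rwa [this]
  have st : Sharp t := by
    by_contra hc
    obtain ⟨n, hh⟩ := idem_of_not_sharp hc
    exact nt n hh
  have st2 : Sharp t⁻¹ := by
    by_contra hc
    obtain ⟨n, hh⟩ := idem_of_not_sharp hc
    exact nt2 n hh
  obtain ⟨s2, hs2⟩ := exists_gen D.L.symm st2
  have hs2' : D.L (mono s2) = mono t⁻¹ := by rw [← hs2, D.L.apply_symm_apply]
  refine ⟨t, s2, ht, hs2', (A0_mem hs2').2 (KK_inv tK), ss, ?_, st, st2, tK, ?_⟩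
  · by_contra hc
    obtain ⟨n, hh⟩ := idem_of_not_sharp hc
    have h2 : pw s2 n ∈ mono s2 := pw_mem (self_mono s2) n
    rw [← D.mem hh, hs2'] at h2
    obtain ⟨m, hm⟩ := mem_mono.1 h2
    exact nt2 m (hm ▸ D.hi _ hh)
  · intro h2
    obtain ⟨m, hm⟩ := mem_mono.1 h2
    exact nt2 m (hm ▸ D.hi _ hj)

theorem A0_gen {D : LData S T} {s s2 : S} {t : T} (h1 : D.L (mono s) = mono t)
    (h2 : D.L (mono s2) = mono t⁻¹) (st : Sharp t) (ht : t * t⁻¹ = t⁻¹ * t) :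
    s ∈ dsub s ⊔ mono s2 := by
  have m : t ∈ dsub t ⊔ mono t⁻¹ := by
    have : t = pw t 1 * t⁻¹ := by
      show t = t * t * t⁻¹
      rw [mul_assoc, ht, imi']
    have m2 : pw t 1 * t⁻¹ ∈ dsub t ⊔ mono t⁻¹ :=
      mul_mem (Subsemigroup.mem_sup_left (mem_dsub.2 ⟨0, rfl⟩))
        (Subsemigroup.mem_sup_right (self_mono _))
    rwa [← this] at m2
  rw [← mono_le] at m ⊢
  rw [← h1, ← h2, ← D.L.symm.le_iff_le, map_sup, D.L.symm_apply_apply, D.L.symm_apply_apply] at m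
  exact m.trans (sup_le_sup_right (symm_dsub_le D.L st h1) _)

theorem A0_rng (hTC : TightlyConnected S) {D : LData S T} (hU : D.Up) {j s : S}
    (hj : IsIdempotentElem j) (h : s ∈ D.L.symm (KK D j)) : s * s⁻¹ = j := by
  have hg := A0_grp hTC hU h
  by_cases hn : ∃ n, IsIdempotentElem (pw s n)
  · obtain ⟨n, hn⟩ := hn
    rw [← (grp_pw hg n).1, idem_inv hn, hn]
    exact A0_idem hj (pw_mem h n) hn
  push Not at hn
  obtain ⟨t, s2, h1, h2, h3, h4, h5, h6, h7, h8, h9⟩ := A0_comp hj h hn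
  have hg2 := A0_grp hTC hU h3
  have ht := h8.1.trans h8.2.1.symm
  have p1 := pureP hg h4 (A0_gen h1 h2 h6 ht)
  have p2 := pureP hg2 h5 (A0_gen h2 (by rw [ii]; exact h1) h7 (by rw [ii]; exact ht.symm))
  have e := le_as (idem_r s) (idem_r s2) p1 p2
  let H : Subsemigroup S :=
    { carrier := {x | x * x⁻¹ = s * s⁻¹ ∧ x⁻¹ * x = s * s⁻¹}
      mul_mem' := by
        rintro a b ⟨a1, a2⟩ ⟨b1, b2⟩
        constructor
        · rw [rng_mul, b1, ← a2, imi', a1, a2]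
        · rw [mir]
          calc b⁻¹ * a⁻¹ * (a * b) = b⁻¹ * (a⁻¹ * a) * b := by simp only [mul_assoc]
            _ = _ := by rw [a2, ← b1, iim', b2, b1] }
  have hH : mono s ⊔ mono s2 ≤ H :=
    sup_le (mono_le.2 ⟨rfl, hg.symm⟩) (mono_le.2 ⟨e.symm, hg2.symm.trans e.symm⟩)
  have hm : j ∈ mono s ⊔ mono s2 := by
    rw [← D.mem hj, map_sup, h1, h2, ← h8.1]
    exact mul_mem (Subsemigroup.mem_sup_left (self_mono _))
      (Subsemigroup.mem_sup_right (self_mono _))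
  have := (hH hm).1
  rw [idem_inv hj, hj] at this
  exact this.symm

theorem A0_inv (hTC : TightlyConnected S) {D : LData S T} (hU : D.Up) {j s : S}
    (hj : IsIdempotentElem j) (h : s ∈ D.L.symm (KK D j)) : s⁻¹ ∈ D.L.symm (KK D j) := by
  have hg := A0_grp hTC hU h
  have hr := A0_rng hTC hU hj h
  by_cases hn : ∃ n, IsIdempotentElem (pw s n)
  · obtain ⟨n, hn⟩ := hn
    have e := A0_idem hj (pw_mem h n) hn
    have : s⁻¹ = pw s (n + n) := by
      have e2 : s * pw s (n + n) = j := by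
        rw [← pw_succ', ← pw_mul, e, hj]
      have e3 : s⁻¹ * s * pw s (n + n) = pw s (n + n) := by
        rw [← hg]
        have := imi (pw s (n + n))
        rwa [(grp_pw hg _).1] at this
      rw [← e3, mul_assoc, e2, ← hr, iim']
    rw [this]
    exact pw_mem h _
  push Not at hn
  by_contra hc
  obtain ⟨t, s2, h1, h2, h3, h4, h5, h6, h7, h8, h9⟩ := A0_comp hj h hn
  let Y : Subsemigroup S :=
    { carrier := {x | x ∈ D.L.symm (KK D j) ∧ (x ∈ mono s2 ∨ x⁻¹ ∉ D.L.symm (KK D j))}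
      mul_mem' := by
        rintro a b ⟨a1, a2⟩ ⟨b1, b2⟩
        refine ⟨mul_mem a1 b1, ?_⟩
        have ra := A0_rng hTC hU hj a1
        have rb := A0_rng hTC hU hj b1
        have ga := A0_grp hTC hU a1
        have gb := A0_grp hTC hU b1
        rcases a2 with a2 | a2
        · rcases b2 with b2 | b2
          · exact Or.inl (mul_mem a2 b2)
          · right
            intro hab
            apply b2
            have := mul_mem hab a1
            have e : (a * b)⁻¹ * a = b⁻¹ := by rw [mir, mul_assoc, ← ga, ra, ← rb, iim']
            rwa [e] at this
        · right
          intro hab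
          apply a2
          have := mul_mem b1 hab
          have e : b * (a * b)⁻¹ = a⁻¹ := by rw [mir, ← mul_assoc, rb, ← ra, ga, iim]
          rwa [e] at this }
  have hY : mono s ⊔ mono s2 ≤ Y :=
    sup_le (mono_le.2 ⟨h, Or.inr hc⟩) (mono_le.2 ⟨h3, Or.inl (self_mono s2)⟩)
  have hm : j ∈ mono s ⊔ mono s2 := by
    rw [← D.mem hj, map_sup, h1, h2, ← h8.1]
    exact mul_mem (Subsemigroup.mem_sup_left (self_mono _))
      (Subsemigroup.mem_sup_right (self_mono _))
  obtain ⟨m1, m2⟩ := hY hm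
  rw [idem_inv hj] at m2
  have m2 := m2.resolve_right (not_not.2 m1)
  rw [← D.mem hj, h2] at m2
  exact h9 m2

theorem KK_sup_idem {D : LData S T} (hU : D.Up) {j h : S} (hj : IsIdempotentElem j)
    (hh : IsIdempotentElem h) (hle : h * j = h) {u : T} (hu : IsIdempotentElem u)
    (hm : u ∈ KK D j ⊔ mono (D.th h)) : u = D.th j ∨ u = D.th h := by
  have ith := D.hi h hh
  have e1 : D.th j * D.th h = D.th h := by rw [← hU _ _ hj hh, idem_comm hj hh, hle]
  let Z : Subsemigroup T :=
    { carrier := {m | m ∈ KK D j ∨ ∃ n ∈ KK D j, m = n * D.th h}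
      mul_mem' := by
        rintro a b (ha | ⟨n, ha, rfl⟩) (hb | ⟨n', hb, rfl⟩)
        · exact Or.inl (mul_mem ha hb)
        · exact Or.inr ⟨_, mul_mem ha hb, by rw [mul_assoc]⟩
        · exact Or.inr ⟨_, mul_mem ha hb, by rw [mul_assoc, ← hb.2.2 _ ith, mul_assoc]⟩
        · refine Or.inr ⟨_, mul_mem ha hb, ?_⟩
          calc n * D.th h * (n' * D.th h) = n * (D.th h * n') * D.th h := by simp only [mul_assoc]
            _ = n * n' * (D.th h * D.th h) := by rw [← hb.2.2 _ ith]; simp only [mul_assoc]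
            _ = _ := by rw [ith] }
  have hZ : KK D j ⊔ mono (D.th h) ≤ Z :=
    sup_le (fun x hx => Or.inl hx) (mono_le.2 (Or.inr ⟨_, th_KK D hj, e1.symm⟩))
  rcases hZ hm with h1 | ⟨n, hn, rfl⟩
  · exact Or.inl (KK_idem h1 hu)
  · right
    have : n * D.th h * (n * D.th h)⁻¹ = D.th h := by
      rw [rng_mul, idem_inv ith, ith, hn.2.2 _ ith, mul_assoc, hn.1, idem_comm ith (D.hi j hj), e1]
    rwa [idem_inv hu, hu] at this

theorem A0_triv (hTC : TightlyConnected S) (hF : Fundamental S) {D : LData S T} (hU : D.Up)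
    {j s : S} (hj : IsIdempotentElem j) (h : s ∈ D.L.symm (KK D j)) : s = j := by
  have hg := A0_grp hTC hU h
  have hr := A0_rng hTC hU hj h
  have hi := A0_inv hTC hU hj h
  have hl : s⁻¹ * s = j := by rw [← hg, hr]
  have key : ∀ g, IsIdempotentElem g → g * j = g → s⁻¹ * g * s = g := by
    intro g ig hle
    have hm : s⁻¹ * g * s ∈ D.L.symm (KK D j) ⊔ mono g :=
      mul_mem (mul_mem (Subsemigroup.mem_sup_left hi) (Subsemigroup.mem_sup_right (self_mono g)))
        (Subsemigroup.mem_sup_left h)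
    have ic := idem_conj ig s
    rw [← D.mem ic, map_sup, D.L.apply_symm_apply, D.hL g ig] at hm
    rcases KK_sup_idem hU hj ig hle (D.hi _ ic) hm with e | e
    · have e := D.inj ic hj e
      have b := conj_back ig (by rw [hr, hle])
      rw [e, ← hl, imi', hr] at b
      rw [e, b]
    · exact D.inj ic ig e
  apply hF
  intro g ig
  have e1 : s⁻¹ * g * s = s⁻¹ * (g * j) * s := by
    calc s⁻¹ * g * s = s⁻¹ * g * (s * s⁻¹ * s) := by rw [imi]
      _ = s⁻¹ * (g * (s * s⁻¹)) * s := by simp only [mul_assoc]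
      _ = _ := by rw [hr]
  rw [e1, key _ (idem_mul ig hj) (by rw [mul_assoc, hj]), idem_inv hj, idem_comm hj ig, mul_assoc, hj]

theorem RR_fun (hTC : TightlyConnected S) (hF : Fundamental S) {D : LData S T} (hU : D.Up)
    {s : S} {t1 t2 : T} (h1 : RR D s t1) (h2 : RR D s t2) : t1 = t2 := by
  have hk := h1.inv.mul h2
  have hj := idem_l s
  have r := hk.rng hU
  have d := hk.dom hU
  rw [idem_inv hj, hj] at r d
  have hK : t1⁻¹ * t2 ∈ KK D (s⁻¹ * s) := by
    refine ⟨r, d, ?_⟩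
    intro u hu
    obtain ⟨i, hi, rfl⟩ := D.hs u hu
    have e := (hk i hi).1
    rw [idem_inv hj, hU _ _ (idem_mul hj hi) hj, hU _ _ hj hi] at e
    rw [push_r hu (t1⁻¹ * t2), e, ← d, mul_assoc ((t1⁻¹ * t2)⁻¹ * (t1⁻¹ * t2)),
      idem_comm hu (idem_l _), ← mul_assoc ((t1⁻¹ * t2)⁻¹ * (t1⁻¹ * t2)), idem_l, ← mul_assoc, imi']
  have e : t1⁻¹ * t2 = D.th (s⁻¹ * s) := by
    have : mono (t1⁻¹ * t2) ≤ mono (D.th (s⁻¹ * s)) := by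
      rw [← D.hL _ hj, ← D.L.symm.le_iff_le, D.L.symm_apply_apply]
      intro x hx
      have : x ∈ D.L.symm (KK D (s⁻¹ * s)) := D.L.symm.monotone (mono_le.2 hK) hx
      rw [A0_triv hTC hF hU hj this]
      exact self_mono _
    exact (mem_mono_idem (D.hi _ hj)).1 (this (self_mono _))
  calc t1 = t1 * (t1⁻¹ * t1) := (imi' _).symm
    _ = t1 * (t1⁻¹ * t2) := by rw [h1.dom hU, e]
    _ = t2 := by rw [← mul_assoc, h1.rng hU, ← h2.rng hU, imi]

theorem iso_of_up (hTC : TightlyConnected S) (hF : Fundamental S) (hNI : NoIsolatedNontrivial S)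
    (D : LData S T) (hU : D.Up) :
    ∃ φ : S → T, Function.Bijective φ ∧ ∀ a b : S, φ (a * b) = φ a * φ b := by
  have tot : ∀ s, ∃ t, RR D s t := by
    let A : Subsemigroup S :=
      { carrier := {s | ∃ t, RR D s t}
        mul_mem' := by
          rintro a b ⟨t, h⟩ ⟨t', h'⟩
          exact ⟨_, h.mul h'⟩ }
    intro s
    refine gen_NE (A := A) hNI ?_ (fun e he => ⟨_, RR_idem hU he⟩) s
    intro x hx
    obtain ⟨p, -, -, h | h⟩ := RR_exists hTC D hU hx
    · exact ⟨_, h⟩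
    · exact ⟨_, h⟩
  have ont : ∀ t, ∃ s, RR D s t := by
    let V : Subsemigroup T :=
      { carrier := {t | ∃ s, RR D s t}
        mul_mem' := by
          rintro a b ⟨t, h⟩ ⟨t', h'⟩
          exact ⟨_, h.mul h'⟩ }
    have h1 : ∀ s : S, s ∈ D.L.symm V := by
      apply gen_NE hNI
      · intro x hx
        obtain ⟨p, h1, -, h⟩ := RR_exists hTC D hU hx
        rw [← mono_le, ← D.L.symm_apply_apply (mono x)]
        apply D.L.symm.monotone
        rw [h1, mono_le]
        rcases h with h | h
        · exact ⟨_, h⟩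
        · exact ⟨x⁻¹, by have := h.inv; rwa [ii] at this⟩
      · intro e he
        rw [← D.mem he, D.L.apply_symm_apply]
        exact ⟨e, RR_idem hU he⟩
    have h2 : D.L.symm V = ⊤ := by rw [eq_top_iff]; intro s _; exact h1 s
    have h3 : V = ⊤ := by rw [← D.L.apply_symm_apply V, h2, map_top]
    intro t
    have : t ∈ V := by rw [h3]; trivial
    exact this
  choose φ hφ using tot
  refine ⟨φ, ⟨?_, ?_⟩, ?_⟩
  · intro a b hab
    apply hF
    intro e he
    have h1 := (hφ a e he).1
    rw [hab, (hφ b e he).1] at h1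
    exact (D.inj (idem_conj he b) (idem_conj he a) h1).symm
  · intro t
    obtain ⟨s, hs⟩ := ont t
    exact ⟨s, RR_fun hTC hF hU (hφ s) hs⟩
  · intro a b
    exact RR_fun hTC hF hU (hφ _) ((hφ a).mul (hφ b))

end H2

theorem iso_of_up' {S T : Type*} [InverseSemigroup S] [Semigroup T] (hTC : TightlyConnected S)
    (hF : Fundamental S) (hNI : NoIsolatedNontrivial S) (D : LData S T) (hU : D.Up) :
    ∃ φ : S → T, Function.Bijective φ ∧ ∀ a b : S, φ (a * b) = φ a * φ b := by
  let _ := invOf (isInverse_T hNI D hU)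
  exact iso_of_up hTC hF hNI D hU


section Psa
variable {M N : Type*} [Semigroup M] [Semigroup N]

/-- identity map of a subsemigroup -/
def idG (A : Subsemigroup M) : PSA M :=
  ⟨{p | p.1 = p.2 ∧ p.1 ∈ A}, by
    refine ⟨?_, ?_, ?_⟩
    · rintro ⟨a, b⟩ ⟨h1, h2⟩ ⟨c, d⟩ ⟨h3, h4⟩ h
      simp_all
    · rintro ⟨a, b⟩ ⟨h1, h2⟩ ⟨c, d⟩ ⟨h3, h4⟩ h
      simp_all
    · rintro ⟨a, b⟩ ⟨h1, h2⟩ ⟨c, d⟩ ⟨h3, h4⟩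
      refine ⟨?_, mul_mem h2 h4⟩
      simp_all⟩

theorem mem_idG {A : Subsemigroup M} {a b : M} : (a, b) ∈ (idG A).1 ↔ a = b ∧ a ∈ A := Iff.rfl

theorem mem_comp {α β : PSA M} {a c : M} :
    (a, c) ∈ (psacomp α β).1 ↔ ∃ b, (a, b) ∈ α.1 ∧ (b, c) ∈ β.1 := Iff.rfl

theorem psa_ext {α β : PSA M} (h : ∀ a b, (a, b) ∈ α.1 ↔ (a, b) ∈ β.1) : α = β := by
  apply Subtype.ext
  ext ⟨a, b⟩
  exact h a b

/-- fixed points -/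
def fixS (α : PSA M) : Subsemigroup M where
  carrier := {a | (a, a) ∈ α.1}
  mul_mem' := fun ha hb => α.2.2.2 _ ha _ hb

theorem eq_idG {α : PSA M} (h : psacomp α α = α) : α = idG (fixS α) := by
  apply psa_ext
  intro a b
  rw [mem_idG]
  constructor
  · intro hab
    have h2 := hab
    rw [← h, mem_comp] at h2
    obtain ⟨c, h3, h4⟩ := h2
    have e1 : c = b := α.2.1 _ h3 _ hab rfl
    subst e1
    have e2 : a = c := α.2.2.1 _ hab _ h4 rfl
    subst e2
    exact ⟨rfl, hab⟩
  · rintro ⟨rfl, h⟩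
    exact h

theorem idG_comp (A B : Subsemigroup M) : psacomp (idG A) (idG B) = idG (A ⊓ B) := by
  apply psa_ext
  intro a b
  rw [mem_comp, mem_idG]
  constructor
  · rintro ⟨c, h1, h2⟩
    obtain ⟨rfl, k1⟩ := mem_idG.1 h1
    obtain ⟨rfl, k2⟩ := mem_idG.1 h2
    exact ⟨rfl, k1, k2⟩
  · rintro ⟨rfl, k1, k2⟩
    exact ⟨a, ⟨rfl, k1⟩, ⟨rfl, k2⟩⟩

theorem idG_inj {A B : Subsemigroup M} (h : idG A = idG B) : A = B := by
  ext a
  have : (a, a) ∈ (idG A).1 ↔ (a, a) ∈ (idG B).1 := by rw [h]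
  rw [mem_idG, mem_idG] at this
  simpa using this

theorem idG_le {A B : Subsemigroup M} : psacomp (idG A) (idG B) = idG A ↔ A ≤ B := by
  rw [idG_comp]
  constructor
  · intro h; exact inf_eq_left.1 (idG_inj h)
  · intro h; rw [inf_eq_left.2 h]

variable (Φ : PSA M ≃ PSA N) (hΦ : ∀ α β, Φ (psacomp α β) = psacomp (Φ α) (Φ β))

theorem Phi_symm (hΦ : ∀ α β, Φ (psacomp α β) = psacomp (Φ α) (Φ β)) (α β : PSA N) :
    Φ.symm (psacomp α β) = psacomp (Φ.symm α) (Φ.symm β) := by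
  apply Φ.injective
  rw [hΦ]
  simp

theorem Phi_idG (hΦ : ∀ α β, Φ (psacomp α β) = psacomp (Φ α) (Φ β)) (A : Subsemigroup M) :
    Φ (idG A) = idG (fixS (Φ (idG A))) := by
  apply eq_idG
  rw [← hΦ, idG_comp, inf_idem]

/-- induced lattice isomorphism -/
def isoL (hΦ : ∀ α β, Φ (psacomp α β) = psacomp (Φ α) (Φ β)) : Subsemigroup M ≃o Subsemigroup N where
  toFun A := fixS (Φ (idG A))
  invFun A := fixS (Φ.symm (idG A))
  left_inv A := by
    apply idG_inj
    rw [← Phi_idG Φ.symm (Phi_symm Φ hΦ), ← Phi_idG Φ hΦ, Φ.symm_apply_apply]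
  right_inv A := by
    apply idG_inj
    rw [← Phi_idG Φ hΦ, ← Phi_idG Φ.symm (Phi_symm Φ hΦ), Φ.apply_symm_apply]
  map_rel_iff' := by
    intro A B
    show fixS (Φ (idG A)) ≤ fixS (Φ (idG B)) ↔ A ≤ B
    rw [← idG_le, ← idG_le, ← Phi_idG Φ hΦ, ← Phi_idG Φ hΦ, ← hΦ]
    exact Φ.injective.eq_iff

theorem isoL_spec (hΦ : ∀ α β, Φ (psacomp α β) = psacomp (Φ α) (Φ β)) (A : Subsemigroup M) :
    Φ (idG A) = idG (isoL Φ hΦ A) := Phi_idG Φ hΦ A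

theorem mono_atom {t : M} (ht : IsIdempotentElem t) : IsAtom (mono t) := by
  constructor
  · intro h
    have := self_mono t
    rw [h] at this
    exact Subsemigroup.notMem_bot this
  · intro B hB
    rw [eq_bot_iff]
    intro b hb
    exfalso
    have := (mem_mono_idem ht).1 (hB.le hb)
    subst this
    exact hB.not_ge (mono_le.2 hb)

theorem atom_mono {C : Subsemigroup M} (h : IsAtom C) :
    ∃ t, IsIdempotentElem t ∧ C = mono t := by
  have hne : ∃ s, s ∈ C := by
    by_contra hc
    push Not at hc
    apply h.1
    rw [eq_bot_iff]
    intro b hb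
    exact absurd hb (hc b)
  have key : ∀ B ≤ C, ∀ b ∈ B, B = C := by
    intro B hB b hb
    rcases h.le_iff.1 hB with h1 | h1
    · rw [h1] at hb; exact absurd hb Subsemigroup.notMem_bot
    · exact h1
  obtain ⟨s, hs⟩ := hne
  have k2 : dsub s = C := key _ ((dsub_le s).trans (mono_le.2 hs)) _ (mem_dsub.2 ⟨0, rfl⟩)
  have : ¬ Sharp s := by
    intro h2
    apply h2
    rw [k2]; exact hs
  obtain ⟨n, hn⟩ := idem_of_not_sharp this
  exact ⟨_, hn, (key _ (mono_le.2 (pw_mem hs n)) _ (self_mono _)).symm⟩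

end Psa

section LD0
variable {S T : Type*} [InverseSemigroup S] [Semigroup T]

theorem exists_LData (Φ : PSA S ≃ PSA T)
    (hΦ : ∀ α β, Φ (psacomp α β) = psacomp (Φ α) (Φ β)) :
    ∃ D : LData S T, ∀ (α : PSA S) (e g : S), IsIdempotentElem e → IsIdempotentElem g →
      ((e, g) ∈ α.1 ↔ (D.th e, D.th g) ∈ (Φ α).1) := by
  have ex : ∀ e : S, IsIdempotentElem e → ∃ t : T, IsIdempotentElem t ∧
      isoL Φ hΦ (mono e) = mono t := fun e he =>
    atom_mono (((isoL Φ hΦ).isAtom_iff _).2 (mono_atom he))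
  have ex2 : ∀ e : S, ∃ t : T, IsIdempotentElem e → (IsIdempotentElem t ∧
      isoL Φ hΦ (mono e) = mono t) := by
    intro e
    by_cases he : IsIdempotentElem e
    · obtain ⟨t, ht⟩ := ex e he
      exact ⟨t, fun _ => ht⟩
    · obtain ⟨t, ht⟩ := ex _ (idem_r e)
      exact ⟨t, fun h => absurd h he⟩
  choose th hth using ex2
  refine ⟨⟨isoL Φ hΦ, th, fun e he => (hth e he).1, fun e he => (hth e he).2, ?_⟩, ?_⟩
  · intro t ht
    obtain ⟨e, he, h⟩ := atom_mono (((isoL Φ hΦ).symm.isAtom_iff _).2 (mono_atom ht))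
    refine ⟨e, he, ?_⟩
    have h2 : mono (th e) = mono t := by
      rw [← (hth e he).2, ← h, OrderIso.apply_symm_apply]
    have h3 := self_mono (th e)
    rw [h2, mem_mono_idem ht] at h3
    exact h3
  · intro α e g he hg
    show _ ↔ (th e, th g) ∈ (Φ α).1
    have a1 : (e, g) ∈ α.1 ↔ psacomp (psacomp (idG (mono e)) α) (idG (mono g)) ≠ idG ⊥ := by
      constructor
      · intro h h2
        have : (e, g) ∈ (idG (⊥ : Subsemigroup S)).1 := by
          rw [← h2]
          exact ⟨g, ⟨e, ⟨rfl, self_mono e⟩, h⟩, ⟨rfl, self_mono g⟩⟩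
        exact Subsemigroup.notMem_bot (mem_idG.1 this).2
      · intro h
        by_contra hc
        apply h
        apply psa_ext
        intro a b
        constructor
        · rintro ⟨c, ⟨d, ⟨h1, h2⟩, h3⟩, ⟨h4, h5⟩⟩
          exfalso
          dsimp only at h1 h2 h3 h4 h5
          rw [mem_mono_idem he] at h2
          rw [mem_mono_idem hg] at h5
          rw [← h1, h2, h5] at h3
          exact hc h3
        · intro h; exact absurd (mem_idG.1 h).2 Subsemigroup.notMem_bot
    have a2 : (th e, th g) ∈ (Φ α).1 ↔
        psacomp (psacomp (idG (mono (th e))) (Φ α)) (idG (mono (th g))) ≠ idG ⊥ := by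
      constructor
      · intro h h2
        have : (th e, th g) ∈ (idG (⊥ : Subsemigroup T)).1 := by
          rw [← h2]
          exact ⟨th g, ⟨th e, ⟨rfl, self_mono _⟩, h⟩, ⟨rfl, self_mono _⟩⟩
        exact Subsemigroup.notMem_bot (mem_idG.1 this).2
      · intro h
        by_contra hc
        apply h
        apply psa_ext
        intro a b
        constructor
        · rintro ⟨c, ⟨d, ⟨h1, h2⟩, h3⟩, ⟨h4, h5⟩⟩
          exfalso
          dsimp only at h1 h2 h3 h4 h5
          rw [mem_mono_idem (hth e he).1] at h2
          rw [mem_mono_idem (hth g hg).1] at h5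
          rw [← h1, h2, h5] at h3
          exact hc h3
        · intro h; exact absurd (mem_idG.1 h).2 Subsemigroup.notMem_bot
    have a3 : idG (⊥ : Subsemigroup T) = Φ (idG ⊥) := by
      rw [isoL_spec Φ hΦ, map_bot]
    rw [a1, a2, a3, ← (hth e he).2, ← (hth g hg).2, ← isoL_spec Φ hΦ, ← isoL_spec Φ hΦ, ← hΦ, ← hΦ]
    exact Φ.injective.ne_iff.symm

/-- downward type -/
def LData.Down (D : LData S T) : Prop :=
  ∀ e f, IsIdempotentElem e → IsIdempotentElem f → (e * f = e ∨ f * e = f) ∧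
    (e * f = e → D.th e * D.th f = D.th f ∧ D.th f * D.th e = D.th f)

theorem LData.band (D : LData S T) {C : Subsemigroup S} (hC : ∀ c ∈ C, IsIdempotentElem c)
    {t : T} (ht : t ∈ D.L C) : ∃ i ∈ C, t = D.th i := by
  have h1 : D.L.symm (mono t) ≤ C := by
    rw [← D.L.symm_apply_apply C]
    exact D.L.symm.monotone (mono_le.2 ht)
  have hne : ∃ s, s ∈ D.L.symm (mono t) := by
    by_contra hc
    push Not at hc
    have : D.L.symm (mono t) = ⊥ := by
      rw [eq_bot_iff]
      intro b hb
      exact absurd hb (hc b)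
    rw [← D.L.symm.map_bot, D.L.symm.injective.eq_iff] at this
    have h := self_mono t
    rw [this] at h
    exact Subsemigroup.notMem_bot h
  obtain ⟨i, hi⟩ := hne
  have ii' := hC i (h1 hi)
  refine ⟨i, h1 hi, ?_⟩
  have : D.L.symm (mono t) ≤ mono i := by
    intro k hk
    have ik := hC k (h1 hk)
    rw [mem_mono_idem ii']
    rw [← D.mem ii', D.L.apply_symm_apply] at hi
    rw [← D.mem ik, D.L.apply_symm_apply] at hk
    exact D.inj ik ii' (mono_idem_unique hk hi (D.hi _ ik) (D.hi _ ii'))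
  rw [← D.L.le_iff_le, D.L.apply_symm_apply, D.hL i ii'] at this
  exact (mem_mono_idem (D.hi _ ii')).1 (this (self_mono t))

theorem LData.three (D : LData S T) {e f : S} (he : IsIdempotentElem e) (hf : IsIdempotentElem f) :
    D.th e * D.th f = D.th e ∨ D.th e * D.th f = D.th f ∨ D.th e * D.th f = D.th (e * f) := by
  have hc := idem_comm he hf
  let C : Subsemigroup S :=
    { carrier := {s | s = e ∨ s = f ∨ s = e * f}
      mul_mem' := by
        have x1 : e * (e * f) = e * f := by rw [← mul_assoc, he]
        have x2 : f * (e * f) = e * f := by rw [hc, ← mul_assoc, hf]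
        have x3 : e * f * e = e * f := by rw [mul_assoc, ← hc, x1]
        have x4 : e * f * f = e * f := by rw [mul_assoc, hf]
        have x5 : e * f * (e * f) = e * f := idem_mul he hf
        have x6 : e * e = e := he
        have x7 : f * f = f := hf
        rintro a b (rfl | rfl | rfl) (rfl | rfl | rfl) <;> simp_all }
  have hC : ∀ c ∈ C, IsIdempotentElem c := by
    rintro c (rfl | rfl | rfl)
    · exact he
    · exact hf
    · exact idem_mul he hf
  have m : D.th e * D.th f ∈ D.L C :=
    mul_mem ((D.mem he).2 (Or.inl rfl)) ((D.mem hf).2 (Or.inr (Or.inl rfl)))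
  obtain ⟨i, hi, h⟩ := D.band hC m
  rcases hi with rfl | rfl | rfl
  · exact Or.inl h
  · exact Or.inr (Or.inl h)
  · exact Or.inr (Or.inr h)

theorem LData.closed2 (D : LData S T) {e f : S} (he : IsIdempotentElem e)
    (hf : IsIdempotentElem f) (h1 : D.th e * D.th f = D.th e ∨ D.th e * D.th f = D.th f)
    (h2 : D.th f * D.th e = D.th e ∨ D.th f * D.th e = D.th f) : e * f = e ∨ e * f = f := by
  let B : Subsemigroup T :=
    { carrier := {s | s = D.th e ∨ s = D.th f}
      mul_mem' := by
        have x6 : D.th e * D.th e = D.th e := D.hi e he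
        have x7 : D.th f * D.th f = D.th f := D.hi f hf
        rintro a b (rfl | rfl) (rfl | rfl)
        · exact Or.inl x6
        · exact h1
        · exact h2
        · exact Or.inr x7 }
  have m1 : e ∈ D.L.symm B := by
    rw [← D.mem he, D.L.apply_symm_apply]; exact Or.inl rfl
  have m2 : f ∈ D.L.symm B := by
    rw [← D.mem hf, D.L.apply_symm_apply]; exact Or.inr rfl
  have m3 := mul_mem m1 m2
  rw [← D.mem (idem_mul he hf), D.L.apply_symm_apply] at m3
  rcases m3 with h | h
  · exact Or.inl (D.inj (idem_mul he hf) he h)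
  · exact Or.inr (D.inj (idem_mul he hf) hf h)

/-- two-element graph -/
theorem pair_psa {M : Type*} [Semigroup M] {a b c d : M} (h1 : a = c ↔ b = d) 
    (haa : a * a = a) (hcc : c * c = c) (hbb : b * b = b) (hdd : d * d = d)
    (hac : (a * c = a ∧ b * d = b) ∨ (a * c = c ∧ b * d = d))
    (hca : (c * a = a ∧ d * b = b) ∨ (c * a = c ∧ d * b = d)) :
    IsPSAGraph ({(a, b), (c, d)} : Set (M × M)) := by
  refine ⟨?_, ?_, ?_⟩
  · rintro _ (rfl | rfl) _ (rfl | rfl) h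
    · rfl
    · exact h1.1 h
    · exact (h1.1 h.symm).symm
    · rfl
  · rintro _ (rfl | rfl) _ (rfl | rfl) h
    · rfl
    · exact h1.2 h
    · exact (h1.2 h.symm).symm
    · rfl
  · rintro _ (rfl | rfl) _ (rfl | rfl)
    · left; dsimp only; rw [haa, hbb]
    · rcases hac with ⟨h, h'⟩ | ⟨h, h'⟩
      · left; dsimp only; rw [h, h']
      · right; dsimp only; rw [h, h']; rfl
    · rcases hca with ⟨h, h'⟩ | ⟨h, h'⟩
      · left; dsimp only; rw [h, h']
      · right; dsimp only; rw [h, h']; rfl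
    · right; dsimp only; rw [hcc, hdd]; rfl

theorem up_or_down (Φ : PSA S ≃ PSA T)
    (hΦ : ∀ α β, Φ (psacomp α β) = psacomp (Φ α) (Φ β)) :
    ∃ D : LData S T, D.Up ∨ D.Down := by
  obtain ⟨D, hD⟩ := exists_LData Φ hΦ
  refine ⟨D, ?_⟩
  have ti : ∀ e, IsIdempotentElem e → D.th e * D.th e = D.th e := fun e he => D.hi e he
  -- swap graphs are impossible
  have noswap : ∀ e f, IsIdempotentElem e → IsIdempotentElem f → e * f = e → e ≠ f →
      ¬ IsPSAGraph ({(D.th e, D.th f), (D.th f, D.th e)} : Set (T × T)) := by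
    intro e f he hf hef hne hg
    obtain ⟨α, hα⟩ := Φ.surjective ⟨_, hg⟩
    have m1 : (e, f) ∈ α.1 := by rw [hD α e f he hf, hα]; left; rfl
    have m2 : (f, e) ∈ α.1 := by rw [hD α f e hf he, hα]; right; rfl
    have m3 := α.2.2.2 _ m1 _ m2
    dsimp only at m3
    rw [idem_comm hf he, hef] at m3
    exact hne (α.2.1 _ m3 _ m1 rfl)
  have dich : ∀ e f, IsIdempotentElem e → IsIdempotentElem f → e * f = e → e ≠ f →
      (D.th e * D.th f = D.th e ∧ D.th f * D.th e = D.th e) ∨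
      (D.th e * D.th f = D.th f ∧ D.th f * D.th e = D.th f) := by
    intro e f he hf hef hne
    have h1 : D.th e * D.th f = D.th e ∨ D.th e * D.th f = D.th f := by
      rcases D.three he hf with h | h | h
      · exact Or.inl h
      · exact Or.inr h
      · rw [hef] at h; exact Or.inl h
    have h2 : D.th f * D.th e = D.th e ∨ D.th f * D.th e = D.th f := by
      rcases D.three hf he with h | h | h
      · exact Or.inr h
      · exact Or.inl h
      · rw [idem_comm hf he, hef] at h; exact Or.inl h
    rcases h1 with h1 | h1 <;> rcases h2 with h2 | h2
    · exact Or.inl ⟨h1, h2⟩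
    · exfalso
      exact noswap e f he hf hef hne (pair_psa eq_comm (ti e he) (ti f hf) (ti f hf) (ti e he)
        (Or.inl ⟨h1, h2⟩) (Or.inr ⟨h2, h1⟩))
    · exfalso
      exact noswap e f he hf hef hne (pair_psa eq_comm (ti e he) (ti f hf) (ti f hf) (ti e he)
        (Or.inr ⟨h1, h2⟩) (Or.inl ⟨h2, h1⟩))
    · exact Or.inr ⟨h1, h2⟩
  have const : ∀ e f g h, IsIdempotentElem e → IsIdempotentElem f → e * f = e → e ≠ f →
      IsIdempotentElem g → IsIdempotentElem h → g * h = g → g ≠ h →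
      D.th e * D.th f = D.th e → D.th g * D.th h = D.th h → False := by
    intro e f g h he hf hef hne hg hh hgh hne2 a b
    have G : IsPSAGraph ({(e, g), (f, h)} : Set (S × S)) :=
      pair_psa (by simp [hne, hne2]) he hf hg hh (Or.inl ⟨hef, hgh⟩)
        (Or.inl ⟨by rw [idem_comm hf he, hef], by rw [idem_comm hh hg, hgh]⟩)
    have m1 := (hD ⟨_, G⟩ e g he hg).1 (by left; rfl)
    have m2 := (hD ⟨_, G⟩ f h hf hh).1 (by right; rfl)
    have m3 := (Φ ⟨_, G⟩).2.2.2 _ m1 _ m2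
    dsimp only at m3
    rw [a, b] at m3
    exact hne2 (D.inj hg hh ((Φ ⟨_, G⟩).2.1 _ m1 _ m3 rfl))
  by_cases hdn : ∃ g h, IsIdempotentElem g ∧ IsIdempotentElem h ∧ g * h = g ∧ g ≠ h ∧
      D.th g * D.th h = D.th h
  · right
    obtain ⟨g, h, hg, hh, hgh, hne2, hd⟩ := hdn
    have down : ∀ e f, IsIdempotentElem e → IsIdempotentElem f → e * f = e → e ≠ f →
        (D.th e * D.th f = D.th f ∧ D.th f * D.th e = D.th f) := by
      intro e f he hf hef hne
      rcases dich e f he hf hef hne with h1 | h1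
      · exact (const e f g h he hf hef hne hg hh hgh hne2 h1.1 hd).elim
      · exact h1
    intro e f he hf
    constructor
    · by_contra hc
      push Not at hc
      have hc2 : e * f ≠ f := by rw [idem_comm he hf]; exact hc.2
      have ig := idem_mul he hf
      have d1 := down (e * f) e ig he (by rw [idem_comm he hf, mul_assoc, he]) hc.1
      have d2 := down (e * f) f ig hf (by rw [mul_assoc, hf]) hc2
      have n1 : D.th e * D.th f ≠ D.th (e * f) := by
        intro h1
        have : D.th e * (D.th e * D.th f) = D.th e := by rw [h1, d1.2]
        rw [← mul_assoc, ti e he, h1] at this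
        exact hc.1 (D.inj ig he this)
      have n2 : D.th f * D.th e ≠ D.th (e * f) := by
        intro h1
        have : D.th f * (D.th f * D.th e) = D.th f := by rw [h1, d2.2]
        rw [← mul_assoc, ti f hf, h1] at this
        exact hc2 (D.inj ig hf this)
      have h1 : D.th e * D.th f = D.th e ∨ D.th e * D.th f = D.th f := by
        rcases D.three he hf with h | h | h
        · exact Or.inl h
        · exact Or.inr h
        · exact absurd h n1
      have h2 : D.th f * D.th e = D.th e ∨ D.th f * D.th e = D.th f := by
        rcases D.three hf he with h | h | h
        · exact Or.inr h
        · exact Or.inl h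
        · rw [idem_comm hf he] at h; exact absurd h n2
      rcases D.closed2 he hf h1 h2 with h | h
      · exact hc.1 h
      · exact hc2 h
    · intro hef
      by_cases hne : e = f
      · subst hne; exact ⟨ti e he, ti e he⟩
      · exact down e f he hf hef hne
  · left
    have up : ∀ e f, IsIdempotentElem e → IsIdempotentElem f → e * f = e → 
        (D.th e * D.th f = D.th e ∧ D.th f * D.th e = D.th e) := by
      intro e f he hf hef
      by_cases hne : e = f
      · subst hne; exact ⟨ti e he, ti e he⟩
      rcases dich e f he hf hef hne with h1 | h1
      · exact h1
      · exact (hdn ⟨e, f, he, hf, hef, hne, h1.1⟩).elim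
    intro e f he hf
    by_cases c1 : e * f = e
    · rw [c1, (up e f he hf c1).1]
    by_cases c2 : e * f = f
    · rw [c2, (up f e hf he (by rw [idem_comm hf he, c2])).2]
    have ig := idem_mul he hf
    have u1 := up (e * f) e ig he (by rw [idem_comm he hf, mul_assoc, he])
    have u2 := up (e * f) f ig hf (by rw [mul_assoc, hf])
    rcases D.three he hf with h | h | h
    · exfalso
      rcases D.three hf he with h' | h' | h'
      · rcases D.closed2 he hf (Or.inl h) (Or.inr h') with x | x
        · exact c1 x
        · exact c2 x
      · rcases D.closed2 he hf (Or.inl h) (Or.inl h') with x | x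
        · exact c1 x
        · exact c2 x
      · rw [idem_comm hf he] at h'
        have : D.th e * D.th f * D.th e = D.th e := by rw [h, ti e he]
        rw [mul_assoc, h', u1.2] at this
        exact c1 (D.inj ig he this)
    · exfalso
      rcases D.three hf he with h' | h' | h'
      · rcases D.closed2 he hf (Or.inr h) (Or.inr h') with x | x
        · exact c1 x
        · exact c2 x
      · rcases D.closed2 he hf (Or.inr h) (Or.inl h') with x | x
        · exact c1 x
        · exact c2 x
      · rw [idem_comm hf he] at h'
        have : D.th f * (D.th e * D.th f) = D.th f := by rw [h, ti f hf]
        rw [← mul_assoc, h', u2.1] at this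
        exact c2 (D.inj ig hf this)
    · exact h.symm

end LD0


section DownCase
variable {S T : Type*} [InverseSemigroup S] [Semigroup T]

theorem down_abs1 {a b u z : T} (h1 : a * b * a = a) (h2 : b * a * b = b) (hu : a * b = u) (hz : b * a = z)
    (zu : z * u = z) (uz : u * z = z) (hl : (b * z * a) * (b * z * a) = b * z * a → z * (b * z * a) = z) :
    z = u := by
  have zz : z * z = z := by rw [← hz, ← mul_assoc, h2]
  have k1 : (b * z * a) * (b * z * a) = b * z * a := by
    calc (b * z * a) * (b * z * a) = b * (z * (a * b) * z) * a := by simp only [mul_assoc]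
      _ = b * z * a := by rw [hu, zu, zz]
  have k2 := hl k1
  have k3 : b * z * a = z := by
    calc b * z * a = (b * a * b) * z * a := by rw [h2]
      _ = (b * a) * (b * z * a) := by simp only [mul_assoc]
      _ = z := by rw [hz, k2]
  calc z = u * z * u := by rw [uz, zu]
    _ = a * (b * z * a) * b := by rw [← hu]; simp only [mul_assoc]
    _ = a * (b * a) * b := by rw [k3, hz]
    _ = u := by rw [← hu, ← mul_assoc, h1]

theorem down_abs2 {a b u v z : T} (h1 : a * b * a = a) (h2 : b * a * b = b) (hu : a * b = u)
    (hv : b * a = v) (vu : v * u = u) (uv : u * v = u) (zv : z * v = z) (vz : v * z = z)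
    (zz : z * z = z) (uz : u * z = z)
    (hd : (a * u * b) * (a * u * b) = a * u * b → u * (a * u * b) = u ∨ a * u * b = z)
    (hl : (a * z * b) * (a * z * b) = a * z * b → z * (a * z * b) = z) :
    v = u ∨ z = u := by
  have uu : u * u = u := by rw [← hu, ← mul_assoc, h1]
  have vv : v * v = v := by rw [← hv, ← mul_assoc, h2]
  have k1 : (a * u * b) * (a * u * b) = a * u * b := by
    calc (a * u * b) * (a * u * b) = a * (u * (b * a) * u) * b := by simp only [mul_assoc]
      _ = a * u * b := by rw [hv, uv, uu]
  rcases hd k1 with h | h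
  · left
    have k2 : a * u * b = u := by
      calc a * u * b = (a * b * a) * u * b := by rw [h1]
        _ = (a * b) * (a * u * b) := by simp only [mul_assoc]
        _ = u := by rw [hu, h]
    calc v = b * (a * b) * a := by rw [← mul_assoc, h2, hv]
      _ = b * (a * u * b) * a := by rw [hu, k2]
      _ = v * u * v := by rw [← hv]; simp only [mul_assoc]
      _ = u := by rw [vu, uv]
  · right
    have k2 : (a * z * b) * (a * z * b) = a * z * b := by
      calc (a * z * b) * (a * z * b) = a * (z * (b * a) * z) * b := by simp only [mul_assoc]
        _ = a * z * b := by rw [hv, zv, zz]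
    have k3 : a * z * b = a * u * b := by
      calc a * z * b = a * (u * (b * a) * z) * b := by rw [hv, uv, uz]
        _ = (a * u * b) * (a * z * b) := by simp only [mul_assoc]
        _ = z := by rw [h, hl k2]
        _ = a * u * b := h.symm
    calc z = v * z * v := by rw [vz, zv]
      _ = b * (a * z * b) * a := by rw [← hv]; simp only [mul_assoc]
      _ = b * (a * u * b) * a := by rw [k3]
      _ = v * u * v := by rw [← hv]; simp only [mul_assoc]
      _ = u := by rw [vu, uv]

theorem down_lt (D : LData S T) (hDn : D.Down) {x : S} (hx : x ∈ NS S)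
    (hle : x⁻¹ * x * (x * x⁻¹) = x⁻¹ * x) : False := by
  obtain ⟨p, hp⟩ := exists_gen D.L (sharp_NS hx)
  obtain ⟨q, hq⟩ := exists_gen D.L (sharp_NS (inv_NS hx))
  have hA : D.L (mono x ⊔ mono x⁻¹) = mono p ⊔ mono q := by rw [map_sup, hp, hq]
  obtain ⟨r1, r2, r3, r4⟩ := bic_rel hle
  have ie := idem_r x
  have jf := idem_l x
  have heA : x * x⁻¹ ∈ mono x ⊔ mono x⁻¹ := mul_mem (left_mem_sup _ _) (right_mem_sup _ _)
  have hfA : x⁻¹ * x ∈ mono x ⊔ mono x⁻¹ := mul_mem (right_mem_sup _ _) (left_mem_sup _ _)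
  have nfp : x⁻¹ * x ∉ mono x := by
    have := not_mem_mono_rng' (inv_NS hx); rwa [ii] at this
  have nfq : x⁻¹ * x ∉ mono x⁻¹ := by
    have := not_mem_mono_rng (inv_NS hx); rwa [ii] at this
  obtain ⟨fe, ef⟩ := (hDn _ _ jf ie).2 hle
  have hne : D.th (x * x⁻¹) ≠ D.th (x⁻¹ * x) := fun h => hx (D.inj ie jf h)
  obtain ⟨a, ha, b, hb, h1, h2, h3, h4⟩ := lemC (p := p) (q := q) (D.hi _ jf)
    (by rw [← hA, D.mem jf]; exact hfA) (by rw [← hp, D.mem jf]; exact nfp)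
    (by rw [← hq, D.mem jf]; exact nfq)
    (D.hi _ ie) (by rw [← hA, D.mem ie]; exact heA) (by rw [fe, ef]) (by rw [fe]; exact hne)
  have least : ∀ w ∈ mono p ⊔ mono q, w * w = w →
      D.th (x * x⁻¹) * w = D.th (x * x⁻¹) ∧ w * D.th (x * x⁻¹) = D.th (x * x⁻¹) := by
    intro w hw iw
    obtain ⟨i, hi, rfl⟩ := D.hs w iw
    rw [← hA, D.mem hi] at hw
    have := (hDn _ _ hi ie).2 (sup_right_id r2 r4 hw)
    exact ⟨this.2, this.1⟩
  have dich : ∀ w ∈ mono p ⊔ mono q, w * w = w → w = D.th (x * x⁻¹) ∨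
      (D.th (x⁻¹ * x) * w = D.th (x⁻¹ * x) ∧ w * D.th (x⁻¹ * x) = D.th (x⁻¹ * x)) := by
    intro w hw iw
    obtain ⟨i, hi, rfl⟩ := D.hs w iw
    rw [← hA, D.mem hi] at hw
    rcases normForm_l rfl r1 r2 r3 r4 hw with h | ⟨n, h⟩ | h
    · left; rw [h]
    · exfalso
      rw [h] at hi
      exact bic_idem hx hle hi
    · right
      have := (hDn _ _ hi jf).2 (by rw [idem_comm hi jf, h])
      exact ⟨this.2, this.1⟩
  have ivv : (b * a) * (b * a) = b * a := by rw [← mul_assoc, h2]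
  have izz : D.th (x * x⁻¹) * D.th (x * x⁻¹) = D.th (x * x⁻¹) := D.hi _ ie
  have hzA : D.th (x * x⁻¹) ∈ mono p ⊔ mono q := by rw [← hA, D.mem ie]; exact heA
  have huA : D.th (x⁻¹ * x) ∈ mono p ⊔ mono q := by rw [← hA, D.mem jf]; exact hfA
  have hvA := mul_mem hb ha
  rcases dich _ hvA ivv with h | ⟨h5, h6⟩
  · exact hne (down_abs1 h1 h2 h3 h ef fe
      (fun k => (least _ (mul_mem (mul_mem hb hzA) ha) k).1))
  · obtain ⟨l1, l2⟩ := least _ hvA ivv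
    rcases down_abs2 h1 h2 h3 rfl h6 h5 l1 l2 izz fe
      (fun k => (dich _ (mul_mem (mul_mem ha huA) hb) k).symm.imp (fun h => h.1) id)
      (fun k => (least _ (mul_mem (mul_mem ha hzA) hb) k).1) with h | h
    · exact h4 h
    · exact hne h

theorem down_idem (hNI : NoIsolatedNontrivial S) (D : LData S T) (hDn : D.Down) (s : S) :
    IsIdempotentElem s := by
  have hN : ∀ x : S, x ∉ NS S := by
    intro x hx
    rcases (hDn _ _ (idem_r x) (idem_l x)).1 with h | h
    · exact down_lt D hDn (inv_NS hx) (by rw [ii]; exact h)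
    · exact down_lt D hDn hx h
  by_contra h
  obtain ⟨x, hx, _⟩ := group_split hNI (hN s) h
  exact hN x hx

theorem band_le {M : Type*} [Semigroup M] (hi : ∀ a : M, a * a = a) (hc : ∀ a b : M, a * b = b * a)
    (a b : M) : natLeSg a b ↔ a * b = a := by
  constructor
  · rintro ⟨e, _, rfl⟩
    rw [mul_assoc, hi]
  · intro h
    exact ⟨a, hi a, h.symm⟩

theorem down_final (hNI : NoIsolatedNontrivial S) (D : LData S T) (hDn : D.Down) :
    IsInverseSgp T ∧ (∀ a b : S, natLeSg a b ∨ natLeSg b a) ∧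
      (∀ a b : T, natLeSg a b ∨ natLeSg b a) ∧
      ∃ δ : S → T, Function.Bijective δ ∧ ∀ a b : S, natLeSg a b ↔ natLeSg (δ b) (δ a) := by
  have hS := down_idem hNI D hDn
  have hSc : ∀ a b : S, a * b = b * a := fun a b => idem_comm (hS a) (hS b)
  have sur : Function.Surjective D.th := by
    intro t
    have ht : t ∈ D.L ⊤ := by rw [map_top]; trivial
    obtain ⟨i, _, h⟩ := D.band (C := ⊤) (fun c _ => hS c) ht
    exact ⟨i, h.symm⟩
  have inj : Function.Injective D.th := fun a b h => D.inj (hS a) (hS b) h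
  have hT : ∀ t : T, t * t = t := by
    intro t
    obtain ⟨i, rfl⟩ := sur t
    exact D.hi i (hS i)
  have hTc : ∀ a b : T, a * b = b * a := by
    intro a b
    obtain ⟨i, rfl⟩ := sur a
    obtain ⟨j, rfl⟩ := sur b
    rcases (hDn i j (hS i) (hS j)).1 with h | h
    · obtain ⟨k1, k2⟩ := (hDn i j (hS i) (hS j)).2 h; rw [k1, k2]
    · obtain ⟨k1, k2⟩ := (hDn j i (hS j) (hS i)).2 h; rw [k1, k2]
  have key : ∀ a b : S, natLeSg a b ↔ natLeSg (D.th b) (D.th a) := by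
    intro a b
    rw [band_le hS hSc, band_le hT hTc]
    constructor
    · intro h; exact ((hDn a b (hS a) (hS b)).2 h).2
    · intro h
      rcases (hDn a b (hS a) (hS b)).1 with k | k
      · exact k
      · have := ((hDn b a (hS b) (hS a)).2 k).1
        rw [h] at this
        rw [inj this]; exact hS a
  have chS : ∀ a b : S, natLeSg a b ∨ natLeSg b a := by
    intro a b
    rw [band_le hS hSc, band_le hS hSc]
    exact (hDn a b (hS a) (hS b)).1
  refine ⟨?_, chS, ?_, D.th, ⟨inj, sur⟩, key⟩
  · intro a
    refine ⟨a, by simp [hT], ?_⟩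
    rintro b ⟨h1, h2⟩
    calc b = b * a * b := h2.symm
      _ = a * b * b := by rw [hTc b a]
      _ = a * b * a := by rw [mul_assoc, hT, mul_assoc, hTc b a, ← mul_assoc, hT]
      _ = a := h1
  · intro a b
    obtain ⟨i, rfl⟩ := sur a
    obtain ⟨j, rfl⟩ := sur b
    rw [← key, ← key]
    exact (chS i j).symm

end DownCase

section Backward
variable {M N : Type*} [Semigroup M] [Semigroup N]

/-- transport of a graph along an equivalence -/
def trG (φ : M ≃ N) (α : Set (M × M)) : Set (N × N) := {p | (φ.symm p.1, φ.symm p.2) ∈ α}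

theorem trans_iso (φ : M ≃ N) (h1 : ∀ α, IsPSAGraph α → IsPSAGraph (trG φ α))
    (h2 : ∀ α, IsPSAGraph α → IsPSAGraph (trG φ.symm α)) :
    ∃ Φ : PSA M ≃ PSA N, ∀ α β : PSA M, Φ (psacomp α β) = psacomp (Φ α) (Φ β) := by
  refine ⟨{ toFun := fun α => ⟨trG φ α.1, h1 _ α.2⟩
            invFun := fun α => ⟨trG φ.symm α.1, h2 _ α.2⟩
            left_inv := ?_
            right_inv := ?_ }, ?_⟩
  · intro α; apply Subtype.ext; ext ⟨a, b⟩; simp [trG]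
  · intro α; apply Subtype.ext; ext ⟨a, b⟩; simp [trG]
  · intro α β
    apply Subtype.ext
    ext ⟨a, b⟩
    constructor
    · rintro ⟨c, k1, k2⟩
      refine ⟨φ c, ?_, ?_⟩
      · show (φ.symm a, φ.symm (φ c)) ∈ α.1
        rw [φ.symm_apply_apply]; exact k1
      · show (φ.symm (φ c), φ.symm b) ∈ β.1
        rw [φ.symm_apply_apply]; exact k2
    · rintro ⟨c, k1, k2⟩
      exact ⟨φ.symm c, k1, k2⟩

theorem tr_hom (φ : M ≃ N) (h : ∀ a b, φ.symm (a * b) = φ.symm a * φ.symm b) (α : Set (M × M))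
    (hα : IsPSAGraph α) : IsPSAGraph (trG φ α) := by
  obtain ⟨f, i, m⟩ := hα
  refine ⟨?_, ?_, ?_⟩
  · rintro ⟨a, b⟩ hp ⟨c, d⟩ hq h
    exact φ.symm.injective (f _ hp _ hq (congrArg φ.symm h))
  · rintro ⟨a, b⟩ hp ⟨c, d⟩ hq h
    exact φ.symm.injective (i _ hp _ hq (congrArg φ.symm h))
  · rintro ⟨a, b⟩ hp ⟨c, d⟩ hq
    have := m _ hp _ hq
    simp only [trG, Set.mem_ofPred_eq, h]
    exact this

theorem back_iso (φ : M → N) (hb : Function.Bijective φ) (h : ∀ a b, φ (a * b) = φ a * φ b) :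
    ∃ Φ : PSA M ≃ PSA N, ∀ α β : PSA M, Φ (psacomp α β) = psacomp (Φ α) (Φ β) := by
  let ψ := Equiv.ofBijective φ hb
  have hψ : ∀ a b, ψ (a * b) = ψ a * ψ b := h
  refine trans_iso ψ (tr_hom ψ ?_) (tr_hom ψ.symm hψ)
  intro a b
  apply ψ.injective
  rw [hψ]; simp

/-- chain semilattices -/
def ChainSL (M : Type*) [Semigroup M] : Prop :=
  (∀ a : M, a * a = a) ∧ (∀ a b : M, a * b = b * a) ∧ ∀ a b : M, a * b = a ∨ a * b = b

theorem tr_dual (hM : ChainSL M) (hN : ChainSL N) (φ : M ≃ N)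
    (h : ∀ a b, φ.symm a * φ.symm b = φ.symm a → a * b = b) (α : Set (M × M))
    (hα : IsPSAGraph α) : IsPSAGraph (trG φ α) := by
  obtain ⟨f, i, m⟩ := hα
  refine ⟨?_, ?_, ?_⟩
  · rintro ⟨a, b⟩ hp ⟨c, d⟩ hq h
    exact φ.symm.injective (f _ hp _ hq (congrArg φ.symm h))
  · rintro ⟨a, b⟩ hp ⟨c, d⟩ hq h
    exact φ.symm.injective (i _ hp _ hq (congrArg φ.symm h))
  · rintro ⟨a, b⟩ hp ⟨c, d⟩ hq
    have hm := m _ hp _ hq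
    simp only [trG, Set.mem_ofPred_eq] at hm ⊢
    rcases hM.2.2 (φ.symm a) (φ.symm c) with k | k
    · rw [k] at hm
      have k2 : φ.symm b * φ.symm d = φ.symm b := f _ hm _ hp rfl
      rw [h _ _ k, h _ _ k2]
      exact hq
    · rw [k] at hm
      have k2 : φ.symm b * φ.symm d = φ.symm d := f _ hm _ hq rfl
      rw [hM.2.1] at k k2
      rw [hN.2.1 a c, hN.2.1 b d, h _ _ k, h _ _ k2]
      exact hp

theorem chainSL_of {S : Type*} [InverseSemigroup S] (h : ∀ a b : S, natLeSg a b ∨ natLeSg b a) :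
    ChainSL S := by
  have h' : ∀ a b : S, natLe a b ∨ natLe b a := h
  have hinv : ∀ a : S, a⁻¹ = a := by
    intro a
    rcases h' a a⁻¹ with k | k
    · have := natLe_inv k
      rw [ii] at this
      exact natLe_antisymm this k
    · have := natLe_inv k
      rw [ii] at this
      exact natLe_antisymm k this
  have hid : ∀ a : S, a * a = a := by
    intro a
    have i1 := idem_r a
    rcases h' a (a * a⁻¹) with k | k
    · exact natLe_idem i1 k
    · have := natLe_eq_of_rng k (by rw [idem_inv i1]; exact i1)
      rw [hinv] at this
      exact this
  have hc : ∀ a b : S, a * b = b * a := fun a b => idem_comm (hid a) (hid b)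
  refine ⟨hid, hc, ?_⟩
  intro a b
  rcases h a b with k | k
  · left; exact (band_le hid hc _ _).1 k
  · right; rw [hc]; exact (band_le hid hc _ _).1 k

theorem chainSL_of' (hT : IsInverseSgp N) (h : ∀ a b : N, natLeSg a b ∨ natLeSg b a) :
    ChainSL N := by
  letI := invOf hT
  exact chainSL_of (S := N) h

theorem back_chain (hM : ChainSL M) (hN : ChainSL N) (δ : M → N) (hb : Function.Bijective δ)
    (h : ∀ a b, natLeSg a b ↔ natLeSg (δ b) (δ a)) :
    ∃ Φ : PSA M ≃ PSA N, ∀ α β : PSA M, Φ (psacomp α β) = psacomp (Φ α) (Φ β) := by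
  let ψ := Equiv.ofBijective δ hb
  have hψ : ∀ a b, a * b = a ↔ ψ b * ψ a = ψ b := by
    intro a b
    rw [← band_le hM.1 hM.2.1, ← band_le hN.1 hN.2.1]; exact h a b
  refine trans_iso ψ (tr_dual hM hN ψ ?_) (tr_dual hN hM ψ.symm ?_)
  · intro a b k
    have := (hψ _ _).1 k
    rw [ψ.apply_symm_apply, ψ.apply_symm_apply] at this
    rw [hN.2.1]; exact this
  · intro a b k
    have := (hψ b a).2 k
    rw [hM.2.1]; exact this

end Backward

/-- for a tightly connected fundamental inverse semigroup `S` with no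
isolated nontrivial subgroups and an arbitrary semigroup `T`, the monoids `PSA S`
and `PSA T` are isomorphic iff either `S ≅ T` as semigroups, or `T` is an inverse
semigroup, `(S, ≤)` and `(T, ≤)` are chains for their natural partial orders, and
there is a dual order-isomorphism of `(S, ≤)` onto `(T, ≤)`. -/
theorem stmt10 {S T : Type*} [InverseSemigroup S] [Semigroup T]
    (hTC : TightlyConnected S) (hF : Fundamental S) (hNI : NoIsolatedNontrivial S) :
    (∃ Φ : PSA S ≃ PSA T, ∀ α β : PSA S, Φ (psacomp α β) = psacomp (Φ α) (Φ β)) ↔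
      ((∃ φ : S → T, Function.Bijective φ ∧ ∀ a b : S, φ (a * b) = φ a * φ b) ∨
        (IsInverseSgp T ∧
          (∀ a b : S, natLeSg a b ∨ natLeSg b a) ∧
          (∀ a b : T, natLeSg a b ∨ natLeSg b a) ∧
          ∃ δ : S → T, Function.Bijective δ ∧
            ∀ a b : S, natLeSg a b ↔ natLeSg (δ b) (δ a))) := by
  constructor
  · rintro ⟨Φ, hΦ⟩
    obtain ⟨D, hU | hD⟩ := up_or_down Φ hΦ
    · exact Or.inl (iso_of_up' hTC hF hNI D hU)
    · exact Or.inr (down_final hNI D hD)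
  · rintro (⟨φ, hb, hm⟩ | ⟨hT, hS, hTc, δ, hb, hd⟩)
    · exact back_iso φ hb hm
    · exact back_chain (chainSL_of hS) (chainSL_of' hT hTc) δ hb hd
end

section
/- A combinatorial inverse semigroup is shortly connected if and only if it is tightly connected. -/
/-- In a combinatorial inverse semigroup every group element is idempotent. -/
theorem combinatorial_ns_or_idem {S : Type*} [InverseSemigroup S] (h : Combinatorial S)
    (x : S) : x ∈ NS S ∨ IsIdempotentElem x := by
  by_cases hx : x * x⁻¹ = x⁻¹ * x
  · right
    have he : x * x⁻¹ * (x * x⁻¹) = x * x⁻¹ := by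
      rw [← mul_assoc, InverseSemigroup.mul_inv_mul]
    have hinv : x * x⁻¹ = (x * x⁻¹)⁻¹ :=
      InverseSemigroup.inv_unique _ _ (by rw [he, he]) (by rw [he, he])
    have hxe : x = x * x⁻¹ := by
      apply h
      · rw [← hinv, he]
      · rw [← hinv, he, hx]
    rw [hxe]
    exact he
  · exact Or.inl hx

/-- a combinatorial inverse semigroup is shortly connected iff it
is tightly connected. -/
theorem stmt13 {S : Type*} [InverseSemigroup S] (h : Combinatorial S) :
    ShortlyConnected S ↔ TightlyConnected S := by
  constructor
  · intro hs x _ e he hlt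
    obtain ⟨n, hn, es, h0, h1, h2, h3⟩ := hs x e he hlt
    exact ⟨n, hn, es, h0, h1, h2, fun k hk hkn =>
      ⟨(h3 k hk hkn).1, (h3 k hk hkn).2, combinatorial_ns_or_idem h _⟩⟩
  · intro ht x e he hlt
    obtain ⟨n, hn, es, h0, h1, h2, h3⟩ := ht x (combinatorial_ns_or_idem h x) e he hlt
    exact ⟨n, hn, es, h0, h1, h2, fun k hk hkn =>
      ⟨(h3 k hk hkn).1, (h3 k hk hkn).2.1⟩⟩
end
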